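/- Let q ≥ 2 be an integer and β > q, let λ ∈ (0,1) be a constant, and let Ĉ > 0 be a constant. Let 𝒱 = {V₁,…,V_q} be a λ-partition of V, and let X_t, Y_t be two configurations whose projections A_t, A_t′ satisfy: (A1) ‖α(X_t) − m‖_∞ ≤ Ĉ/√n and ‖α(Y_t) − m‖_∞ ≤ Ĉ/√n; and (A2) |α_{1,i}(X_t) − α_{1,i}(Y_t)| ≤ Ĉ/√|V_i| for all i ∈ [q]. Then there exists a constant ρ > 0 (depending only on λ, Ĉ, β, q) and a coupling of one SW step from X_t with one SW step from Y_t such that, for all sufficiently large n, A_{t+1} = A_{t+1}′ with probability at least ρ. -/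

import Mathlib

open scoped Classical
open Finset

/-- Spin configurations on `n` vertices with `q` spins. -/
abbrev Conf (n q : ℕ) := Fin n → Fin q

/-- Number of vertices assigned spin `j`. -/
def cntN {n q : ℕ} (X : Conf n q) (j : Fin q) : ℕ :=
  (Finset.univ.filter (fun v => X v = j)).card

/-- Number of monochromatic pairs `{u,v}` (`u < v`, same spin). -/
def numMono {n q : ℕ} (σ : Conf n q) : ℕ :=
  (Finset.univ.filter (fun p : Fin n × Fin n => p.1 < p.2 ∧ σ p.1 = σ p.2)).card

/-- The mean-field `q`-state Potts measure: probability of `σ`. -/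
noncomputable def pottsProb (n q : ℕ) (β : ℝ) (σ : Conf n q) : ℝ :=
  Real.exp (β / n * numMono σ) / ∑ τ : Conf n q, Real.exp (β / n * numMono τ)

/-- The set of monochromatic pairs of a configuration. -/
def monoPairs {n q : ℕ} (σ : Conf n q) : Finset (Fin n × Fin n) :=
  Finset.univ.filter (fun p : Fin n × Fin n => p.1 < p.2 ∧ σ p.1 = σ p.2)

/-- The graph on `Fin n` whose edges are the pairs in `E`. -/
def graphOf {n : ℕ} (E : Finset (Fin n × Fin n)) : SimpleGraph (Fin n) :=
  SimpleGraph.fromRel (fun u v => (u, v) ∈ E)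

/-- Number of connected components of the graph `(V, E)`. -/
noncomputable def numComps {n : ℕ} (E : Finset (Fin n × Fin n)) : ℕ :=
  Nat.card (graphOf E).ConnectedComponent

/-- One-step transition probability of the Swendsen–Wang dynamics:
percolate on monochromatic pairs with probability `p = 1 - exp (-β/n)`,
then color each connected component uniformly at random. -/
noncomputable def swStep (n q : ℕ) (β : ℝ) (σ τ : Conf n q) : ℝ :=
  ∑ E ∈ (monoPairs σ).powerset,
    ((1 - Real.exp (-(β / n))) ^ E.card *
        Real.exp (-(β / n)) ^ ((monoPairs σ).card - E.card)) *
      (if ∀ u v : Fin n, (graphOf E).Reachable u v → τ u = τ v then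
        ((q : ℝ))⁻¹ ^ numComps E else 0)

/-- `t`-step transition probability of the Swendsen–Wang dynamics. -/
noncomputable def swProb (n q : ℕ) (β : ℝ) : ℕ → Conf n q → Conf n q → ℝ
  | 0, σ, τ => if σ = τ then 1 else 0
  | t + 1, σ, τ => ∑ η : Conf n q, swStep n q β σ η * swProb n q β t η τ

/-- Probability of observing the trajectory `ω 0, ω 1, …, ω (ℓ-1)` at times
`1, …, ℓ` for the SW dynamics started at `X₀`. -/
noncomputable def pathProb (n q : ℕ) (β : ℝ) (X₀ : Conf n q) (ℓ : ℕ)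
    (ω : Fin ℓ → Conf n q) : ℝ :=
  ∏ i : Fin ℓ, swStep n q β
    (if _h : 0 < (i : ℕ) then
        ω ⟨(i : ℕ) - 1, lt_of_le_of_lt (Nat.sub_le _ _) i.isLt⟩
      else X₀) (ω i)

/-- Total variation distance between two probability vectors on configurations. -/
noncomputable def tvDist {n q : ℕ} (f g : Conf n q → ℝ) : ℝ :=
  (∑ τ : Conf n q, |f τ - g τ|) / 2

/-- Mixing time `τ_mix(ε)` of the SW dynamics. -/
noncomputable def mixingTime (n q : ℕ) (β ε : ℝ) : ℕ :=
  sInf {t : ℕ | ∀ σ : Conf n q, tvDist (swProb n q β t σ) (pottsProb n q β) ≤ ε}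

/-- `theta lam` is the unique root in `(0,1)` of `exp (-lam * x) = 1 - x`
for `lam > 1`, and `0` for `lam ≤ 1`. -/
noncomputable def theta (lam : ℝ) : ℝ :=
  if lam ≤ 1 then 0
  else sSup {x : ℝ | x ∈ Set.Ioo (0 : ℝ) 1 ∧ Real.exp (-lam * x) = 1 - x}

/-- The drift function `F`. -/
noncomputable def F (q : ℕ) (β : ℝ) (x : ℝ) : ℝ :=
  1 / q + (1 - 1 / q) * theta (β * x) * x

/-- The unique fixed point of `F` in `(1/q, 1]` (for `β > q`). -/
noncomputable def aFix (q : ℕ) (β : ℝ) : ℝ :=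
  sSup {x : ℝ | x ∈ Set.Ioc (1 / (q : ℝ)) 1 ∧ F q β x = x}

/-- The cutoff constant `c(β,q) = (2 log (1 / F'(a)))⁻¹`. -/
noncomputable def cConst (q : ℕ) (β : ℝ) : ℝ :=
  (2 * Real.log (1 / deriv (F q β) (aFix q β)))⁻¹

/-- Fraction of vertices assigned spin `j`. -/
noncomputable def cntFrac {n q : ℕ} (X : Conf n q) : Fin q → ℝ :=
  fun j => (cntN X j : ℝ) / n

/-- The proportions vector `α(X)`: fractions of vertices of each spin,
sorted in nonincreasing order. -/
noncomputable def alphaVec {n q : ℕ} (X : Conf n q) : Fin q → ℝ :=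
  fun i => cntFrac X (Tuple.sort (cntFrac X) i.rev)

/-- `ℓ∞` distance between two vectors indexed by `Fin q`. -/
noncomputable def linf {q : ℕ} (f g : Fin q → ℝ) : ℝ :=
  ⨆ i : Fin q, |f i - g i|

/-- The vector `κ(b) = (b, (1-b)/(q-1), …, (1-b)/(q-1))`. -/
noncomputable def kappaVec (q : ℕ) (b : ℝ) : Fin q → ℝ :=
  fun i => if (i : ℕ) = 0 then b else (1 - b) / ((q : ℝ) - 1)

/-- The majority vector `m = (a, (1-a)/(q-1), …, (1-a)/(q-1))`. -/
noncomputable def mVec (q : ℕ) (β : ℝ) : Fin q → ℝ :=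
  kappaVec q (aFix q β)

/-- Index of the most common spin of `X` (least such index on ties). -/
noncomputable def domIdx {n q : ℕ} (X : Conf n q) : ℕ :=
  sInf {j : ℕ | ∃ hj : j < q, ∀ j' : Fin q, cntN X j' ≤ cntN X ⟨j, hj⟩}

/-- `α₁(X)`: fraction of vertices carrying the most common spin of `X`. -/
noncomputable def alpha1 {n q : ℕ} (X : Conf n q) : ℝ :=
  ((Finset.univ.filter (fun v : Fin n => (X v : ℕ) = domIdx X)).card : ℝ) / n

/-- `α_{1,k}(X)`: fraction of vertices of `Vk` carrying the most common spin of `X`. -/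
noncomputable def alpha1In {n q : ℕ} (X : Conf n q) (Vk : Finset (Fin n)) : ℝ :=
  ((Vk.filter (fun v => (X v : ℕ) = domIdx X)).card : ℝ) / Vk.card

/-- `P` is a partition of the vertex set into `q` classes. -/
def IsPartition {n q : ℕ} (P : Fin q → Finset (Fin n)) : Prop :=
  (∀ i j, i ≠ j → Disjoint (P i) (P j)) ∧ ∀ v : Fin n, ∃ i, v ∈ P i

/-- A `λ`-partition: a partition with all classes of size at least `λ n`. -/
def IsLamPartition {n q : ℕ} (lam : ℝ) (P : Fin q → Finset (Fin n)) : Prop :=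
  IsPartition P ∧ ∀ i, lam * n ≤ ((P i).card : ℝ)

/-- Projection: `projCnt P X i j` is the number of vertices of `P i`
assigned spin `j` in `X`. -/
def projCnt {n q : ℕ} (P : Fin q → Finset (Fin n)) (X : Conf n q) :
    Fin q → Fin q → ℕ :=
  fun i j => ((P i).filter (fun v => X v = j)).card

/-- All potential edges of the complete graph on `Fin n`. -/
def allPairs (n : ℕ) : Finset (Fin n × Fin n) :=
  Finset.univ.filter (fun p : Fin n × Fin n => p.1 < p.2)

/-- Probability of the edge set `E` under the Erdős–Rényi measure `G(n,p)`. -/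
noncomputable def erProb (n : ℕ) (p : ℝ) (E : Finset (Fin n × Fin n)) : ℝ :=
  p ^ E.card * (1 - p) ^ ((allPairs n).card - E.card)

/-- Size of the connected component of `v` in the graph `(V, E)`. -/
noncomputable def compCard {n : ℕ} (E : Finset (Fin n × Fin n)) (v : Fin n) : ℕ :=
  (Finset.univ.filter (fun u => (graphOf E).Reachable v u)).card

/-- `L₁`: size of the largest connected component. -/
noncomputable def L1 {n : ℕ} (E : Finset (Fin n × Fin n)) : ℕ :=
  Finset.univ.sup (fun v => compCard E v)

/-- Sum of the squares of the component sizes, `Σ_j L_j²`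
(computed as `Σ_v |C(v)|`). -/
noncomputable def sumCompSq {n : ℕ} (E : Finset (Fin n × Fin n)) : ℕ :=
  ∑ v : Fin n, compCard E v

/-- Expectation of `f` under the Erdős–Rényi measure `G(n,p)`. -/
noncomputable def erExp (n : ℕ) (p : ℝ) (f : Finset (Fin n × Fin n) → ℝ) : ℝ :=
  ∑ E ∈ (allPairs n).powerset, erProb n p E * f E

/-- Random-cluster weight of an edge set with parameters `q`, `p = 1 - exp (-β/n)`. -/
noncomputable def rcWeight (n q : ℕ) (β : ℝ) (E : Finset (Fin n × Fin n)) : ℝ :=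
  (1 - Real.exp (-(β / n))) ^ E.card *
    Real.exp (-(β / n)) ^ ((allPairs n).card - E.card) * (q : ℝ) ^ numComps E

/-- The mean-field random-cluster measure: probability of the edge set `E`. -/
noncomputable def rcProb (n q : ℕ) (β : ℝ) (E : Finset (Fin n × Fin n)) : ℝ :=
  rcWeight n q β E / ∑ B ∈ (allPairs n).powerset, rcWeight n q β B

/-- A sub-coupling of two nonnegative weights, supported on the relation `R`, of mass at least `ρ`. -/
def SubC {α β : Type*} [Fintype α] [Fintype β] (f : α → ℝ) (g : β → ℝ)
    (R : α → β → Prop) (ρ : ℝ) : Prop :=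
  ∃ ν : α → β → ℝ, (∀ a b, 0 ≤ ν a b) ∧ (∀ a, ∑ b, ν a b ≤ f a) ∧ (∀ b, ∑ a, ν a b ≤ g b) ∧
    (∀ a b, ¬ R a b → ν a b = 0) ∧ ρ ≤ ∑ a, ∑ b, ν a b

namespace SubC

variable {α β : Type*} [Fintype α] [Fintype β]

theorem symm {f : α → ℝ} {g : β → ℝ} {R : α → β → Prop} {ρ : ℝ} (h : SubC f g R ρ) :
    SubC g f (fun b a => R a b) ρ := by
  obtain ⟨ν, h0, h1, h2, h3, h4⟩ := h
  exact ⟨fun b a => ν a b, fun b a => h0 a b, h2, h1, fun b a => h3 a b,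
    by rw [Finset.sum_comm]; exact h4⟩

theorem mono {f : α → ℝ} {g : β → ℝ} {R R' : α → β → Prop} {ρ ρ' : ℝ} (h : SubC f g R ρ)
    (hR : ∀ a b, R a b → R' a b) (hρ : ρ' ≤ ρ) : SubC f g R' ρ' := by
  obtain ⟨ν, h0, h1, h2, h3, h4⟩ := h
  exact ⟨ν, h0, h1, h2, fun a b hab => h3 a b (fun h => hab (hR a b h)), hρ.trans h4⟩

/-- Reindexing the second weight along an equivalence. -/
theorem comp_equiv {f : α → ℝ} {g : β → ℝ} {R : α → β → Prop} {ρ : ℝ} (e : β ≃ β)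
    (h : SubC f g R ρ) : SubC f (fun b => g (e b)) (fun a b => R a (e b)) ρ := by
  obtain ⟨ν, h0, h1, h2, h3, h4⟩ := h
  refine ⟨fun a b => ν a (e b), fun a b => h0 _ _, fun a => ?_, fun b => h2 _,
    fun a b => h3 _ _, ?_⟩
  · rw [Equiv.sum_comp e (fun b => ν a b)]; exact h1 a
  · exact h4.trans_eq (Finset.sum_congr rfl fun a _ => (Equiv.sum_comp e (fun b => ν a b)).symm)

/-- Sub-couplings of mixtures. -/
theorem mixture {σ τ : Type*} [Fintype σ] [Fintype τ] {u : σ → ℝ} {v : τ → ℝ}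
    {F : σ → α → ℝ} {G : τ → β → ℝ} {Q : σ → τ → Prop} {R : α → β → Prop} {ρ₁ ρ₂ : ℝ}
    (huv : SubC u v Q ρ₁) (hF : ∀ s a, 0 ≤ F s a) (hG : ∀ s b, 0 ≤ G s b) (hρ₂ : 0 ≤ ρ₂)
    (h : ∀ s s', Q s s' → SubC (F s) (G s') R ρ₂) :
    SubC (fun a => ∑ s, u s * F s a) (fun b => ∑ s, v s * G s b) R (ρ₁ * ρ₂) := by
  obtain ⟨γ, g0, g1, g2, g3, g4⟩ := huv
  have h' : ∀ s s', ∃ ν : α → β → ℝ, (∀ a b, 0 ≤ ν a b) ∧ (∀ a, ∑ b, ν a b ≤ F s a) ∧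
      (∀ b, ∑ a, ν a b ≤ G s' b) ∧ (∀ a b, ¬ R a b → ν a b = 0) ∧
      γ s s' * ρ₂ ≤ γ s s' * ∑ a, ∑ b, ν a b := by
    intro s s'
    by_cases hq : Q s s'
    · obtain ⟨ν, h0, h1, h2, h3, h4⟩ := h s s' hq
      exact ⟨ν, h0, h1, h2, h3, mul_le_mul_of_nonneg_left h4 (g0 _ _)⟩
    · refine ⟨fun _ _ => 0, fun _ _ => le_rfl, fun a => by simpa using hF s a,
        fun b => by simpa using hG s' b, fun _ _ _ => rfl, by simp [g3 s s' hq]⟩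
  choose ν n0 n1 n2 n3 n4 using h'
  refine ⟨fun a b => ∑ s, ∑ s', γ s s' * ν s s' a b, fun a b => ?_, fun a => ?_, fun b => ?_,
    fun a b hab => ?_, ?_⟩
  · exact Finset.sum_nonneg fun s _ => Finset.sum_nonneg fun s' _ => mul_nonneg (g0 _ _) (n0 _ _ _ _)
  · rw [Finset.sum_comm]
    refine Finset.sum_le_sum fun s _ => ?_
    rw [Finset.sum_comm]
    calc ∑ s', ∑ b, γ s s' * ν s s' a b ≤ ∑ s', γ s s' * F s a := by
          refine Finset.sum_le_sum fun s' _ => ?_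
          rw [← Finset.mul_sum]
          exact mul_le_mul_of_nonneg_left (n1 _ _ _) (g0 _ _)
      _ = (∑ s', γ s s') * F s a := by rw [Finset.sum_mul]
      _ ≤ u s * F s a := mul_le_mul_of_nonneg_right (g1 s) (hF _ _)
  · rw [Finset.sum_comm]
    calc ∑ s, ∑ a, ∑ s', γ s s' * ν s s' a b = ∑ s, ∑ s', γ s s' * ∑ a, ν s s' a b := by
          refine Finset.sum_congr rfl fun s _ => ?_
          rw [Finset.sum_comm]
          simp only [Finset.mul_sum]
      _ ≤ ∑ s, ∑ s', γ s s' * G s' b := by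
          refine Finset.sum_le_sum fun s _ => Finset.sum_le_sum fun s' _ => ?_
          exact mul_le_mul_of_nonneg_left (n2 _ _ _) (g0 _ _)
      _ = ∑ s', (∑ s, γ s s') * G s' b := by
          rw [Finset.sum_comm]; simp only [Finset.sum_mul]
      _ ≤ ∑ s', v s' * G s' b :=
          Finset.sum_le_sum fun s' _ => mul_le_mul_of_nonneg_right (g2 s') (hG _ _)
  · exact Finset.sum_eq_zero fun s _ => Finset.sum_eq_zero fun s' _ => by
      rw [n3 s s' a b hab, mul_zero]
  · have e : ∑ a, ∑ b, ∑ s, ∑ s', γ s s' * ν s s' a b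
        = ∑ s, ∑ s', γ s s' * ∑ a, ∑ b, ν s s' a b := by
      simp only [Finset.mul_sum]
      calc ∑ a, ∑ b, ∑ s, ∑ s', γ s s' * ν s s' a b
          = ∑ a, ∑ s, ∑ b, ∑ s', γ s s' * ν s s' a b :=
            Finset.sum_congr rfl fun a _ => Finset.sum_comm
        _ = ∑ s, ∑ a, ∑ b, ∑ s', γ s s' * ν s s' a b := Finset.sum_comm
        _ = ∑ s, ∑ a, ∑ s', ∑ b, γ s s' * ν s s' a b :=
            Finset.sum_congr rfl fun s _ => Finset.sum_congr rfl fun a _ => Finset.sum_comm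
        _ = _ := Finset.sum_congr rfl fun s _ => Finset.sum_comm
    rw [e]
    calc ρ₁ * ρ₂ ≤ (∑ s, ∑ s', γ s s') * ρ₂ := mul_le_mul_of_nonneg_right g4 hρ₂
      _ = ∑ s, ∑ s', γ s s' * ρ₂ := by simp only [Finset.sum_mul]
      _ ≤ _ := Finset.sum_le_sum fun s _ => Finset.sum_le_sum fun s' _ => n4 s s'

/-- Two point masses at related points are coupled with mass one. -/
theorem dirac {R : α → β → Prop} {x : α} {y : β} (h : R x y) :
    SubC (fun a => if x = a then (1 : ℝ) else 0) (fun b => if y = b then (1 : ℝ) else 0) R 1 := by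
  refine ⟨fun a b => if x = a ∧ y = b then 1 else 0, fun a b => ?_, fun a => ?_, fun b => ?_,
    fun a b hab => ?_, ?_⟩
  · positivity
  · by_cases hx : x = a <;> simp [hx]
  · by_cases hy : y = b <;> simp [hy]
  · beta_reduce
    rw [if_neg]; rintro ⟨rfl, rfl⟩; exact hab h
  · simp [ite_and]

/-- The diagonal coupling. -/
theorem diag {f : α → ℝ} (hf : ∀ a, 0 ≤ f a) : SubC f f (fun a b => a = b) (∑ a, f a) := by
  refine ⟨fun a b => if a = b then f a else 0, fun a b => ?_, fun a => ?_, fun b => ?_,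
    fun a b hab => if_neg hab, ?_⟩
  · beta_reduce
    split_ifs; exacts [hf a, le_rfl]
  · simp
  · simp
  · simp

/-- The independent coupling restricted to a product event. -/
theorem indep {f : α → ℝ} {g : β → ℝ} (hf : ∀ a, 0 ≤ f a) (hg : ∀ b, 0 ≤ g b)
    (hf1 : ∑ a, f a ≤ 1) (hg1 : ∑ b, g b ≤ 1) (A : α → Prop) (B : β → Prop) {ρ₁ ρ₂ : ℝ}
    (h₂ : 0 ≤ ρ₂)
    (hA : ρ₁ ≤ ∑ a, if A a then f a else 0) (hB : ρ₂ ≤ ∑ b, if B b then g b else 0) :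
    SubC f g (fun a b => A a ∧ B b) (ρ₁ * ρ₂) := by
  have fA : ∀ a, 0 ≤ (if A a then f a else 0) := fun a => by split_ifs; exacts [hf a, le_rfl]
  have gB : ∀ b, 0 ≤ (if B b then g b else 0) := fun b => by split_ifs; exacts [hg b, le_rfl]
  have fA' : ∀ a, (if A a then f a else 0) ≤ f a := fun a => by split_ifs; exacts [le_rfl, hf a]
  have gB' : ∀ b, (if B b then g b else 0) ≤ g b := fun b => by split_ifs; exacts [le_rfl, hg b]
  have sA : ∑ a, (if A a then f a else 0) ≤ 1 := (Finset.sum_le_sum fun a _ => fA' a).trans hf1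
  have sB : ∑ b, (if B b then g b else 0) ≤ 1 := (Finset.sum_le_sum fun a _ => gB' a).trans hg1
  refine ⟨fun a b => (if A a then f a else 0) * (if B b then g b else 0),
    fun a b => mul_nonneg (fA a) (gB b), fun a => ?_, fun b => ?_, fun a b hab => ?_, ?_⟩
  · rw [← Finset.mul_sum]
    exact (mul_le_of_le_one_right (fA a) sB).trans (fA' a)
  · rw [← Finset.sum_mul]
    exact (mul_le_of_le_one_left (gB b) sA).trans (gB' b)
  · beta_reduce
    by_cases h1 : A a
    · rw [if_neg (fun h => hab ⟨h1, h⟩), mul_zero]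
    · rw [if_neg h1, zero_mul]
  · simp only [← Finset.mul_sum, ← Finset.sum_mul]
    exact mul_le_mul hA hB h₂ (Finset.sum_nonneg fun a _ => fA a)

/-- Coupling two uniform weights along class maps whose fibres are comparable in size. -/
theorem of_fibers {γ : Type*} (cl : α → γ) (cl' : β → γ) (good : α → Prop) {u ε : ℝ}
    (hu : 0 ≤ u) (hε : 0 < ε) (hε1 : ε ≤ 1)
    (h : ∀ a, good a → ε * (#{a' : α | cl a' = cl a} : ℝ) ≤ (#{b : β | cl' b = cl a} : ℝ)) :
    SubC (fun _ : α => u) (fun _ : β => u) (fun a b => cl' b = cl a)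
      (ε * u * (#{a : α | good a} : ℝ)) := by
  have hpos : ∀ a, good a → (0 : ℝ) < (#{b : β | cl' b = cl a} : ℝ) := fun a ha => by
    refine lt_of_lt_of_le (mul_pos hε ?_) (h a ha)
    exact_mod_cast Finset.card_pos.mpr ⟨a, by simp⟩
  refine ⟨fun a b => if good a ∧ cl' b = cl a then ε * u / (#{b' : β | cl' b' = cl a} : ℝ) else 0,
    fun a b => ?_, fun a => ?_, fun b => ?_, fun a b hab => ?_, ?_⟩
  · positivity
  · by_cases ha : good a
    · simp only [ha, true_and]
      rw [← Finset.sum_filter, Finset.sum_const, nsmul_eq_mul, mul_div_cancel₀ _ (hpos a ha).ne']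
      exact mul_le_of_le_one_left hu hε1
    · simp [ha, hu]
  · by_cases hb : ∃ a, good a ∧ cl' b = cl a
    · obtain ⟨a₀, ha₀, hb₀⟩ := hb
      calc ∑ a, (if good a ∧ cl' b = cl a then ε * u / (#{b' : β | cl' b' = cl a} : ℝ) else 0)
          ≤ ∑ a, (if cl a = cl a₀ then ε * u / (#{b' : β | cl' b' = cl a₀} : ℝ) else 0) := by
            refine Finset.sum_le_sum fun a _ => ?_
            by_cases h1 : good a ∧ cl' b = cl a
            · have : cl a = cl a₀ := by rw [← h1.2, hb₀]
              rw [if_pos h1, if_pos this, this]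
            · rw [if_neg h1]; positivity
        _ = u * (ε * (#{a' : α | cl a' = cl a₀} : ℝ)) / (#{b' : β | cl' b' = cl a₀} : ℝ) := by
            rw [← Finset.sum_filter, Finset.sum_const, nsmul_eq_mul]; ring
        _ ≤ u := by
            rw [div_le_iff₀ (hpos a₀ ha₀)]
            exact mul_le_mul_of_nonneg_left (h a₀ ha₀) hu
    · rw [Finset.sum_eq_zero]
      · exact hu
      · intro a _
        beta_reduce
        rw [if_neg]; exact fun h => hb ⟨a, h⟩
  · beta_reduce
    rw [if_neg]; exact fun h => hab h.2
  · have : ∀ a, ∑ b, (if good a ∧ cl' b = cl a then ε * u / (#{b' : β | cl' b' = cl a} : ℝ) else 0)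
        = if good a then ε * u else 0 := by
      intro a
      by_cases ha : good a
      · simp only [ha, true_and]
        rw [← Finset.sum_filter, Finset.sum_const, nsmul_eq_mul, mul_div_cancel₀ _ (hpos a ha).ne']
        simp
      · simp [ha]
    simp only [this]
    rw [← Finset.sum_filter, Finset.sum_const, nsmul_eq_mul, mul_comm]

/-- A sub-coupling of two probability vectors extends to a coupling. -/
theorem exists_coupling {f g : α → ℝ} {R : α → α → Prop} {ρ : ℝ} (h : SubC f g R ρ)
    (hf : ∑ a, f a = 1) (hg : ∑ a, g a = 1) :
    ∃ μ : α × α → ℝ, (∀ z, 0 ≤ μ z) ∧ (∀ x, ∑ y, μ (x, y) = f x) ∧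
      (∀ y, ∑ x, μ (x, y) = g y) ∧ ρ ≤ ∑ z : α × α, if R z.1 z.2 then μ z else 0 := by
  obtain ⟨ν, h0, h1, h2, h3, h4⟩ := h
  set m := ∑ a, ∑ b, ν a b with hm
  have hm' : m = ∑ b, ∑ a, ν a b := Finset.sum_comm
  have sf : ∑ a, (f a - ∑ b, ν a b) = 1 - m := by rw [Finset.sum_sub_distrib, hf]
  have sg : ∑ b, (g b - ∑ a, ν a b) = 1 - m := by rw [Finset.sum_sub_distrib, hg, hm']
  have f0 : ∀ a, 0 ≤ f a - ∑ b, ν a b := fun a => sub_nonneg.2 (h1 a)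
  have g0 : ∀ a, 0 ≤ g a - ∑ b, ν b a := fun a => sub_nonneg.2 (h2 a)
  have m0 : 0 ≤ 1 - m := by rw [← sf]; exact Finset.sum_nonneg fun a _ => f0 a
  have c1 : ∀ a, (f a - ∑ b, ν a b) * (1 - m) / (1 - m) = f a - ∑ b, ν a b := by
    intro a
    by_cases hz : 1 - m = 0
    · have := (Finset.sum_eq_zero_iff_of_nonneg fun a _ => f0 a).1 (sf.trans hz) a (mem_univ a)
      rw [this]; simp
    · field_simp
  have c2 : ∀ a, (g a - ∑ b, ν b a) * (1 - m) / (1 - m) = g a - ∑ b, ν b a := by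
    intro a
    by_cases hz : 1 - m = 0
    · have := (Finset.sum_eq_zero_iff_of_nonneg fun a _ => g0 a).1 (sg.trans hz) a (mem_univ a)
      rw [this]; simp
    · field_simp
  have hp : ∀ x y, 0 ≤ (f x - ∑ b, ν x b) * (g y - ∑ a, ν a y) / (1 - m) :=
    fun x y => div_nonneg (mul_nonneg (f0 _) (g0 _)) m0
  refine ⟨fun z => ν z.1 z.2 + (f z.1 - ∑ b, ν z.1 b) * (g z.2 - ∑ a, ν a z.2) / (1 - m),
    fun z => add_nonneg (h0 _ _) (hp _ _), fun x => ?_, fun y => ?_, ?_⟩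
  · dsimp only
    rw [Finset.sum_add_distrib, ← Finset.sum_div, ← Finset.mul_sum, sg, c1]; ring
  · dsimp only
    rw [Finset.sum_add_distrib, ← Finset.sum_div, ← Finset.sum_mul, sf, mul_comm (1 - m), c2]; ring
  · refine h4.trans ?_
    rw [Fintype.sum_prod_type]
    refine Finset.sum_le_sum fun a _ => Finset.sum_le_sum fun b _ => ?_
    by_cases hr : R a b
    · simp only [hr, if_true]
      linarith [hp a b]
    · simp [hr, h3 a b hr]

end SubC

theorem card_conf (n q : ℕ) : (Fintype.card (Conf n q) : ℝ) = (q : ℝ) ^ n := by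
  simp [Conf]

/-- Resampling a uniform colouring on a set leaves it uniform. -/
theorem sum_sum_piecewise {n q : ℕ} (s : Finset (Fin n)) (G : Conf n q → ℝ) :
    ∑ a : Conf n q, ∑ b : Conf n q, G (s.piecewise a b) = (q : ℝ) ^ n * ∑ c, G c := by
  have hinv : Function.Involutive (fun z : Conf n q × Conf n q =>
      ((s.piecewise z.1 z.2 : Conf n q), (s.piecewise z.2 z.1 : Conf n q))) := by
    rintro ⟨a, b⟩
    ext v <;> by_cases hv : v ∈ s <;> simp [Finset.piecewise, hv]
  rw [← Fintype.sum_prod_type' (f := fun a b : Conf n q => G (s.piecewise a b))]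
  rw [← Equiv.sum_comp (Function.Involutive.toPerm _ hinv)]
  have : ∀ z : Conf n q × Conf n q,
      G (s.piecewise (Function.Involutive.toPerm _ hinv z).1 (Function.Involutive.toPerm _ hinv z).2) = G z.1 := by
    intro z
    congr 1
    exact congrArg Prod.fst (hinv z)
  simp only [this]
  rw [Fintype.sum_prod_type, Finset.mul_sum]
  refine Finset.sum_congr rfl fun a _ => ?_
  simp [Finset.card_univ, Conf]

theorem sum_conf_mul_eq_zero {n q : ℕ} {x y : Fin n} (hxy : x ≠ y) (φ ψ : Fin q → ℝ)
    (hφ : ∑ k, φ k = 0) : ∑ c : Conf n q, φ (c x) * ψ (c y) = 0 := by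
  have key : ∀ c : Conf n q, φ (c x) * ψ (c y)
      = ∏ v, (if v = x then φ (c v) else 1) * (if v = y then ψ (c v) else 1) := by
    intro c
    rw [Finset.prod_mul_distrib]
    simp
  simp only [key]
  have := Finset.prod_univ_sum (fun _ : Fin n => (Finset.univ : Finset (Fin q)))
    (fun v k => (if v = x then φ k else 1) * (if v = y then ψ k else 1))
  rw [Fintype.piFinset_univ] at this
  rw [← this]
  refine Finset.prod_eq_zero (mem_univ x) ?_
  simp [hxy, hφ]

theorem color_second_moment {n q : ℕ} (hq : 1 ≤ q) (h : Fin n → Fin n) (U : Finset (Fin n))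
    (j : Fin q) :
    ∑ c : Conf n q, ((#{v ∈ U | c (h v) = j} : ℝ) - (#U : ℝ) / q) ^ 2
      ≤ (q : ℝ) ^ n * (#{z ∈ U ×ˢ U | h z.1 = h z.2} : ℝ) := by
  have hq0 : (0 : ℝ) < q := by exact_mod_cast hq
  have hq1 : (1 : ℝ) / q ≤ 1 := by
    rw [div_le_one hq0]; exact_mod_cast hq
  have hq2 : (0 : ℝ) ≤ 1 / q := by positivity
  set φ : Fin q → ℝ := fun k => (if k = j then 1 else 0) - 1 / q with hφ
  have hφ0 : ∑ k, φ k = 0 := by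
    simp only [hφ, Finset.sum_sub_distrib]
    simp [hq0.ne']
  have hφ1 : ∀ k, |φ k| ≤ 1 := by
    intro k
    simp only [hφ]
    rw [abs_le]
    split_ifs <;> constructor <;> linarith
  have e1 : ∀ c : Conf n q, (#{v ∈ U | c (h v) = j} : ℝ) - (#U : ℝ) / q
      = ∑ v ∈ U, φ (c (h v)) := by
    intro c
    simp only [hφ, Finset.sum_sub_distrib]
    rw [Finset.card_filter]
    push_cast
    rw [Finset.sum_const, nsmul_eq_mul]
    ring
  calc _ = ∑ c : Conf n q, ∑ z ∈ U ×ˢ U, φ (c (h z.1)) * φ (c (h z.2)) := by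
        refine Finset.sum_congr rfl fun c _ => ?_
        rw [e1, sq, Finset.sum_mul_sum, ← Finset.sum_product']
    _ = ∑ z ∈ U ×ˢ U, ∑ c : Conf n q, φ (c (h z.1)) * φ (c (h z.2)) := Finset.sum_comm
    _ ≤ ∑ z ∈ U ×ˢ U, if h z.1 = h z.2 then (q : ℝ) ^ n else 0 := by
        refine Finset.sum_le_sum fun z _ => ?_
        split_ifs with hz
        · calc _ ≤ ∑ c : Conf n q, (1 : ℝ) := by
                refine Finset.sum_le_sum fun c _ => ?_
                refine (le_abs_self _).trans ?_
                rw [abs_mul]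
                exact mul_le_one₀ (hφ1 _) (abs_nonneg _) (hφ1 _)
            _ = _ := by simp [Finset.card_univ, Conf]
        · exact (sum_conf_mul_eq_zero hz φ φ hφ0).le
    _ = _ := by
        rw [← Finset.sum_filter, Finset.sum_const, nsmul_eq_mul, mul_comm]

/-- Markov's inequality for finite weighted sums. -/
theorem card_mul_le_of_sum_le {α : Type*} [Fintype α] (g : α → ℝ) (hg : ∀ a, 0 ≤ g a)
    {B M : ℝ} (h : ∑ a, g a ≤ M) : (#{a : α | B < g a} : ℝ) * B ≤ M := by
  refine le_trans ?_ h
  calc (#{a : α | B < g a} : ℝ) * B = ∑ a ∈ {a : α | B < g a}, B := by simp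
    _ ≤ ∑ a ∈ {a : α | B < g a}, g a :=
        Finset.sum_le_sum fun a ha => (by simpa using ha : B < g a).le
    _ ≤ ∑ a, g a := Finset.sum_le_sum_of_subset_of_nonneg (Finset.subset_univ _)
        fun a _ _ => hg a

theorem color_good_count {n q : ℕ} (hq : 1 ≤ q) (hn : 0 < n) (h : Fin n → Fin n)
    (U : Finset (Fin n)) (t : Fin n → Fin q) {K L : ℝ} (hL : 0 < L)
    (hKL : 2 * (q : ℝ) ^ 2 * K ≤ L ^ 2)
    (hK : (#{z ∈ U ×ˢ U | h z.1 = h z.2} : ℝ) ≤ K * n) :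
    (q : ℝ) ^ n / 2 ≤ (#{c : Conf n q | ∀ i j,
      |(#{v ∈ U | t v = i ∧ c (h v) = j} : ℝ) - (#{v ∈ U | t v = i} : ℝ) / q|
        ≤ L * √n} : ℝ) := by
  have hq0 : (0 : ℝ) < q := by exact_mod_cast hq
  have hn0 : (0 : ℝ) < n := by exact_mod_cast hn
  set w : Fin q → Fin q → Conf n q → ℝ := fun i j c =>
    (#{v ∈ U | t v = i ∧ c (h v) = j} : ℝ) - (#{v ∈ U | t v = i} : ℝ) / q with hw
  have bad : ∀ i j, (#{c : Conf n q | L ^ 2 * n < (w i j c) ^ 2} : ℝ) * (L ^ 2 * n)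
      ≤ (q : ℝ) ^ n * (K * n) := by
    intro i j
    refine card_mul_le_of_sum_le _ (fun c => sq_nonneg _) ?_
    have := color_second_moment hq h (U.filter fun v => t v = i) j
    simp only [Finset.filter_filter] at this
    refine this.trans (mul_le_mul_of_nonneg_left (le_trans ?_ hK) (by positivity))
    exact_mod_cast Finset.card_le_card (Finset.filter_subset_filter _
      (Finset.product_subset_product (Finset.filter_subset _ _) (Finset.filter_subset _ _)))
  have bad' : ∀ i j, (#{c : Conf n q | L ^ 2 * n < (w i j c) ^ 2} : ℝ)
      ≤ (q : ℝ) ^ n / (2 * (q : ℝ) ^ 2) := by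
    intro i j
    rw [le_div_iff₀ (by positivity)]
    have h1 := bad i j
    have h3 : (#{c : Conf n q | L ^ 2 * n < (w i j c) ^ 2} : ℝ) * L ^ 2 ≤ (q : ℝ) ^ n * K := by
      have : (#{c : Conf n q | L ^ 2 * n < (w i j c) ^ 2} : ℝ) * L ^ 2 * n
        ≤ (q : ℝ) ^ n * K * n := by linarith
      exact le_of_mul_le_mul_right this hn0
    by_contra hcon
    push Not at hcon
    have h4 : (q : ℝ) ^ n * L ^ 2 <
        (#{c : Conf n q | L ^ 2 * n < (w i j c) ^ 2} : ℝ) * (2 * (q : ℝ) ^ 2) * L ^ 2 :=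
      mul_lt_mul_of_pos_right hcon (by positivity)
    have h5 : (q : ℝ) ^ n * (2 * (q : ℝ) ^ 2 * K) ≤ (q : ℝ) ^ n * L ^ 2 :=
      mul_le_mul_of_nonneg_left hKL (by positivity)
    nlinarith [mul_le_mul_of_nonneg_right h3 (show (0 : ℝ) ≤ 2 * (q : ℝ) ^ 2 by positivity)]
  have hsub : (Finset.univ : Finset (Conf n q)) ⊆
      ({c : Conf n q | ∀ i j, |w i j c| ≤ L * √n} : Finset (Conf n q)) ∪
      (Finset.univ : Finset (Fin q × Fin q)).biUnion
        fun ij => {c : Conf n q | L ^ 2 * n < (w ij.1 ij.2 c) ^ 2} := by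
    intro c _
    simp only [mem_union, mem_filter, mem_univ, true_and, mem_biUnion, Prod.exists]
    by_contra hcon
    push Not at hcon
    obtain ⟨⟨i, j, hij⟩, h2⟩ := hcon
    refine absurd (h2 i j) (not_le.2 ?_)
    rw [← sq_abs (w i j c)]
    calc L ^ 2 * n = (L * √n) ^ 2 := by rw [mul_pow, Real.sq_sqrt hn0.le]
      _ < |w i j c| ^ 2 := by gcongr
  have hc := Finset.card_le_card hsub
  have hc2 := hc.trans (Finset.card_union_le _ _)
  have hc3 : ((q : ℝ) ^ n) ≤ (#{c : Conf n q | ∀ i j, |w i j c| ≤ L * √n} : ℝ) +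
      ∑ ij : Fin q × Fin q, (#{c : Conf n q | L ^ 2 * n < (w ij.1 ij.2 c) ^ 2} : ℝ) := by
    rw [← card_conf, ← Finset.card_univ]
    exact_mod_cast hc2.trans (Nat.add_le_add_left Finset.card_biUnion_le _)
  have hc4 : ∑ ij : Fin q × Fin q, (#{c : Conf n q | L ^ 2 * n < (w ij.1 ij.2 c) ^ 2} : ℝ)
      ≤ (q : ℝ) ^ n / 2 := by
    calc _ ≤ ∑ ij : Fin q × Fin q, (q : ℝ) ^ n / (2 * (q : ℝ) ^ 2) :=
          Finset.sum_le_sum fun ij _ => bad' _ _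
      _ = _ := by
          rw [Finset.sum_const, Finset.card_univ, nsmul_eq_mul]
          simp only [Fintype.card_prod, Fintype.card_fin]
          push_cast
          field_simp
  linarith

/-- The matrix of colour counts of `e` on `J`, by type. -/
def typeCnt {n q : ℕ} (J : Finset (Fin n)) (t : Fin n → Fin q) (e : Conf n q) :
    Fin q → Fin q → ℤ :=
  fun i j => (#{v ∈ J | t v = i ∧ e v = j} : ℤ)

/-- Move one unit from entry `(i, k)` to entry `(i, j)`. -/
def moveUnit {q : ℕ} (b : Fin q → Fin q → ℤ) (i j k : Fin q) : Fin q → Fin q → ℤ :=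
  fun i' j' => b i' j' + (if i' = i ∧ j' = j then 1 else 0) - (if i' = i ∧ j' = k then 1 else 0)

theorem typeCnt_update {n q : ℕ} (J : Finset (Fin n)) (t : Fin n → Fin q) (e : Conf n q)
    {v : Fin n} (hv : v ∈ J) (j : Fin q) :
    typeCnt J t (Function.update e v j) = moveUnit (typeCnt J t e) (t v) j (e v) := by
  funext i' j'
  simp only [typeCnt, moveUnit, Finset.card_filter]
  push_cast
  rw [← Finset.add_sum_erase _ _ hv, ← Finset.add_sum_erase J (fun w => if t w = i' ∧ e w = j' then (1 : ℤ) else 0) hv]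
  have : ∑ w ∈ J.erase v, (if t w = i' ∧ Function.update e v j w = j' then (1 : ℤ) else 0)
      = ∑ w ∈ J.erase v, (if t w = i' ∧ e w = j' then (1 : ℤ) else 0) := by
    refine Finset.sum_congr rfl fun w hw => ?_
    rw [Function.update_of_ne (Finset.ne_of_mem_erase hw)]
  rw [this, Function.update_self]
  simp only [eq_comm (a := i'), eq_comm (a := j')]
  ring

theorem moveUnit_moveUnit {q : ℕ} (b : Fin q → Fin q → ℤ) (i j k : Fin q) :
    moveUnit (moveUnit b i j k) i k j = b := by
  funext i' j'
  simp only [moveUnit]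
  ring

theorem card_typeCnt_moveUnit {n q : ℕ} (J : Finset (Fin n)) (t : Fin n → Fin q)
    (b : Fin q → Fin q → ℤ) (i : Fin q) {j k : Fin q} (hjk : j ≠ k) :
    (#{e : Conf n q | typeCnt J t e = b} : ℤ) * b i k
      = (#{e : Conf n q | typeCnt J t e = moveUnit b i j k} : ℤ) * (b i j + 1) := by
  have h1 : ∀ (b : Fin q → Fin q → ℤ) (k : Fin q),
      (#{e : Conf n q | typeCnt J t e = b} : ℤ) * b i k =
      (#(({e : Conf n q | typeCnt J t e = b} : Finset (Conf n q)).sigma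
        fun e => J.filter fun v => t v = i ∧ e v = k) : ℤ) := by
    intro b k
    rw [Finset.card_sigma]
    push_cast
    rw [Finset.sum_congr rfl (g := fun _ => b i k), Finset.sum_const, nsmul_eq_mul]
    intro e he
    have : typeCnt J t e = b := by simpa using he
    rw [← this]; rfl
  have h2 : b i j + 1 = moveUnit b i j k i j := by simp [moveUnit, hjk]
  rw [h1, h2, h1]
  norm_cast
  refine Finset.card_nbij' (fun z => ⟨Function.update z.1 z.2 j, z.2⟩)
    (fun z => ⟨Function.update z.1 z.2 k, z.2⟩) ?_ ?_ ?_ ?_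
  · rintro ⟨e, v⟩ hz
    simp only [Finset.coe_sigma, Set.mem_sigma_iff, Finset.mem_coe, mem_filter, mem_univ, true_and] at hz ⊢
    obtain ⟨rfl, hv, rfl, rfl⟩ := hz
    refine ⟨typeCnt_update J t e hv j, hv, rfl, by simp⟩
  · rintro ⟨e, v⟩ hz
    simp only [Finset.coe_sigma, Set.mem_sigma_iff, Finset.mem_coe, mem_filter, mem_univ, true_and] at hz ⊢
    obtain ⟨he, hv, rfl, rfl⟩ := hz
    refine ⟨?_, hv, rfl, by simp⟩
    rw [typeCnt_update J t e hv k, he, moveUnit_moveUnit]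
  · rintro ⟨e, v⟩ hz
    simp only [Finset.coe_sigma, Set.mem_sigma_iff, Finset.mem_coe, mem_filter, mem_univ, true_and] at hz
    obtain ⟨he, hv, rfl, rfl⟩ := hz
    simp
  · rintro ⟨e, v⟩ hz
    simp only [Finset.coe_sigma, Set.mem_sigma_iff, Finset.mem_coe, mem_filter, mem_univ, true_and] at hz
    obtain ⟨he, hv, rfl, rfl⟩ := hz
    simp

theorem card_typeCnt_shift {n q : ℕ} (J : Finset (Fin n)) (t : Fin n → Fin q) {lo hi : ℝ}
    (hlo : 0 ≤ lo) (hlohi : lo ≤ hi) (hhi : 0 < hi) (l : ℕ) :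
    ∀ (b x : Fin q → Fin q → ℤ), (∀ i, ∑ j, x i j = 0) → (∑ i, ∑ j, (x i j).natAbs ≤ l) →
      (∀ i j, lo ≤ b i j ∧ (b i j : ℝ) ≤ hi) →
      (∀ i j, lo ≤ (b i j + x i j : ℤ) ∧ ((b i j + x i j : ℤ) : ℝ) ≤ hi) →
      (lo / hi) ^ l * (#{e : Conf n q | typeCnt J t e = b} : ℝ)
        ≤ (#{e : Conf n q | typeCnt J t e = fun i j => b i j + x i j} : ℝ) := by
  have hθ0 : 0 ≤ lo / hi := by positivity
  have hθ1 : lo / hi ≤ 1 := (div_le_one hhi).2 hlohi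
  induction l with
  | zero =>
    intro b x _ hx _ _
    have : ∀ i j, x i j = 0 := by
      intro i j
      have h1 : ∑ i, ∑ j, (x i j).natAbs = 0 := by omega
      rw [Finset.sum_eq_zero_iff] at h1
      have h2 := h1 i (mem_univ _)
      rw [Finset.sum_eq_zero_iff] at h2
      simpa using h2 j (mem_univ _)
    simp [this]
  | succ l ih =>
    intro b x hrow hx hb hbx
    by_cases hz : ∀ i j, x i j = 0
    · simp only [hz, add_zero]
      exact mul_le_of_le_one_left (by positivity) (pow_le_one₀ hθ0 hθ1)
    push Not at hz
    obtain ⟨i, j₀, hij₀⟩ := hz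
    obtain ⟨j, -, hj⟩ : ∃ j ∈ univ, 0 < x i j := by
      by_contra hcon
      push Not at hcon
      have := (Finset.sum_eq_zero_iff_of_nonpos hcon).1 (hrow i) j₀ (mem_univ _)
      exact hij₀ this
    obtain ⟨k, -, hk⟩ : ∃ k ∈ univ, x i k < 0 := by
      by_contra hcon
      push Not at hcon
      have := (Finset.sum_eq_zero_iff_of_nonneg hcon).1 (hrow i) j₀ (mem_univ _)
      exact hij₀ this
    have hjk : j ≠ k := by rintro rfl; omega
    set b' := moveUnit b i j k with hb'
    set x' : Fin q → Fin q → ℤ := moveUnit x i k j with hx'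
    have hsum : (fun i j => b' i j + x' i j) = fun i j => b i j + x i j := by
      funext i' j'
      simp only [hb', hx', moveUnit]; ring
    have hsum' : ∀ i j, b' i j + x' i j = b i j + x i j := fun i j => congrFun (congrFun hsum i) j
    have hrow' : ∀ i', ∑ j', x' i' j' = 0 := by
      intro i'
      simp only [hx', moveUnit, Finset.sum_sub_distrib, Finset.sum_add_distrib, hrow]
      by_cases hi : i' = i <;> simp [hi]
    have hlt : ∑ i, ∑ j, (x' i j).natAbs < ∑ i, ∑ j, (x i j).natAbs := by
      have hle : ∀ i' j', (x' i' j').natAbs ≤ (x i' j').natAbs := by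
        intro i' j'
        simp only [hx', moveUnit]
        by_cases h1 : i' = i ∧ j' = j
        · obtain ⟨rfl, rfl⟩ := h1
          simp only [hjk, and_false, if_false, and_self, if_true]; omega
        · by_cases h2 : i' = i ∧ j' = k
          · obtain ⟨rfl, rfl⟩ := h2
            simp only [hjk.symm, and_false, if_false, and_self, if_true]; omega
          · simp [h1, h2]
      refine Finset.sum_lt_sum (fun i' _ => Finset.sum_le_sum fun j' _ => hle i' j')
        ⟨i, mem_univ _, Finset.sum_lt_sum (fun j' _ => hle i j') ⟨j, mem_univ _, ?_⟩⟩
      simp only [hx', moveUnit, hjk, and_false, if_false, and_self, if_true]; omega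
    have hb'box : ∀ i' j', lo ≤ b' i' j' ∧ (b' i' j' : ℝ) ≤ hi := by
      intro i' j'
      have hbetween : (b i' j' ≤ b' i' j' ∧ b' i' j' ≤ b i' j' + x i' j') ∨
          (b i' j' + x i' j' ≤ b' i' j' ∧ b' i' j' ≤ b i' j') ∨ b' i' j' = b i' j' := by
        simp only [hb', moveUnit]
        by_cases h1 : i' = i ∧ j' = j
        · obtain ⟨rfl, rfl⟩ := h1
          simp only [hjk, and_false, if_false, and_self, if_true]; omega
        · by_cases h2 : i' = i ∧ j' = k
          · obtain ⟨rfl, rfl⟩ := h2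
            simp only [hjk.symm, and_false, if_false, and_self, if_true]; omega
          · simp [h1, h2]
      obtain ⟨p1, p2⟩ := hb i' j'
      obtain ⟨p3, p4⟩ := hbx i' j'
      rcases hbetween with ⟨h1, h2⟩ | ⟨h1, h2⟩ | h1
      · have h1' : (b i' j' : ℝ) ≤ b' i' j' := by exact_mod_cast h1
        have h2' : (b' i' j' : ℝ) ≤ ((b i' j' + x i' j' : ℤ) : ℝ) := by exact_mod_cast h2
        exact ⟨by linarith, by linarith⟩
      · have h2' : (b' i' j' : ℝ) ≤ b i' j' := by exact_mod_cast h2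
        have h1' : ((b i' j' + x i' j' : ℤ) : ℝ) ≤ (b' i' j' : ℝ) := by exact_mod_cast h1
        exact ⟨by linarith, by linarith⟩
      · rw [h1]; exact ⟨p1, p2⟩
    have hih := ih b' x' hrow' (by omega) hb'box (fun i j => by rw [hsum']; exact hbx i j)
    rw [hsum] at hih
    have hstep : lo / hi * (#{e : Conf n q | typeCnt J t e = b} : ℝ)
        ≤ (#{e : Conf n q | typeCnt J t e = b'} : ℝ) := by
      have h1 : (#{e : Conf n q | typeCnt J t e = b} : ℝ) * b i k
          = (#{e : Conf n q | typeCnt J t e = b'} : ℝ) * (b i j + 1) := by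
        exact_mod_cast card_typeCnt_moveUnit J t b i hjk
      rw [div_mul_eq_mul_div, div_le_iff₀ hhi]
      have h3 : ((b i j : ℝ) + 1) ≤ hi := by
        refine le_trans ?_ (hbx i j).2
        push_cast
        have : (1 : ℝ) ≤ x i j := by exact_mod_cast hj
        linarith
      calc lo * (#{e : Conf n q | typeCnt J t e = b} : ℝ)
          ≤ b i k * (#{e : Conf n q | typeCnt J t e = b} : ℝ) :=
            mul_le_mul_of_nonneg_right (hb i k).1 (by positivity)
        _ = (#{e : Conf n q | typeCnt J t e = b'} : ℝ) * (b i j + 1) := by rw [← h1]; ring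
        _ ≤ _ := mul_le_mul_of_nonneg_left h3 (by positivity)
    calc (lo / hi) ^ (l + 1) * (#{e : Conf n q | typeCnt J t e = b} : ℝ)
        = (lo / hi) ^ l * (lo / hi * (#{e : Conf n q | typeCnt J t e = b} : ℝ)) := by ring
      _ ≤ (lo / hi) ^ l * (#{e : Conf n q | typeCnt J t e = b'} : ℝ) :=
          mul_le_mul_of_nonneg_left hstep (by positivity)
      _ ≤ _ := hih

/-- Sets of equal size are matched by a permutation that respects types as far as possible. -/
theorem exists_perm_mapsTo {n q : ℕ} (t' t : Fin n → Fin q) (k : ℕ) :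
    ∀ A B : Finset (Fin n), #A = k → #B = k → ∃ φ : Equiv.Perm (Fin n), (∀ a ∈ A, φ a ∈ B) ∧
      #{a ∈ A | t (φ a) ≠ t' a} ≤ ∑ i, (#{a ∈ A | t' a = i} - #{b ∈ B | t b = i}) := by
  induction k with
  | zero =>
    intro A B hA hB
    rw [Finset.card_eq_zero] at hA
    subst hA
    exact ⟨1, by simp, by rw [Finset.filter_empty]; simp⟩
  | succ k ih =>
    intro A B hA hB
    obtain ⟨a, ha, b, hb, hab⟩ : ∃ a ∈ A, ∃ b ∈ B, t b = t' a ∨ ∀ x ∈ A, ∀ y ∈ B, t y ≠ t' x := by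
      by_cases h : ∃ a ∈ A, ∃ b ∈ B, t b = t' a
      · obtain ⟨a, ha, b, hb, hab⟩ := h
        exact ⟨a, ha, b, hb, Or.inl hab⟩
      · obtain ⟨a, ha⟩ : A.Nonempty := Finset.card_pos.1 (by omega)
        obtain ⟨b, hb⟩ : B.Nonempty := Finset.card_pos.1 (by omega)
        push Not at h
        exact ⟨a, ha, b, hb, Or.inr h⟩
    obtain ⟨φ, hφ, hφ2⟩ := ih (A.erase a) (B.erase b)
      (by rw [Finset.card_erase_of_mem ha]; omega) (by rw [Finset.card_erase_of_mem hb]; omega)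
    have hfix : ∀ x ∈ A.erase a, (Equiv.swap (φ a) b * φ) x = φ x := by
      intro x hx
      have h1 := hφ x hx
      rw [Equiv.Perm.mul_apply, Equiv.swap_apply_of_ne_of_ne]
      · exact fun h => Finset.ne_of_mem_erase hx (φ.injective h)
      · exact Finset.ne_of_mem_erase h1
    have hfa : (Equiv.swap (φ a) b * φ) a = b := by simp
    refine ⟨Equiv.swap (φ a) b * φ, fun x hx => ?_, ?_⟩
    · by_cases hxa : x = a
      · rw [hxa, hfa]; exact hb
      · have := Finset.mem_erase.2 ⟨hxa, hx⟩
        rw [hfix x this]; exact Finset.mem_of_mem_erase (hφ x this)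
    · have cA : ∀ i, #{x ∈ A | t' x = i} = #{x ∈ A.erase a | t' x = i} + if t' a = i then 1 else 0 := by
        intro i
        rw [Finset.card_filter, Finset.card_filter, ← Finset.sum_erase_add _ _ ha]
      have cB : ∀ i, #{x ∈ B | t x = i} = #{x ∈ B.erase b | t x = i} + if t b = i then 1 else 0 := by
        intro i
        rw [Finset.card_filter, Finset.card_filter, ← Finset.sum_erase_add _ _ hb]
      have hv : #{x ∈ A | t ((Equiv.swap (φ a) b * φ) x) ≠ t' x}
          = #{x ∈ A.erase a | t (φ x) ≠ t' x} + if t b ≠ t' a then 1 else 0 := by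
        rw [Finset.card_filter, Finset.card_filter, ← Finset.sum_erase_add _ _ ha, hfa]
        congr 1
        exact Finset.sum_congr rfl fun x hx => by rw [hfix x hx]
      rw [hv]
      have hterm : ∀ i, (#{x ∈ A.erase a | t' x = i} - #{x ∈ B.erase b | t x = i}) +
          (if t' a = i ∧ t b ≠ t' a then 1 else 0) ≤ #{x ∈ A | t' x = i} - #{x ∈ B | t x = i} := by
        intro i
        rw [cA, cB]
        by_cases h : t b = t' a
        · simp only [h, ne_eq, not_true_eq_false, and_false, if_false]
          omega
        · have hall := hab.resolve_left h
          by_cases h1 : t' a = i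
          · have h2 : #{x ∈ B.erase b | t x = i} = 0 := by
              rw [Finset.card_eq_zero, Finset.filter_eq_empty_iff]
              intro y hy; rw [← h1]; exact hall a ha y (Finset.mem_of_mem_erase hy)
            have h3 : t b ≠ i := h1 ▸ h
            simp only [h1, h2, h3, ne_eq, not_false_eq_true, and_self, if_true, if_false]
            omega
          · by_cases h3 : t b = i
            · have h2 : #{x ∈ A.erase a | t' x = i} = 0 := by
                rw [Finset.card_eq_zero, Finset.filter_eq_empty_iff]
                intro y hy; rw [← h3]
                exact (hall y (Finset.mem_of_mem_erase hy) b hb).symm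
              simp [h1, h2]
            · simp [h1, h3]
      calc _ ≤ ∑ i, (#{x ∈ A.erase a | t' x = i} - #{x ∈ B.erase b | t x = i})
            + ∑ i, (if t' a = i ∧ t b ≠ t' a then 1 else 0) := by
            refine Nat.add_le_add hφ2 ?_
            by_cases h : t b = t' a <;> simp [h]
        _ ≤ _ := by
            rw [← Finset.sum_add_distrib]
            exact Finset.sum_le_sum fun i _ => hterm i

theorem card_filter_congr_iff {α : Type*} {s : Finset α} {p p' : α → Prop}
    {_ : DecidablePred p} {_ : DecidablePred p'} (h : ∀ a, p a ↔ p' a) :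
    #{a ∈ s | p a} = #{a ∈ s | p' a} := by
  simp only [h]

theorem card_eq_of_type_card_eq {n q : ℕ} {J J' : Finset (Fin n)} {t t' : Fin n → Fin q}
    (h : ∀ i, #{v ∈ J | t v = i} = #{v ∈ J' | t' v = i}) : #J = #J' := by
  rw [Finset.card_eq_sum_card_fiberwise (f := t) (t := Finset.univ) (by simp),
    Finset.card_eq_sum_card_fiberwise (f := t') (s := J') (t := Finset.univ) (by simp)]
  exact Finset.sum_congr rfl fun i _ => h i

theorem card_typeCnt_congr {n q : ℕ} {J J' : Finset (Fin n)} {t t' : Fin n → Fin q}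
    (h : ∀ i, #{v ∈ J | t v = i} = #{v ∈ J' | t' v = i}) (b : Fin q → Fin q → ℤ) :
    #{e : Conf n q | typeCnt J t e = b} = #{e : Conf n q | typeCnt J' t' e = b} := by
  obtain ⟨σ, hσ, hσ2⟩ := exists_perm_mapsTo t t' _ J J' rfl (card_eq_of_type_card_eq h).symm
  have h0 : ∀ a ∈ J, t' (σ a) = t a := by
    simp only [h, Nat.sub_self, Finset.sum_const_zero, nonpos_iff_eq_zero,
      Finset.card_eq_zero, Finset.filter_eq_empty_iff, not_not] at hσ2
    exact fun a ha => hσ2 ha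
  have himg : J.image σ = J' := by
    refine Finset.eq_of_subset_of_card_le ?_ ?_
    · intro x hx
      obtain ⟨a, ha, rfl⟩ := Finset.mem_image.1 hx
      exact hσ a ha
    · rw [Finset.card_image_of_injective _ σ.injective, card_eq_of_type_card_eq h]
  have hcnt : ∀ e : Conf n q, typeCnt J t (e ∘ σ) = typeCnt J' t' e := by
    intro e
    funext i j
    simp only [typeCnt, ← himg, Finset.filter_image, Function.comp]
    rw [Finset.card_image_of_injective _ σ.injective]
    congr 2
    refine Finset.filter_congr fun a ha => ?_
    rw [h0 a ha]
  refine Finset.card_bij' (fun e _ => e ∘ σ.symm) (fun e _ => e ∘ σ) ?_ ?_ ?_ ?_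
  · intro e he
    simp only [Finset.mem_filter, Finset.mem_univ, true_and] at he ⊢
    rw [← hcnt, Function.comp_assoc]; simpa using he
  · intro e he
    simp only [Finset.mem_filter, Finset.mem_univ, true_and] at he ⊢
    rw [hcnt]; exact he
  · intro e _; funext v; simp
  · intro e _; funext v; simp

theorem exp_neg_le_one_sub {z : ℝ} (h0 : 0 ≤ z) (h1 : z ≤ 1 / 2) : Real.exp (-(2 * z)) ≤ 1 - z := by
  rw [Real.exp_neg]
  have h2 : 1 + 2 * z ≤ Real.exp (2 * z) := by linarith [Real.add_one_le_exp (2 * z)]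
  have h3 : (Real.exp (2 * z))⁻¹ ≤ (1 + 2 * z)⁻¹ := inv_anti₀ (by linarith) h2
  refine h3.trans ?_
  rw [inv_le_iff_one_le_mul₀ (by linarith)]
  nlinarith

/-- Uniform colourings can be coupled so that the type counts differ by a prescribed shift. -/
theorem exists_shift_subC {q : ℕ} (hq : 1 ≤ q) {c X : ℝ} (hc : 0 < c) (hX : 0 ≤ X) :
    ∃ ρ : ℝ, 0 < ρ ∧ ∃ N : ℕ, ∀ n : ℕ, N ≤ n → ∀ (J J' : Finset (Fin n)) (t t' : Fin n → Fin q)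
      (m : ℕ), c * n ≤ m → (∀ i, #{v ∈ J | t v = i} = q * m) →
      (∀ i, #{v ∈ J' | t' v = i} = q * m) →
      ∀ x : Fin q → Fin q → ℤ, (∀ i, ∑ j, x i j = 0) → (∀ i j, |(x i j : ℝ)| ≤ X * √n) →
      SubC (fun _ : Conf n q => ((q : ℝ) ^ n)⁻¹) (fun _ : Conf n q => ((q : ℝ) ^ n)⁻¹)
        (fun e e' => ∀ i j, typeCnt J' t' e' i j = typeCnt J t e i j + x i j) ρ := by
  have hq0 : (0 : ℝ) < q := by exact_mod_cast hq
  set A : ℝ := 2 * q + X with hA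
  have hA0 : 0 < A := by positivity
  set C : ℝ := 4 * A * (q ^ 2 * X) / c with hC
  have hC0 : 0 ≤ C := by positivity
  refine ⟨Real.exp (-C) / 2, by positivity, ⌈(4 * A / c) ^ 2⌉₊ + 1, ?_⟩
  intro n hn J J' t t' m hm hJ hJ' x hx hxX
  have hn0 : 0 < n := by omega
  have hn0' : (0 : ℝ) < n := by exact_mod_cast hn0
  have hs0 : 0 < √(n : ℝ) := Real.sqrt_pos.2 hn0'
  have hss : √(n : ℝ) * √n = n := Real.mul_self_sqrt hn0'.le
  have hm0 : (0 : ℝ) < m := lt_of_lt_of_le (by positivity) hm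
  have hbig : 4 * A / c ≤ √n := by
    apply Real.le_sqrt_of_sq_le
    exact (Nat.le_ceil _).trans (by exact_mod_cast (by omega : ⌈(4 * A / c) ^ 2⌉₊ ≤ n))
  set R : ℝ := A * √n with hR
  have hR0 : 0 < R := by positivity
  have hRm : 4 * R ≤ m := by
    have : 4 * A ≤ √n * c := by rwa [div_le_iff₀ hc] at hbig
    calc 4 * R = 4 * A * √n := by rw [hR]; ring
      _ ≤ √n * c * √n := by gcongr
      _ = c * n := by linear_combination c * hss
      _ ≤ m := hm
  set l : ℕ := ∑ i, ∑ j, (x i j).natAbs with hl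
  have hlX : (l : ℝ) ≤ q ^ 2 * X * √n := by
    rw [hl]; push_cast
    calc ∑ i, ∑ j, ((x i j).natAbs : ℝ) ≤ ∑ i : Fin q, ∑ j : Fin q, X * √n := by
          refine Finset.sum_le_sum fun i _ => Finset.sum_le_sum fun j _ => ?_
          rw [Nat.cast_natAbs]; push_cast; exact hxX i j
      _ = _ := by simp; ring
  have hz : Real.exp (-C) ≤ ((m - R) / (m + R)) ^ l := by
    have h1 : 1 - 2 * R / m ≤ (m - R) / (m + R) := by
      rw [le_div_iff₀ (by positivity), sub_mul, div_mul_eq_mul_div]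
      have : 2 * R ≤ 2 * R * (m + R) / m := by
        rw [le_div_iff₀ hm0]; nlinarith
      linarith
    have h2 : Real.exp (-(2 * (2 * R / m))) ≤ (m - R) / (m + R) :=
      (exp_neg_le_one_sub (by positivity)
        (by rw [div_le_iff₀ hm0]; linarith)).trans h1
    refine le_trans ?_ (pow_le_pow_left₀ (Real.exp_pos _).le h2 l)
    rw [← Real.exp_nat_mul]
    refine Real.exp_le_exp.2 ?_
    have h3 : (l : ℝ) * (2 * (2 * R / m)) ≤ C := by
      calc (l : ℝ) * (2 * (2 * R / m)) ≤ (q ^ 2 * X * √n) * (2 * (2 * R / (c * n))) := by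
            gcongr
        _ = C * (√n * √n / n) := by
            rw [hC, hR]; field_simp; ring
        _ = C := by rw [hss, div_self hn0'.ne', mul_one]
    linarith
  have hgood := color_good_count hq hn0 id J t (K := 1) (L := 2 * q) (by positivity)
    (by nlinarith [sq_nonneg (q : ℝ)]) (by
      rw [one_mul]
      have : #{z ∈ J ×ˢ J | id z.1 = id z.2} ≤ n := by
        calc #{z ∈ J ×ˢ J | id z.1 = id z.2} ≤ #(Finset.univ : Finset (Fin n)) := by
              refine Finset.card_le_card_of_injOn Prod.fst (by simp) ?_
              intro a ha b hb hab
              simp at ha hb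
              exact Prod.ext hab (by rw [← ha.2, ← hb.2]; exact hab)
          _ = n := by simp
      exact_mod_cast this)
  have hgood' : (q : ℝ) ^ n / 2 ≤ (#{e : Conf n q | ∀ i j,
      |(typeCnt J t e i j : ℝ) - m| ≤ 2 * q * √n} : ℝ) := by
    refine hgood.trans ?_
    norm_cast
    refine Finset.card_le_card fun e he => ?_
    have he := (Finset.mem_filter.1 he).2
    refine Finset.mem_filter.2 ⟨Finset.mem_univ _, fun i j => ?_⟩
    have := he i j
    rw [hJ] at this
    push_cast at this
    rw [mul_div_cancel_left₀ _ hq0.ne'] at this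
    simpa [typeCnt] using this
  have hsub := SubC.of_fibers (α := Conf n q) (β := Conf n q)
    (cl := fun e => fun i j => typeCnt J t e i j + x i j)
    (cl' := fun e => typeCnt J' t' e)
    (good := fun e => ∀ i j, |(typeCnt J t e i j : ℝ) - m| ≤ 2 * q * √n)
    (u := ((q : ℝ) ^ n)⁻¹) (ε := Real.exp (-C)) (by positivity) (Real.exp_pos _)
    (Real.exp_le_one_iff.2 (by linarith)) ?_
  · refine hsub.mono (fun e e' h i j => congrFun (congrFun h i) j) ?_
    have : Real.exp (-C) / 2 = Real.exp (-C) * ((q : ℝ) ^ n)⁻¹ * ((q : ℝ) ^ n / 2) := by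
      field_simp
    rw [this]
    refine mul_le_mul_of_nonneg_left (hgood'.trans (le_of_eq ?_)) (by positivity)
    congr
  · intro e he
    have key := card_typeCnt_shift J' t' (lo := m - R) (hi := m + R) (by linarith) (by linarith)
      (by linarith) l (typeCnt J t e) x hx le_rfl
      (fun i j => by
        have := abs_le.1 (he i j)
        have h2 : 2 * q * √n ≤ R := by rw [hR, hA]; nlinarith
        constructor <;> linarith)
      (fun i j => by
        have := abs_le.1 (he i j)
        have h3 := abs_le.1 (hxX i j)
        have h2 : 2 * q * √n + X * √n = R := by rw [hR, hA]; ring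
        push_cast
        constructor <;> linarith)
    refine le_trans ?_ (key.trans (le_of_eq (by congr)))
    refine mul_le_mul hz (le_of_eq ?_) (by positivity)
      (by have : 0 ≤ m - R := by linarith
          positivity)
    rw [← card_typeCnt_congr (fun i => (hJ i).trans (hJ' i).symm)]
    norm_cast
    refine card_filter_congr_iff fun a => ⟨fun h => ?_, fun h => by rw [h]⟩
    funext i j
    simpa using congrFun (congrFun h i) j

/-- The law of the colouring obtained by giving each class of `h` the colour of its root. -/
noncomputable def colorLaw {n q : ℕ} (h : Fin n → Fin n) (τ : Conf n q) : ℝ :=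
  ∑ c : Conf n q, ((q : ℝ) ^ n)⁻¹ * (if (fun v => c (h v)) = τ then 1 else 0)

/-- Colours are drawn in three independent groups of roots: `D`, `J`, and the rest. -/
theorem colorLaw_eq {n q : ℕ} (hq : 1 ≤ q) (h : Fin n → Fin n) (D J : Finset (Fin n))
    (τ : Conf n q) :
    colorLaw h τ = ∑ a : Conf n q, ((q : ℝ) ^ n)⁻¹ * ∑ b : Conf n q, ((q : ℝ) ^ n)⁻¹ *
      ∑ e : Conf n q, ((q : ℝ) ^ n)⁻¹ *
        (if (fun v => D.piecewise a (J.piecewise e b) (h v)) = τ then 1 else 0) := by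
  have hq0 : (q : ℝ) ^ n ≠ 0 := pow_ne_zero _ (by positivity)
  have key : ∀ (s : Finset (Fin n)) (G : Conf n q → ℝ),
      ∑ c, G c = ∑ a, ((q : ℝ) ^ n)⁻¹ * ∑ b, G (s.piecewise a b) := by
    intro s G
    rw [← Finset.mul_sum, sum_sum_piecewise, inv_mul_cancel_left₀ hq0]
  unfold colorLaw
  rw [key D]
  refine Finset.sum_congr rfl fun a _ => ?_
  rw [key J, ← Finset.mul_sum]
  simp only [Finset.mul_sum]
  rw [Finset.sum_comm]

/-- The colour counts of `b ∘ h` on `U` are within `w` of their means. -/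
def InWindow {n q : ℕ} (h : Fin n → Fin n) (t : Fin n → Fin q) (U : Finset (Fin n)) (w : ℝ)
    (b : Conf n q) : Prop :=
  ∀ i j, |(#{v ∈ U | t v = i ∧ b (h v) = j} : ℝ) - (#{v ∈ U | t v = i} : ℝ) / q| ≤ w

theorem card_filter_split {n : ℕ} {D J : Finset (Fin n)} (hDJ : Disjoint J D) (p : Fin n → Prop)
    [DecidablePred p] :
    #{v | p v} = #{v ∈ D | p v} + #{v ∈ J | p v} + #{v ∈ (D ∪ J)ᶜ | p v} := by
  rw [← Finset.card_union_of_disjoint, ← Finset.filter_union, ← Finset.card_union_of_disjoint,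
    ← Finset.filter_union, Finset.union_compl]
  · exact Finset.disjoint_filter_filter disjoint_compl_right
  · exact Finset.disjoint_filter_filter hDJ.symm

theorem abs_card_filter_sub_le {n : ℕ} (D : Finset (Fin n)) (p p' : Fin n → Prop)
    [DecidablePred p] [DecidablePred p'] :
    |(#{v ∈ D | p v} : ℝ) - #{v ∈ D | p' v}| ≤ #{v ∈ D | ¬ (p v ↔ p' v)} := by
  have h1 : #{v ∈ D | p v} ≤ #{v ∈ D | p' v} + #{v ∈ D | ¬ (p v ↔ p' v)} := by
    rw [← Finset.card_filter_add_card_filter_not (s := {v ∈ D | p v}) (fun v => p' v)]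
    refine Nat.add_le_add (Finset.card_le_card ?_) (Finset.card_le_card ?_) <;>
    · intro v; simp only [Finset.mem_filter]; tauto
  have h2 : #{v ∈ D | p' v} ≤ #{v ∈ D | p v} + #{v ∈ D | ¬ (p v ↔ p' v)} := by
    rw [← Finset.card_filter_add_card_filter_not (s := {v ∈ D | p' v}) (fun v => p v)]
    refine Nat.add_le_add (Finset.card_le_card ?_) (Finset.card_le_card ?_) <;>
    · intro v; simp only [Finset.mem_filter]; tauto
  rw [abs_le]
  constructor
  · have : (#{v ∈ D | p' v} : ℝ) ≤ #{v ∈ D | p v} + #{v ∈ D | ¬ (p v ↔ p' v)} := by exact_mod_cast h2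
    linarith
  · have : (#{v ∈ D | p v} : ℝ) ≤ #{v ∈ D | p' v} + #{v ∈ D | ¬ (p v ↔ p' v)} := by exact_mod_cast h1
    linarith

theorem sum_card_filter_and {n q : ℕ} (S : Finset (Fin n)) (p : Fin n → Prop)
    [DecidablePred p] (e : Fin n → Fin q) :
    ∑ j, #{v ∈ S | p v ∧ e v = j} = #{v ∈ S | p v} := by
  rw [Finset.card_eq_sum_card_fiberwise (f := e) (t := Finset.univ) (by simp)]
  simp only [Finset.filter_filter]

/-- Colourings of two similar component structures can be coupled with matching type counts. -/
theorem exists_colorLaw_subC {q : ℕ} (hq : 1 ≤ q) {c K : ℝ} (hc : 0 < c) (hK : 0 ≤ K) :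
    ∃ ρ : ℝ, 0 < ρ ∧ ∃ N : ℕ, ∀ n : ℕ, N ≤ n → ∀ (h h' : Fin n → Fin n) (t t' : Fin n → Fin q)
      (D J J' : Finset (Fin n)) (m : ℕ),
      (∀ v, h v ∈ D ↔ v ∈ D) → (∀ v, h' v ∈ D ↔ v ∈ D) → (∀ v ∈ D, h v = h' v) →
      Disjoint J D → Disjoint J' D → (∀ v ∈ J, h v = v) → (∀ v ∈ J', h' v = v) →
      (∀ v, h v ∈ J → v ∈ J) → (∀ v, h' v ∈ J' → v ∈ J') →
      c * n ≤ m → (∀ i, #{v ∈ J | t v = i} = q * m) → (∀ i, #{v ∈ J' | t' v = i} = q * m) →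
      (∀ i, #{v | t v = i} = #{v | t' v = i}) →
      (#{v ∈ D | t v ≠ t' v} : ℝ) ≤ K * √n →
      (#{z ∈ Dᶜ ×ˢ Dᶜ | h z.1 = h z.2} : ℝ) ≤ K * n →
      (#{z ∈ Dᶜ ×ˢ Dᶜ | h' z.1 = h' z.2} : ℝ) ≤ K * n →
      SubC (colorLaw (q := q) h) (colorLaw (q := q) h') (fun τ τ' => ∀ i j,
        #{v | t v = i ∧ τ v = j} = #{v | t' v = i ∧ τ' v = j}) ρ := by
  set L : ℝ := 2 * q ^ 2 * K + 1 with hL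
  have hL0 : 0 < L := by positivity
  obtain ⟨ρ, hρ, N, hN⟩ := exists_shift_subC hq hc (X := 2 * K + 2 * L) (by positivity)
  have hq0 : (1 : ℝ) ≤ q := by exact_mod_cast hq
  refine ⟨1 * (1 / 2 * (1 / 2) * (ρ * 1)), by positivity, N + 1, ?_⟩
  intro n hn h h' t t' D J J' m hD hD' hhD hJD hJD' hJ hJ' hJc hJc' hm hJm hJm' htt htK hpair hpair'
  have hn0 : 0 < n := by omega
  have hu : (0 : ℝ) ≤ ((q : ℝ) ^ n)⁻¹ := by positivity
  have hu1 : ∑ _a : Conf n q, ((q : ℝ) ^ n)⁻¹ = 1 := by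
    rw [Finset.sum_const, Finset.card_univ, nsmul_eq_mul, card_conf]
    exact mul_inv_cancel₀ (by positivity)
  rw [funext (colorLaw_eq hq h D J), funext (colorLaw_eq hq h' D J')]
  have hd := SubC.diag (α := Conf n q) (f := fun _ => ((q : ℝ) ^ n)⁻¹) (fun _ => hu)
  rw [hu1] at hd
  have h01 : ∀ (p : Prop) [Decidable p], (0 : ℝ) ≤ if p then 1 else 0 := fun p _ => by positivity
  have hs3 : ∀ (G : Conf n q → ℝ), (∀ e, 0 ≤ G e) → 0 ≤ ∑ e, ((q : ℝ) ^ n)⁻¹ * G e :=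
    fun G hG => Finset.sum_nonneg fun e _ => mul_nonneg hu (hG e)
  refine SubC.mixture hd (fun a τ => hs3 _ fun b => hs3 _ fun e => h01 _)
    (fun a τ => hs3 _ fun b => hs3 _ fun e => h01 _) (by positivity) ?_
  rintro a _ rfl
  have hwin : ∀ (g : Fin n → Fin n) (s : Fin n → Fin q) (I : Finset (Fin n)),
      (#{z ∈ Dᶜ ×ˢ Dᶜ | g z.1 = g z.2} : ℝ) ≤ K * n →
      1 / 2 ≤ ∑ b : Conf n q, if InWindow g s (D ∪ I)ᶜ (L * √n) b then ((q : ℝ) ^ n)⁻¹ else 0 := by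
    intro g s I hg
    have := color_good_count hq hn0 g (D ∪ I)ᶜ s (K := K) (L := L) hL0
      (by rw [hL]; nlinarith [sq_nonneg (2 * (q : ℝ) ^ 2 * K), sq_nonneg (q : ℝ),
            mul_nonneg (sq_nonneg (q : ℝ)) hK])
      (le_trans (by
        norm_cast
        refine Finset.card_le_card (Finset.filter_subset_filter _ ?_)
        refine Finset.product_subset_product ?_ ?_ <;>
        exact Finset.compl_subset_compl.2 Finset.subset_union_left) hg)
    rw [← Finset.sum_filter, Finset.sum_const, nsmul_eq_mul, ← div_eq_mul_inv,
      le_div_iff₀ (by positivity)]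
    have h2 : #{b : Conf n q | ∀ i j, |(#{v ∈ (D ∪ I)ᶜ | s v = i ∧ b (g v) = j} : ℝ) -
        (#{v ∈ (D ∪ I)ᶜ | s v = i} : ℝ) / q| ≤ L * √n} =
        #{b : Conf n q | InWindow g s (D ∪ I)ᶜ (L * √n) b} := card_filter_congr_iff fun b => Iff.rfl
    rw [← h2]
    linarith
  refine SubC.mixture (SubC.indep (fun _ => hu) (fun _ => hu) hu1.le hu1.le _ _ (by norm_num)
    (hwin h t J hpair) (hwin h' t' J' hpair')) (fun b τ => hs3 _ fun e => h01 _)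
    (fun b τ => hs3 _ fun e => h01 _) (by positivity) ?_
  rintro b b' ⟨hb, hb'⟩
  set x : Fin q → Fin q → ℤ := fun i j =>
    ((#{v ∈ D | t v = i ∧ a (h v) = j} : ℤ) + #{v ∈ (D ∪ J)ᶜ | t v = i ∧ b (h v) = j}) -
    ((#{v ∈ D | t' v = i ∧ a (h v) = j} : ℤ) + #{v ∈ (D ∪ J')ᶜ | t' v = i ∧ b' (h' v) = j}) with hx
  have hsp : ∀ i, #{v ∈ D | t v = i} + q * m + #{v ∈ (D ∪ J)ᶜ | t v = i}
      = #{v ∈ D | t' v = i} + q * m + #{v ∈ (D ∪ J')ᶜ | t' v = i} := by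
    intro i
    have h1 := card_filter_split hJD (fun v => t v = i)
    have h2 := card_filter_split hJD' (fun v => t' v = i)
    rw [hJm] at h1; rw [hJm'] at h2
    rw [← h1, ← h2, htt]
  have hDi : ∀ (p p' : Fin n → Prop) [DecidablePred p] [DecidablePred p'], (∀ v, t v = t' v → (p v ↔ p' v)) →
      |(#{v ∈ D | p v} : ℝ) - #{v ∈ D | p' v}| ≤ K * √n := by
    intro p p' _ _ hp
    refine (abs_card_filter_sub_le D p p').trans (le_trans ?_ htK)
    norm_cast
    refine Finset.card_le_card fun v hv => ?_
    simp only [Finset.mem_filter] at hv ⊢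
    exact ⟨hv.1, fun he => hv.2 (hp v he)⟩
  refine SubC.mixture (hN n (by omega) J J' t t' m hm hJm hJm' x ?_ ?_)
    (fun e τ => h01 _) (fun e τ => h01 _) zero_le_one ?_
  · intro i
    simp only [hx, Finset.sum_sub_distrib, Finset.sum_add_distrib]
    simp only [← Nat.cast_sum, sum_card_filter_and]
    have := hsp i
    omega
  · intro i j
    have e1 := hDi (fun v => t v = i ∧ a (h v) = j) (fun v => t' v = i ∧ a (h v) = j)
      (fun v hv => by rw [hv])
    have e2 := hDi (fun v => t v = i) (fun v => t' v = i) (fun v hv => by rw [hv])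
    have e3 : |(#{v ∈ (D ∪ J)ᶜ | t v = i} : ℝ) / q - (#{v ∈ (D ∪ J')ᶜ | t' v = i} : ℝ) / q|
        ≤ K * √n := by
      have : (#{v ∈ (D ∪ J)ᶜ | t v = i} : ℝ) - (#{v ∈ (D ∪ J')ᶜ | t' v = i} : ℝ)
          = -((#{v ∈ D | t v = i} : ℝ) - #{v ∈ D | t' v = i}) := by
        have : (#{v ∈ D | t v = i} + q * m + #{v ∈ (D ∪ J)ᶜ | t v = i} : ℝ)
          = #{v ∈ D | t' v = i} + q * m + #{v ∈ (D ∪ J')ᶜ | t' v = i} := by exact_mod_cast hsp i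
        linarith
      rw [← sub_div, this, abs_div, abs_neg, abs_of_pos (by linarith : (0 : ℝ) < q)]
      exact (div_le_self (abs_nonneg _) hq0).trans e2
    have e4 := hb i j
    have e5 := hb' i j
    simp only [hx]; push_cast
    rw [abs_le] at e1 e3 e4 e5 ⊢
    constructor <;> linarith
  · intro e e' hee
    have hdir : ∀ (R : Conf n q → Conf n q → Prop) (x y : Conf n q), R x y →
        SubC (fun a => if x = a then (1 : ℝ) else 0) (fun b => if y = b then (1 : ℝ) else 0) R 1 := by
      intro R x y hxy
      convert SubC.dirac hxy
    refine hdir _ _ _ fun i j => ?_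
    have hcnt : ∀ (g : Fin n → Fin n) (s : Fin n → Fin q) (I : Finset (Fin n)) (f d : Conf n q),
        (∀ v, g v ∈ D ↔ v ∈ D) → Disjoint I D → (∀ v ∈ I, g v = v) → (∀ v, g v ∈ I → v ∈ I) →
        #{v | s v = i ∧ D.piecewise a (I.piecewise f d) (g v) = j} =
          #{v ∈ D | s v = i ∧ a (g v) = j} + #{v ∈ I | s v = i ∧ f v = j} +
          #{v ∈ (D ∪ I)ᶜ | s v = i ∧ d (g v) = j} := by
      intro g s I f d h1 h2 h3 h4
      rw [card_filter_split h2]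
      congr 1
      · congr 1
        · refine congrArg Finset.card (Finset.filter_congr fun v hv => ?_)
          rw [Finset.piecewise_eq_of_mem _ _ _ ((h1 v).2 hv)]
        · refine congrArg Finset.card (Finset.filter_congr fun v hv => ?_)
          rw [Finset.piecewise_eq_of_notMem _ _ _
            (fun hh => Finset.disjoint_left.1 h2 hv ((h1 v).1 hh)), h3 v hv,
            Finset.piecewise_eq_of_mem _ _ _ hv]
      · refine congrArg Finset.card (Finset.filter_congr fun v hv => ?_)
        simp only [Finset.mem_compl, Finset.mem_union, not_or] at hv
        rw [Finset.piecewise_eq_of_notMem _ _ _ (fun hh => hv.1 ((h1 v).1 hh)),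
          Finset.piecewise_eq_of_notMem _ _ _ (fun hh => hv.2 (h4 v hh))]
    rw [hcnt h t J e b hD hJD hJ hJc, hcnt h' t' J' e' b' hD' hJD' hJ' hJc']
    have hA : #{v ∈ D | t' v = i ∧ a (h' v) = j} = #{v ∈ D | t' v = i ∧ a (h v) = j} :=
      congrArg Finset.card (Finset.filter_congr fun v hv => by rw [hhD v hv])
    rw [hA]
    have := hee i j
    simp only [typeCnt, hx] at this
    zify
    linarith

theorem numComps_eq_card_image {n : ℕ} (E : Finset (Fin n × Fin n)) (h : Fin n → Fin n)
    (hh : ∀ u v, (graphOf E).Reachable u v ↔ h u = h v) :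
    numComps E = #(Finset.univ.image h) := by
  have : Nat.card (graphOf E).ConnectedComponent = Nat.card (Set.range h) := by
    refine Nat.card_eq_of_bijective
      (fun C => C.lift (fun v => (⟨h v, v, rfl⟩ : Set.range h)) ?_) ⟨?_, ?_⟩
    · intro v w p _
      exact Subtype.ext ((hh v w).1 p.reachable)
    · intro C C'
      induction C using SimpleGraph.ConnectedComponent.ind with | _ v => ?_
      induction C' using SimpleGraph.ConnectedComponent.ind with | _ w => ?_
      intro hvw
      exact SimpleGraph.ConnectedComponent.sound ((hh v w).2 (congrArg Subtype.val hvw))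
    · rintro ⟨_, v, rfl⟩
      exact ⟨(graphOf E).connectedComponentMk v, rfl⟩
  rw [numComps, this, Nat.card_eq_fintype_card, ← Set.toFinset_card, Set.toFinset_range]

/-- Colouring the components of a graph uniformly is the law of colouring their roots. -/
theorem ite_eq_colorLaw {n q : ℕ} (hq : 1 ≤ q) (E : Finset (Fin n × Fin n)) (h : Fin n → Fin n)
    (hh : ∀ u v, (graphOf E).Reachable u v ↔ h u = h v) (τ : Conf n q) :
    (if ∀ u v : Fin n, (graphOf E).Reachable u v → τ u = τ v then
        ((q : ℝ))⁻¹ ^ numComps E else 0) = colorLaw h τ := by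
  have hq0 : (q : ℝ) ≠ 0 := by positivity
  rw [colorLaw, ← Finset.mul_sum, Finset.sum_boole]
  split_ifs with hτ
  · choose! r hr using fun (w : Fin n) (hw : w ∈ Finset.univ.image h) => Finset.mem_image.1 hw
    have hset : ({c : Conf n q | (fun v => c (h v)) = τ} : Finset (Conf n q)) =
        Fintype.piFinset fun w => if w ∈ Finset.univ.image h then {τ (r w)} else Finset.univ := by
      ext c
      simp only [Finset.mem_filter, Finset.mem_univ, true_and, Fintype.mem_piFinset]
      constructor
      · rintro rfl w
        split_ifs with hw
        · rw [Finset.mem_singleton]; beta_reduce; rw [(hr w hw).2]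
        · exact Finset.mem_univ _
      · intro hc
        funext v
        have hv : h v ∈ Finset.univ.image h := Finset.mem_image_of_mem h (Finset.mem_univ v)
        have := hc (h v)
        rw [if_pos hv, Finset.mem_singleton] at this
        rw [this]
        exact hτ _ _ ((hh _ _).2 (hr _ hv).2)
    rw [hset, Fintype.card_piFinset, numComps_eq_card_image E h hh]
    have : ∀ w, #(if w ∈ Finset.univ.image h then {τ (r w)} else (Finset.univ : Finset (Fin q)))
        = if w ∈ Finset.univ.image h then 1 else q := by
      intro w; split_ifs <;> simp
    simp only [this]
    rw [Finset.prod_ite, Finset.prod_const_one, one_mul, Finset.prod_const]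
    have hc : #{w : Fin n | w ∉ Finset.univ.image h} + #(Finset.univ.image h) = n := by
      have := Finset.card_compl_add_card (Finset.univ.image h)
      rw [Fintype.card_fin] at this
      refine Eq.trans ?_ this
      congr 2; ext; simp
    have hpow : (q : ℝ) ^ n = (q : ℝ) ^ #{w : Fin n | w ∉ Finset.univ.image h} *
        (q : ℝ) ^ #(Finset.univ.image h) := by rw [← pow_add, hc]
    push_cast
    rw [hpow, inv_pow]
    field_simp
  · rw [Finset.filter_false_of_mem, Finset.card_empty, Nat.cast_zero, mul_zero]
    rintro c - rfl
    exact hτ fun u v huv => by beta_reduce; rw [(hh u v).1 huv]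

/-- A representative of each class of a relation: its least element. -/
noncomputable def minRep {n : ℕ} (R : Fin n → Fin n → Prop) (v : Fin n) : Fin n :=
  if h : ∃ u, R u v then (Finset.univ.filter fun u => R u v).min' (by simpa [Finset.Nonempty] using h)
  else v

theorem rel_minRep {n : ℕ} {R : Fin n → Fin n → Prop} (hR : Equivalence R) (v : Fin n) :
    R (minRep R v) v := by
  have h : ∃ u, R u v := ⟨v, hR.refl v⟩
  rw [minRep, dif_pos h]
  exact (Finset.mem_filter.1 (Finset.min'_mem (Finset.univ.filter fun u => R u v)
    ⟨v, by simpa using hR.refl v⟩)).2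

theorem rel_iff_minRep_eq {n : ℕ} {R : Fin n → Fin n → Prop} (hR : Equivalence R) (u v : Fin n) :
    R u v ↔ minRep R u = minRep R v := by
  constructor
  · intro huv
    have : ∀ w, R w u ↔ R w v := fun w => ⟨fun h => hR.trans h huv, fun h => hR.trans h (hR.symm huv)⟩
    have hv : ∃ w, R w v := ⟨v, hR.refl v⟩
    simp only [minRep, dif_pos hv, this]
  · intro h
    exact hR.trans (hR.symm (rel_minRep hR u)) (h ▸ rel_minRep hR v)

section Percolation

variable {γ : Type*}

/-- Expectation of `f` under percolation on `S` with closing probability `y`. -/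
def percExp (y : ℝ) (S : Finset γ) (f : Finset γ → ℝ) : ℝ :=
  ∑ E ∈ S.powerset, (1 - y) ^ #E * y ^ (#S - #E) * f E

theorem percExp_empty (y : ℝ) (f : Finset γ → ℝ) : percExp y ∅ f = f ∅ := by
  simp [percExp]

theorem percExp_congr {y : ℝ} {S : Finset γ} {f g : Finset γ → ℝ} (h : ∀ E ⊆ S, f E = g E) :
    percExp y S f = percExp y S g :=
  Finset.sum_congr rfl fun E hE => by rw [h E (Finset.mem_powerset.1 hE)]

theorem percExp_add (y : ℝ) (S : Finset γ) (f g : Finset γ → ℝ) :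
    percExp y S (fun E => f E + g E) = percExp y S f + percExp y S g := by
  simp only [percExp, mul_add, Finset.sum_add_distrib]

theorem percExp_mul_left (y : ℝ) (S : Finset γ) (c : ℝ) (f : Finset γ → ℝ) :
    percExp y S (fun E => c * f E) = c * percExp y S f := by
  simp only [percExp, Finset.mul_sum]
  exact Finset.sum_congr rfl fun E _ => by ring

theorem percExp_sum {ι : Type*} (y : ℝ) (S : Finset γ) (I : Finset ι) (f : ι → Finset γ → ℝ) :
    percExp y S (fun E => ∑ i ∈ I, f i E) = ∑ i ∈ I, percExp y S (f i) := by
  simp only [percExp, Finset.mul_sum]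
  exact Finset.sum_comm

theorem percExp_mono {y : ℝ} (hy0 : 0 ≤ y) (hy1 : y ≤ 1) {S : Finset γ} {f g : Finset γ → ℝ}
    (h : ∀ E ⊆ S, f E ≤ g E) : percExp y S f ≤ percExp y S g :=
  Finset.sum_le_sum fun E hE => mul_le_mul_of_nonneg_left (h E (Finset.mem_powerset.1 hE))
    (mul_nonneg (pow_nonneg (by linarith) _) (pow_nonneg hy0 _))

/-- Probability of `A` under percolation on `S` with closing probability `y`. -/
noncomputable def percProb (y : ℝ) (S : Finset γ) (A : Finset γ → Prop) : ℝ :=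
  percExp y S fun E => if A E then 1 else 0

theorem percProb_mono {y : ℝ} (hy0 : 0 ≤ y) (hy1 : y ≤ 1) {S : Finset γ} {A B : Finset γ → Prop}
    (h : ∀ E ⊆ S, A E → B E) : percProb y S A ≤ percProb y S B := by
  refine percExp_mono hy0 hy1 fun E hE => ?_
  by_cases hA : A E
  · rw [if_pos hA, if_pos (h E hE hA)]
  · rw [if_neg hA]; positivity

theorem percProb_or_le {y : ℝ} (hy0 : 0 ≤ y) (hy1 : y ≤ 1) (S : Finset γ) (A B : Finset γ → Prop) :
    percProb y S (fun E => A E ∨ B E) ≤ percProb y S A + percProb y S B := by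
  rw [percProb, percProb, percProb, ← percExp_add]
  refine percExp_mono hy0 hy1 fun E _ => ?_
  by_cases hA : A E <;> by_cases hB : B E <;> simp [hA, hB]

theorem percProb_exists_le {y : ℝ} (hy0 : 0 ≤ y) (hy1 : y ≤ 1) (S : Finset γ) {q : ℕ}
    (A : Fin q → Finset γ → Prop) :
    percProb y S (fun E => ∃ i, A i E) ≤ ∑ i, percProb y S (A i) := by
  simp only [percProb]
  rw [← percExp_sum]
  refine percExp_mono hy0 hy1 fun E _ => ?_
  have h0 : ∀ i ∈ Finset.univ, (0 : ℝ) ≤ if A i E then 1 else 0 := fun i _ => by positivity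
  split_ifs with h
  · obtain ⟨i, hi⟩ := h
    have := Finset.single_le_sum h0 (Finset.mem_univ i)
    rwa [if_pos hi] at this
  · exact Finset.sum_nonneg h0

/-- Markov's inequality. -/
theorem percProb_mul_le {y : ℝ} (hy0 : 0 ≤ y) (hy1 : y ≤ 1) (S : Finset γ) {g : Finset γ → ℝ}
    (hg : ∀ E, 0 ≤ g E) (B : ℝ) :
    percProb y S (fun E => B < g E) * B ≤ percExp y S g := by
  rw [percProb, mul_comm, ← percExp_mul_left]
  refine percExp_mono hy0 hy1 fun E _ => ?_
  split_ifs with h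
  · linarith
  · simpa using hg E

variable [DecidableEq γ]

/-- The percolation weight of `E` as a subset of `S`. -/
def percW (y : ℝ) (S E : Finset γ) : ℝ :=
  if E ⊆ S then (1 - y) ^ #E * y ^ (#S - #E) else 0

theorem percExp_insert (y : ℝ) {S : Finset γ} {a : γ} (ha : a ∉ S) (f : Finset γ → ℝ) :
    percExp y (insert a S) f = y * percExp y S f + (1 - y) * percExp y S fun E => f (insert a E) := by
  rw [percExp, Finset.sum_powerset_insert ha, percExp, percExp, Finset.mul_sum, Finset.mul_sum]
  congr 1
  · refine Finset.sum_congr rfl fun E hE => ?_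
    have := Finset.card_le_card (Finset.mem_powerset.1 hE)
    rw [Finset.card_insert_of_notMem ha, Nat.sub_add_comm this, pow_succ]
    ring
  · refine Finset.sum_congr rfl fun E hE => ?_
    have haE : a ∉ E := fun h => ha (Finset.mem_powerset.1 hE h)
    rw [Finset.card_insert_of_notMem ha, Finset.card_insert_of_notMem haE, Nat.add_sub_add_right,
      pow_succ]
    ring

theorem percExp_const (y : ℝ) (S : Finset γ) (c : ℝ) : percExp y S (fun _ => c) = c := by
  induction S using Finset.induction_on with
  | empty => exact percExp_empty y _
  | insert a S ha ih => rw [percExp_insert y ha, ih]; ring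

theorem percExp_union (y : ℝ) {S T : Finset γ} (hST : Disjoint S T) (f : Finset γ → ℝ) :
    percExp y (S ∪ T) f = percExp y S fun E => percExp y T fun E' => f (E ∪ E') := by
  induction S using Finset.induction_on generalizing f with
  | empty => rw [percExp_empty, Finset.empty_union]; simp only [Finset.empty_union]
  | insert a S ha ih =>
    rw [Finset.disjoint_insert_left] at hST
    rw [Finset.insert_union, percExp_insert y (by simp [ha, hST.1]), percExp_insert y ha,
      ih hST.2, ih hST.2]
    simp only [Finset.insert_union]

theorem percW_nonneg {y : ℝ} (hy0 : 0 ≤ y) (hy1 : y ≤ 1) (S E : Finset γ) : 0 ≤ percW y S E := by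
  unfold percW
  split_ifs
  · exact mul_nonneg (pow_nonneg (by linarith) _) (pow_nonneg hy0 _)
  · exact le_rfl

theorem sum_percW_mul [Fintype γ] (y : ℝ) (S : Finset γ) (f : Finset γ → ℝ) :
    ∑ E, percW y S E * f E = percExp y S f := by
  simp only [percW, ite_mul, zero_mul, percExp]
  rw [← Finset.sum_filter]
  refine Finset.sum_congr ?_ fun _ _ => rfl
  ext E; simp

theorem sum_percW [Fintype γ] (y : ℝ) (S : Finset γ) : ∑ E, percW y S E = 1 := by
  have := sum_percW_mul y S (fun _ => 1)
  rw [percExp_const] at this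
  simpa using this

theorem sum_ite_percW [Fintype γ] (y : ℝ) (S : Finset γ) (A : Finset γ → Prop) :
    ∑ E, (if A E then percW y S E else 0) = percProb y S A := by
  rw [percProb, ← sum_percW_mul]
  refine Finset.sum_congr rfl fun E _ => ?_
  split_ifs <;> simp

theorem percProb_not (y : ℝ) (S : Finset γ) (A : Finset γ → Prop) :
    percProb y S (fun E => ¬ A E) = 1 - percProb y S A := by
  have : percProb y S A + percProb y S (fun E => ¬ A E) = 1 := by
    rw [percProb, percProb, ← percExp_add]
    refine (percExp_congr fun E _ => ?_).trans (percExp_const y S 1)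
    by_cases hA : A E <;> simp [hA]
  linarith

theorem percProb_disjoint (y : ℝ) {S T : Finset γ} (hT : T ⊆ S) :
    percProb y S (fun E => Disjoint E T) = y ^ #T := by
  have hS : S = T ∪ (S \ T) := (Finset.union_sdiff_of_subset hT).symm
  rw [percProb, hS, percExp_union y Finset.disjoint_sdiff]
  have h1 : ∀ E ⊆ T, (percExp y (S \ T) fun E' => if Disjoint (E ∪ E') T then (1 : ℝ) else 0)
      = if E = ∅ then 1 else 0 := by
    intro E hE
    refine (percExp_congr fun E' hE' => ?_).trans (percExp_const y _ _)
    have : Disjoint (E ∪ E') T ↔ E = ∅ := by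
      rw [Finset.disjoint_union_left]
      constructor
      · intro h
        exact Finset.disjoint_self_iff_empty _ |>.1 (h.1.mono_right hE)
      · rintro rfl
        exact ⟨Finset.disjoint_empty_left _, Finset.sdiff_disjoint.mono_left hE'⟩
    simp only [this]
  have h2 : ∀ U : Finset γ, (percExp y U fun E => if E = ∅ then (1 : ℝ) else 0) = y ^ #U := by
    intro U
    induction U using Finset.induction_on with
    | empty => rw [percExp_empty]; simp
    | insert a U ha ih =>
      rw [percExp_insert y ha, ih, Finset.card_insert_of_notMem ha]
      simp only [Finset.insert_ne_empty, if_false, percExp_const]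
      ring
  refine Eq.trans (percExp_congr fun E hE => ?_) (h2 T)
  rw [← h1 E hE]
  refine percExp_congr fun E' _ => ?_
  congr

theorem percProb_mem (y : ℝ) {S : Finset γ} {e : γ} (he : e ∈ S) :
    percProb y S (fun E => e ∈ E) = 1 - y := by
  have := percProb_disjoint y (Finset.singleton_subset_iff.2 he)
  simp only [Finset.disjoint_singleton_right, Finset.card_singleton, pow_one] at this
  rw [percProb_not] at this
  linarith

end Percolation

/-- No edge of `E` is incident to `v`. -/
def Untouched {n : ℕ} (E : Finset (Fin n × Fin n)) (v : Fin n) : Prop :=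
  ∀ e ∈ E, e.1 ≠ v ∧ e.2 ≠ v

/-- The pairs of `S` incident to `v`. -/
def pairsAt {n : ℕ} (S : Finset (Fin n × Fin n)) (v : Fin n) : Finset (Fin n × Fin n) :=
  {e ∈ S | e.1 = v ∨ e.2 = v}

/-- The number of vertices of `U` incident to no edge of `E`. -/
noncomputable def isoCnt {n : ℕ} (E : Finset (Fin n × Fin n)) (U : Finset (Fin n)) : ℕ :=
  #{v ∈ U | Untouched E v}

/-- The expected number of isolated vertices of `U` under percolation on `S`. -/
def isoMean {n : ℕ} (y : ℝ) (S : Finset (Fin n × Fin n)) (U : Finset (Fin n)) : ℝ :=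
  ∑ v ∈ U, y ^ #(pairsAt S v)

theorem untouched_iff_disjoint_pairsAt {n : ℕ} {S E : Finset (Fin n × Fin n)} (hE : E ⊆ S)
    (v : Fin n) : Untouched E v ↔ Disjoint E (pairsAt S v) := by
  simp only [Untouched, Finset.disjoint_left, pairsAt, Finset.mem_filter, not_and, not_or]
  exact ⟨fun h e he _ => h e he, fun h e he => h he (hE he)⟩

theorem card_pairsAt_inter_le {n : ℕ} {S : Finset (Fin n × Fin n)} (hS : ∀ e ∈ S, e.1 < e.2)
    {u v : Fin n} (huv : u ≠ v) : #(pairsAt S u ∩ pairsAt S v) ≤ 1 := by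
  rw [Finset.card_le_one]
  intro e he f hf
  simp only [pairsAt, Finset.mem_inter, Finset.mem_filter] at he hf
  have h1 := hS e he.1.1
  have h2 := hS f hf.1.1
  refine Prod.ext ?_ ?_
  all_goals
    rcases he.1.2 with h3 | h3 <;> rcases he.2.2 with h4 | h4 <;> rcases hf.1.2 with h5 | h5 <;>
      rcases hf.2.2 with h6 | h6 <;> first
      | exact absurd (h3.symm.trans h4) huv
      | exact absurd (h5.symm.trans h6) huv
      | simp only [h3, h4, h5, h6] at *
    all_goals exact absurd h1 (lt_asymm h2)

theorem percExp_isoCnt_variance {n : ℕ} {S : Finset (Fin n × Fin n)} (hS : ∀ e ∈ S, e.1 < e.2)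
    (U : Finset (Fin n)) {y β : ℝ} (hy0 : 0 ≤ y) (hy1 : y ≤ 1) (hβ : (1 - y) * n ≤ β) :
    percExp y S (fun E => ((isoCnt E U : ℝ) - isoMean y S U) ^ 2) ≤ (1 + β) * n := by
  set I : Fin n → Finset (Fin n × Fin n) → ℝ := fun v E => if Untouched E v then 1 else 0 with hI
  have hIm : ∀ v, percExp y S (I v) = y ^ #(pairsAt S v) := by
    intro v
    rw [← percProb_disjoint y (S := S) (T := pairsAt S v) (Finset.filter_subset _ _)]
    refine percExp_congr fun E hE => ?_
    simp only [hI, untouched_iff_disjoint_pairsAt hE]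
    congr
  have hII : ∀ u v, percExp y S (fun E => I u E * I v E) = y ^ #(pairsAt S u ∪ pairsAt S v) := by
    intro u v
    rw [← percProb_disjoint y (S := S) (T := pairsAt S u ∪ pairsAt S v)
      (Finset.union_subset (Finset.filter_subset _ _) (Finset.filter_subset _ _))]
    refine percExp_congr fun E hE => ?_
    simp only [hI, untouched_iff_disjoint_pairsAt hE, Finset.disjoint_union_right]
    by_cases h1 : Disjoint E (pairsAt S u) <;> by_cases h2 : Disjoint E (pairsAt S v) <;>
      simp [h1, h2]
  have hcov : ∀ u v, percExp y S (fun E => (I u E - y ^ #(pairsAt S u)) * (I v E - y ^ #(pairsAt S v)))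
      = y ^ #(pairsAt S u ∪ pairsAt S v) - y ^ #(pairsAt S u) * y ^ #(pairsAt S v) := by
    intro u v
    have : (fun E => (I u E - y ^ #(pairsAt S u)) * (I v E - y ^ #(pairsAt S v))) = fun E =>
        (I u E * I v E + (-y ^ #(pairsAt S u)) * I v E) + ((-y ^ #(pairsAt S v)) * I u E
          + y ^ #(pairsAt S u) * y ^ #(pairsAt S v)) := by
      funext E; ring
    rw [this, percExp_add, percExp_add, percExp_add, percExp_mul_left, percExp_mul_left,
      percExp_const, hII, hIm, hIm]
    ring
  have hbound : ∀ u v, y ^ #(pairsAt S u ∪ pairsAt S v) - y ^ #(pairsAt S u) * y ^ #(pairsAt S v)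
      ≤ (if u = v then 1 else 0) + (1 - y) := by
    intro u v
    by_cases huv : u = v
    · rw [if_pos huv]
      have h1 : y ^ #(pairsAt S u ∪ pairsAt S v) ≤ 1 := pow_le_one₀ hy0 hy1
      have h2 : 0 ≤ y ^ #(pairsAt S u) * y ^ #(pairsAt S v) := by positivity
      linarith
    · rw [if_neg huv, ← pow_add, ← Finset.card_union_add_card_inter]
      have h1 : y ^ (#(pairsAt S u ∪ pairsAt S v) + 1) ≤
          y ^ (#(pairsAt S u ∪ pairsAt S v) + #(pairsAt S u ∩ pairsAt S v)) :=
        pow_le_pow_of_le_one hy0 hy1 (by have := card_pairsAt_inter_le hS huv; omega)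
      have h2 : y ^ #(pairsAt S u ∪ pairsAt S v) ≤ 1 := pow_le_one₀ hy0 hy1
      rw [pow_succ] at h1
      nlinarith
  have hsq : (fun E => ((isoCnt E U : ℝ) - isoMean y S U) ^ 2) = fun E => ∑ u ∈ U, ∑ v ∈ U,
      (I u E - y ^ #(pairsAt S u)) * (I v E - y ^ #(pairsAt S v)) := by
    funext E
    rw [← Finset.sum_mul_sum, sq]
    have : (isoCnt E U : ℝ) - isoMean y S U = ∑ u ∈ U, (I u E - y ^ #(pairsAt S u)) := by
      rw [Finset.sum_sub_distrib, isoMean, isoCnt, Finset.sum_boole]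
    rw [this]
  rw [hsq, percExp_sum]
  simp only [percExp_sum, hcov]
  have hU : (#U : ℝ) ≤ n := by
    exact_mod_cast (Finset.card_le_univ U).trans_eq (Fintype.card_fin n)
  have h1y : 0 ≤ 1 - y := by linarith
  calc _ ≤ ∑ u ∈ U, ∑ v ∈ U, ((if u = v then (1 : ℝ) else 0) + (1 - y)) :=
        Finset.sum_le_sum fun u _ => Finset.sum_le_sum fun v _ => hbound u v
    _ = ∑ u ∈ U, (1 + #U * (1 - y)) := by
        refine Finset.sum_congr rfl fun u hu => ?_
        rw [Finset.sum_add_distrib, Finset.sum_ite_eq, if_pos hu, Finset.sum_const, nsmul_eq_mul]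
    _ = #U * (1 + #U * (1 - y)) := by rw [Finset.sum_const, nsmul_eq_mul]
    _ ≤ n * (1 + n * (1 - y)) := by gcongr
    _ ≤ n * (1 + β) := by gcongr; linarith
    _ = _ := mul_comm _ _

theorem percProb_isoCnt_le {n : ℕ} (hn : 0 < n) {S : Finset (Fin n × Fin n)}
    (hS : ∀ e ∈ S, e.1 < e.2) (U : Finset (Fin n)) {y β L : ℝ} (hy0 : 0 ≤ y) (hy1 : y ≤ 1)
    (hβ : (1 - y) * n ≤ β) (hL : 0 < L) :
    percProb y S (fun E => L * √n < |(isoCnt E U : ℝ) - isoMean y S U|) ≤ (1 + β) / L ^ 2 := by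
  have hn0 : (0 : ℝ) < n := by exact_mod_cast hn
  have h1 := percExp_isoCnt_variance hS U hy0 hy1 hβ
  have h2 := percProb_mul_le hy0 hy1 S (g := fun E => ((isoCnt E U : ℝ) - isoMean y S U) ^ 2)
    (fun E => sq_nonneg _) (L ^ 2 * n)
  have h3 : percProb y S (fun E => L * √n < |(isoCnt E U : ℝ) - isoMean y S U|) ≤
      percProb y S (fun E => L ^ 2 * n < ((isoCnt E U : ℝ) - isoMean y S U) ^ 2) := by
    refine percProb_mono hy0 hy1 fun E _ h => ?_
    have := pow_lt_pow_left₀ h (by positivity) two_ne_zero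
    rwa [mul_pow, Real.sq_sqrt hn0.le, sq_abs] at this
  refine h3.trans ?_
  rw [le_div_iff₀ (by positivity)]
  have h4 := h2.trans h1
  rw [← mul_assoc] at h4
  exact le_of_mul_le_mul_right h4 hn0

/-- `u` and `v` lie in the same component of the graph `(V, E)`. -/
def Conn {n : ℕ} (E : Finset (Fin n × Fin n)) (u v : Fin n) : Prop :=
  (graphOf E).Reachable u v

theorem Conn.equivalence {n : ℕ} (E : Finset (Fin n × Fin n)) : Equivalence (Conn E) :=
  ⟨fun v => SimpleGraph.Reachable.refl v, fun h => h.symm, fun h h' => h.trans h'⟩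

theorem Conn.induction_on {n : ℕ} {E : Finset (Fin n × Fin n)} {v : Fin n} {p : Fin n → Prop}
    {u : Fin n} (h : Conn E v u) (h0 : p v)
    (hs : ∀ a b, p a → ((a, b) ∈ E ∨ (b, a) ∈ E) → p b) : p u := by
  rw [Conn, SimpleGraph.reachable_iff_reflTransGen] at h
  induction h with
  | refl => exact h0
  | tail _ hab ih =>
    rw [graphOf, SimpleGraph.fromRel_adj] at hab
    exact hs _ _ ih hab.2

theorem Conn.of_mem {n : ℕ} {E : Finset (Fin n × Fin n)} {a b : Fin n}
    (h : (a, b) ∈ E ∨ (b, a) ∈ E) : Conn E a b := by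
  by_cases hab : a = b
  · subst hab; exact SimpleGraph.Reachable.refl a
  · exact SimpleGraph.Adj.reachable (by rw [graphOf, SimpleGraph.fromRel_adj]; exact ⟨hab, h⟩)

theorem Conn.mono {n : ℕ} {E E' : Finset (Fin n × Fin n)} (h : E ⊆ E') {u v : Fin n}
    (huv : Conn E u v) : Conn E' u v :=
  huv.induction_on ((Conn.equivalence E').refl u) fun _ _ h1 h2 =>
    (Conn.equivalence E').trans h1 (Conn.of_mem (h2.imp (@h _) (@h _)))

/-- If all edges of `G` meeting `W` stay inside `W` and belong to `E`, then inside `W` the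
components of `G` are components of `E`. -/
theorem Conn.of_closed {n : ℕ} {G E : Finset (Fin n × Fin n)} {W : Finset (Fin n)}
    (hW : ∀ e ∈ G, e.1 ∈ W ∨ e.2 ∈ W → e ∈ E ∧ e.1 ∈ W ∧ e.2 ∈ W) {v u : Fin n} (hv : v ∈ W)
    (h : Conn G v u) : Conn E v u ∧ u ∈ W := by
  refine h.induction_on (p := fun u => Conn E v u ∧ u ∈ W) ⟨(Conn.equivalence E).refl v, hv⟩ ?_
  rintro a b ⟨h1, ha⟩ (h2 | h2)
  · obtain ⟨h3, -, h4⟩ := hW _ h2 (Or.inl ha)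
    exact ⟨(Conn.equivalence E).trans h1 (Conn.of_mem (Or.inl h3)), h4⟩
  · obtain ⟨h3, h4, -⟩ := hW _ h2 (Or.inr ha)
    exact ⟨(Conn.equivalence E).trans h1 (Conn.of_mem (Or.inr h3)), h4⟩

theorem Untouched.eq_of_conn {n : ℕ} {E : Finset (Fin n × Fin n)} {u v : Fin n}
    (hv : Untouched E v) (h : Conn E v u) : u = v := by
  refine h.induction_on (p := fun u => u = v) rfl ?_
  rintro a b rfl (h2 | h2)
  · exact absurd rfl (hv _ h2).1
  · exact absurd rfl (hv _ h2).2

/-- The endpoint of `e` other than `u`. -/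
def otherEnd {n : ℕ} (u : Fin n) (e : Fin n × Fin n) : Fin n :=
  if e.1 = u then e.2 else e.1

theorem Conn.eq_or_exists {n : ℕ} {E₁ E₂ : Finset (Fin n × Fin n)} {u v : Fin n}
    (h1 : ∀ e ∈ E₁, e.1 = u ∨ e.2 = u) (h2 : Untouched E₂ u) (h : Conn (E₁ ∪ E₂) u v) :
    v = u ∨ ∃ e ∈ E₁, Conn E₂ (otherEnd u e) v := by
  have hrefl := fun w => (Conn.equivalence E₂).refl w
  refine h.induction_on (p := fun v => v = u ∨ ∃ e ∈ E₁, Conn E₂ (otherEnd u e) v) (Or.inl rfl)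
    fun a b ha hab => ?_
  by_cases hb : b = u
  · exact Or.inl hb
  right
  rw [Finset.mem_union, Finset.mem_union] at hab
  rcases hab with (h3 | h3) | (h3 | h3)
  · have hau : a = u := (h1 _ h3).resolve_right hb
    exact ⟨_, h3, by rw [otherEnd, if_pos hau]; exact hrefl b⟩
  · rcases ha with rfl | ⟨e, he, hea⟩
    · exact absurd rfl (h2 _ h3).1
    · exact ⟨e, he, (Conn.equivalence E₂).trans hea (Conn.of_mem (Or.inl h3))⟩
  · exact ⟨_, h3, by rw [otherEnd, if_neg hb]; exact hrefl b⟩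
  · rcases ha with rfl | ⟨e, he, hea⟩
    · exact absurd rfl (h2 _ h3).2
    · exact ⟨e, he, (Conn.equivalence E₂).trans hea (Conn.of_mem (Or.inr h3))⟩

/-- The number of vertices connected to `u`. -/
noncomputable def connCnt {n : ℕ} (E : Finset (Fin n × Fin n)) (u : Fin n) : ℕ :=
  #{v : Fin n | Conn E u v}

theorem connCnt_union_le {n : ℕ} {E₁ E₂ : Finset (Fin n × Fin n)} {u : Fin n}
    (h1 : ∀ e ∈ E₁, e.1 = u ∨ e.2 = u) (h2 : Untouched E₂ u) :
    connCnt (E₁ ∪ E₂) u ≤ 1 + ∑ e ∈ E₁, connCnt E₂ (otherEnd u e) := by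
  have : ({v : Fin n | Conn (E₁ ∪ E₂) u v} : Finset (Fin n)) ⊆
      {u} ∪ E₁.biUnion fun e => {v : Fin n | Conn E₂ (otherEnd u e) v} := by
    intro v hv
    have := Conn.eq_or_exists h1 h2 (Finset.mem_filter.1 hv).2
    simpa using this
  refine (Finset.card_le_card this).trans ((Finset.card_union_le _ _).trans ?_)
  rw [Finset.card_singleton]
  exact Nat.add_le_add_left Finset.card_biUnion_le _

theorem percExp_connCnt_le {n : ℕ} {y : ℝ} (hy0 : 0 ≤ y) (hy1 : y ≤ 1) {M : ℝ}
    (hM1 : (1 - y) * M < 1) (S : Finset (Fin n × Fin n)) (hM : ∀ v, (#(pairsAt S v) : ℝ) ≤ M)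
    (u : Fin n) : percExp y S (fun E => (connCnt E u : ℝ)) ≤ (1 - (1 - y) * M)⁻¹ := by
  induction S using Finset.strongInduction generalizing u with
  | H S ih =>
    have hpos : 0 < 1 - (1 - y) * M := by linarith
    have hM0 : 0 ≤ M := (Nat.cast_nonneg _).trans (hM u)
    have hone : 1 ≤ (1 - (1 - y) * M)⁻¹ := by
      rw [one_le_inv₀ hpos]; nlinarith
    set T := pairsAt S u with hT
    have hTS : T ⊆ S := Finset.filter_subset _ _
    have hTu : ∀ e ∈ T, e.1 = u ∨ e.2 = u := fun e he => (Finset.mem_filter.1 he).2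
    have hun : ∀ E ⊆ S \ T, Untouched E u := by
      intro E hE e he
      have := hE he
      simp only [Finset.mem_sdiff, hT, pairsAt, Finset.mem_filter, not_and, not_or] at this
      exact this.2 this.1
    have hS : S = T ∪ (S \ T) := (Finset.union_sdiff_of_subset hTS).symm
    have hrec : ∀ e ∈ T, percExp y (S \ T) (fun E => (connCnt E (otherEnd u e) : ℝ))
        ≤ (1 - (1 - y) * M)⁻¹ := by
      intro e he
      refine ih (S \ T) (Finset.sdiff_ssubset hTS ⟨e, he⟩) (fun v => ?_) _
      refine le_trans ?_ (hM v)
      exact_mod_cast Finset.card_le_card (Finset.filter_subset_filter _ Finset.sdiff_subset)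
    calc percExp y S (fun E => (connCnt E u : ℝ))
        = percExp y T fun E₁ => percExp y (S \ T) fun E₂ => (connCnt (E₁ ∪ E₂) u : ℝ) := by
          conv_lhs => rw [hS]
          exact percExp_union y Finset.disjoint_sdiff _
      _ ≤ percExp y T fun E₁ => percExp y (S \ T) fun E₂ =>
            1 + ∑ e ∈ T, (if e ∈ E₁ then (1 : ℝ) else 0) * connCnt E₂ (otherEnd u e) := by
          refine percExp_mono hy0 hy1 fun E₁ h₁ => percExp_mono hy0 hy1 fun E₂ h₂ => ?_
          have h := connCnt_union_le (fun e he => hTu e (h₁ he)) (hun E₂ h₂)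
          simp only [ite_mul, one_mul, zero_mul]
          rw [← Finset.sum_filter, Finset.filter_mem_eq_inter, Finset.inter_eq_right.2 h₁]
          exact_mod_cast h
      _ = percExp y T fun E₁ => 1 + ∑ e ∈ T, percExp y (S \ T)
            (fun E₂ => (connCnt E₂ (otherEnd u e) : ℝ)) * (if e ∈ E₁ then (1 : ℝ) else 0) := by
          refine percExp_congr fun E₁ _ => ?_
          rw [percExp_add, percExp_const, percExp_sum]
          simp only [percExp_mul_left]
          congr 1
          exact Finset.sum_congr rfl fun e _ => mul_comm _ _
      _ = 1 + ∑ e ∈ T, percExp y (S \ T) (fun E₂ => (connCnt E₂ (otherEnd u e) : ℝ)) * (1 - y) := by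
          rw [percExp_add, percExp_const, percExp_sum]
          simp only [percExp_mul_left]
          congr 1
          refine Finset.sum_congr rfl fun e he => ?_
          rw [← percProb_mem y he, percProb]
          congr 2
          funext E₁
          congr
      _ ≤ 1 + ∑ e ∈ T, (1 - (1 - y) * M)⁻¹ * (1 - y) := by
          have h1y : 0 ≤ 1 - y := by linarith
          gcongr with e he
          exact hrec e he
      _ ≤ 1 + M * ((1 - (1 - y) * M)⁻¹ * (1 - y)) := by
          have h1y : 0 ≤ 1 - y := by linarith
          rw [Finset.sum_const, nsmul_eq_mul]
          gcongr
          exact hM u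
      _ = (1 - (1 - y) * M)⁻¹ := by
          have := mul_inv_cancel₀ hpos.ne'
          linear_combination -this

/-- In subcritical percolation the number of connected pairs is linear. -/
theorem percProb_card_conn_le {n : ℕ} (hn : 0 < n) {y : ℝ} (hy0 : 0 ≤ y) (hy1 : y ≤ 1) {M b K : ℝ}
    (hb : 0 < b) (hM1 : (1 - y) * M ≤ 1 - b) (S : Finset (Fin n × Fin n))
    (hM : ∀ v, (#(pairsAt S v) : ℝ) ≤ M) (hK : 0 < K) :
    percProb y S (fun E => K * n < #{z : Fin n × Fin n | Conn E z.1 z.2}) ≤ 1 / (K * b) := by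
  have hn0 : (0 : ℝ) < n := by exact_mod_cast hn
  have h1 := percProb_mul_le hy0 hy1 S
    (g := fun E => (#{z : Fin n × Fin n | Conn E z.1 z.2} : ℝ)) (fun E => Nat.cast_nonneg _) (K * n)
  have h2 : percExp y S (fun E => (#{z : Fin n × Fin n | Conn E z.1 z.2} : ℝ)) ≤ n * b⁻¹ := by
    have : (fun E => (#{z : Fin n × Fin n | Conn E z.1 z.2} : ℝ)) =
        fun E => ∑ u : Fin n, (connCnt E u : ℝ) := by
      funext E
      rw [← Nat.cast_sum]
      congr 1
      rw [Finset.card_filter, Fintype.sum_prod_type]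
      refine Finset.sum_congr rfl fun u _ => ?_
      rw [connCnt, Finset.card_filter]
    rw [this, percExp_sum]
    calc _ ≤ ∑ u : Fin n, b⁻¹ := Finset.sum_le_sum fun u _ =>
          (percExp_connCnt_le hy0 hy1 (by linarith) S hM u).trans
            (inv_anti₀ hb (by linarith))
      _ = n * b⁻¹ := by simp
  rw [le_div_iff₀ (by positivity)]
  have h3 := h1.trans h2
  have h4 : percProb y S (fun E => K * n < #{z : Fin n × Fin n | Conn E z.1 z.2}) * (K * b) * n
      ≤ 1 * n := by
    calc _ = percProb y S (fun E => K * n < #{z : Fin n × Fin n | Conn E z.1 z.2}) * (K * n) * b := by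
          ring
      _ ≤ n * b⁻¹ * b := by gcongr
      _ = _ := by field_simp
  exact le_of_mul_le_mul_right h4 hn0

/-- The ordered pairs `u < v` with both entries in `D`. -/
def pairsIn {n : ℕ} (D : Finset (Fin n)) : Finset (Fin n × Fin n) :=
  {e | e.1 < e.2 ∧ e.1 ∈ D ∧ e.2 ∈ D}

theorem mem_pairsIn {n : ℕ} {D : Finset (Fin n)} {e : Fin n × Fin n} :
    e ∈ pairsIn D ↔ e.1 < e.2 ∧ e.1 ∈ D ∧ e.2 ∈ D := by
  simp [pairsIn]

theorem pairsIn_mono {n : ℕ} {D D' : Finset (Fin n)} (h : D ⊆ D') : pairsIn D ⊆ pairsIn D' :=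
  fun _ he => mem_pairsIn.2 ⟨(mem_pairsIn.1 he).1, h (mem_pairsIn.1 he).2.1,
    h (mem_pairsIn.1 he).2.2⟩

theorem two_mul_card_pairsIn {n : ℕ} (D : Finset (Fin n)) :
    2 * #(pairsIn D) + #D = #D * #D := by
  have h1 : #(pairsIn D) = #{e ∈ D ×ˢ D | e.1 < e.2} := by
    congr 1; ext e; simp [pairsIn]; tauto
  have h2 : #{e ∈ D ×ˢ D | e.1 < e.2} = #{e ∈ D ×ˢ D | e.2 < e.1} :=
    Finset.card_nbij' Prod.swap Prod.swap (by intro e; simp; tauto) (by intro e; simp; tauto)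
      (fun _ _ => Prod.swap_swap _) (fun _ _ => Prod.swap_swap _)
  have h3 := Finset.card_filter_add_card_filter_not (s := D ×ˢ D) (fun e => e.1 = e.2)
  have h4 : #{e ∈ D ×ˢ D | e.1 = e.2} = #D :=
    Finset.card_nbij' Prod.fst (fun v => (v, v)) (by intro e; simp; tauto) (fun v hv => by simpa using hv)
      (fun e he => Prod.ext rfl (Finset.mem_filter.1 he).2) (fun _ _ => rfl)
  have h5 : #{e ∈ D ×ˢ D | ¬ e.1 = e.2} = #{e ∈ D ×ˢ D | e.1 < e.2} + #{e ∈ D ×ˢ D | e.2 < e.1} := by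
    rw [← Finset.card_union_of_disjoint]
    · congr 1; ext e; simp only [Finset.mem_filter, Finset.mem_union, ← ne_eq, ne_iff_lt_or_gt]; tauto
    · rw [Finset.disjoint_filter]; intro e _ h; exact lt_asymm h
  rw [Finset.card_product] at h3
  omega

theorem card_pairsAt_pairsIn {n : ℕ} {D : Finset (Fin n)} {v : Fin n} (hv : v ∈ D) :
    #(pairsAt (pairsIn D) v) = #D - 1 := by
  rw [← Finset.card_erase_of_mem hv]
  refine Finset.card_nbij' (otherEnd v) (fun w => if v < w then (v, w) else (w, v)) ?_ ?_ ?_ ?_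
  · rintro ⟨a, b⟩ he
    simp only [pairsAt, Finset.coe_filter, mem_pairsIn, Set.mem_ofPred_eq] at he
    simp only [otherEnd, Finset.coe_erase, Set.mem_sdiff, Finset.mem_coe, Set.mem_singleton_iff]
    obtain ⟨⟨h1, h2, h3⟩, rfl | rfl⟩ := he
    · rw [if_pos rfl]; exact ⟨h3, h1.ne'⟩
    · rw [if_neg h1.ne]; exact ⟨h2, h1.ne⟩
  · intro w hw
    simp only [Finset.coe_erase, Set.mem_sdiff, Finset.mem_coe, Set.mem_singleton_iff] at hw
    simp only [pairsAt, Finset.coe_filter, mem_pairsIn, Set.mem_ofPred_eq]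
    split_ifs with h
    · exact ⟨⟨h, hv, hw.1⟩, Or.inl rfl⟩
    · exact ⟨⟨lt_of_le_of_ne (not_lt.1 h) hw.2, hw.1, hv⟩, Or.inr rfl⟩
  · rintro ⟨a, b⟩ he
    simp only [pairsAt, Finset.coe_filter, mem_pairsIn, Set.mem_ofPred_eq] at he
    simp only [otherEnd]
    obtain ⟨⟨h1, h2, h3⟩, rfl | rfl⟩ := he
    · simp [h1]
    · simp [h1.ne, lt_asymm h1]
  · intro w hw
    simp only [Finset.coe_erase, Set.mem_sdiff, Finset.mem_coe, Set.mem_singleton_iff] at hw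
    simp only [otherEnd]
    split_ifs with h h' h' <;> simp_all

theorem card_pairsAt_lt {n : ℕ} {S : Finset (Fin n × Fin n)} (hS : ∀ e ∈ S, e.1 < e.2) (v : Fin n) :
    #(pairsAt S v) < n := by
  have h1 : pairsAt S v ⊆ pairsAt (pairsIn Finset.univ) v :=
    Finset.filter_subset_filter _ fun e he => mem_pairsIn.2 ⟨hS e he, by simp, by simp⟩
  have h2 := (Finset.card_le_card h1).trans_eq (card_pairsAt_pairsIn (Finset.mem_univ v))
  rw [Finset.card_univ, Fintype.card_fin] at h2
  have := v.pos
  omega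

/-- The action of a permutation of the vertices on ordered pairs. -/
def pairMap {n : ℕ} (φ : Equiv.Perm (Fin n)) (e : Fin n × Fin n) : Fin n × Fin n :=
  if φ e.1 < φ e.2 then (φ e.1, φ e.2) else (φ e.2, φ e.1)

theorem pairMap_symm_pairMap {n : ℕ} (φ : Equiv.Perm (Fin n)) {e : Fin n × Fin n}
    (he : e.1 < e.2) : pairMap φ.symm (pairMap φ e) = e := by
  unfold pairMap
  split_ifs <;> simp_all [lt_asymm he]

theorem pairMap_lt {n : ℕ} (φ : Equiv.Perm (Fin n)) {e : Fin n × Fin n} (he : e.1 < e.2) :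
    (pairMap φ e).1 < (pairMap φ e).2 := by
  unfold pairMap
  split_ifs with h
  · exact h
  · exact lt_of_le_of_ne (not_lt.1 h) (fun h' => he.ne (φ.injective h').symm)

/-- The image of a set of ordered pairs under a permutation of the vertices. -/
def mapPairs {n : ℕ} (φ : Equiv.Perm (Fin n)) (E : Finset (Fin n × Fin n)) :
    Finset (Fin n × Fin n) :=
  E.image (pairMap φ)

theorem mapPairs_symm_mapPairs {n : ℕ} (φ : Equiv.Perm (Fin n)) {E : Finset (Fin n × Fin n)}
    (hE : ∀ e ∈ E, e.1 < e.2) : mapPairs φ.symm (mapPairs φ E) = E := by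
  rw [mapPairs, mapPairs, Finset.image_image]
  refine Finset.ext fun e => ?_
  simp only [Finset.mem_image, Function.comp]
  constructor
  · rintro ⟨f, hf, rfl⟩
    rwa [pairMap_symm_pairMap φ (hE f hf)]
  · exact fun he => ⟨e, he, pairMap_symm_pairMap φ (hE e he)⟩

theorem card_mapPairs {n : ℕ} (φ : Equiv.Perm (Fin n)) {E : Finset (Fin n × Fin n)}
    (hE : ∀ e ∈ E, e.1 < e.2) : #(mapPairs φ E) = #E :=
  le_antisymm Finset.card_image_le
    (by conv_lhs => rw [← mapPairs_symm_mapPairs φ hE]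
        exact Finset.card_image_le)

theorem mapPairs_subset_pairsIn {n : ℕ} {φ : Equiv.Perm (Fin n)} {E : Finset (Fin n × Fin n)}
    {D D' : Finset (Fin n)} (hφ : ∀ v ∈ D, φ v ∈ D') (hE : E ⊆ pairsIn D) :
    mapPairs φ E ⊆ pairsIn D' := by
  intro e he
  obtain ⟨f, hf, rfl⟩ := Finset.mem_image.1 he
  obtain ⟨h1, h2, h3⟩ := mem_pairsIn.1 (hE hf)
  refine mem_pairsIn.2 ⟨pairMap_lt φ h1, ?_⟩
  unfold pairMap
  split_ifs
  exacts [⟨hφ _ h2, hφ _ h3⟩, ⟨hφ _ h3, hφ _ h2⟩]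

theorem untouched_mapPairs {n : ℕ} (φ : Equiv.Perm (Fin n)) (E : Finset (Fin n × Fin n))
    (v : Fin n) : Untouched (mapPairs φ E) (φ v) ↔ Untouched E v := by
  simp only [Untouched, mapPairs, Finset.forall_mem_image]
  refine forall₂_congr fun e _ => ?_
  unfold pairMap
  split_ifs <;> simp [and_comm]

theorem conn_mapPairs {n : ℕ} (φ : Equiv.Perm (Fin n)) (E : Finset (Fin n × Fin n))
    (u v : Fin n) : Conn (mapPairs φ E) (φ u) (φ v) ↔ Conn E u v := by
  constructor
  · intro h
    have := h.induction_on (p := fun w => Conn E u (φ.symm w))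
      (by rw [φ.symm_apply_apply]; exact (Conn.equivalence E).refl u) ?_
    · rwa [φ.symm_apply_apply] at this
    intro a b ha hab
    refine (Conn.equivalence E).trans ha (Conn.of_mem ?_)
    simp only [mapPairs, Finset.mem_image, pairMap, Prod.exists] at hab
    rcases hab with ⟨x, y, hxy, h⟩ | ⟨x, y, hxy, h⟩ <;> split_ifs at h <;>
      obtain ⟨rfl, rfl⟩ := Prod.mk.inj h <;> simp [hxy]
  · intro h
    refine h.induction_on (p := fun w => Conn (mapPairs φ E) (φ u) (φ w))
      ((Conn.equivalence _).refl _) ?_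
    intro a b ha hab
    refine (Conn.equivalence _).trans ha (Conn.of_mem ?_)
    rcases hab with hab | hab
    all_goals
      have h2 := Finset.mem_image_of_mem (pairMap φ) hab
      unfold pairMap at h2
      split_ifs at h2
    exacts [Or.inl h2, Or.inr h2, Or.inr h2, Or.inl h2]

theorem choose_mul_pow_le {a N : ℕ} (h : a ≤ N) (d : ℕ) :
    a.choose d * N ^ d ≤ N.choose d * a ^ d := by
  have h1 : a.descFactorial d * N ^ d ≤ N.descFactorial d * a ^ d := by
    simp only [Nat.descFactorial_eq_prod_range]
    rw [← Finset.card_range d, ← Finset.prod_const, ← Finset.prod_const, Finset.card_range,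
      ← Finset.prod_mul_distrib, ← Finset.prod_mul_distrib]
    refine Finset.prod_le_prod' fun i _ => ?_
    rw [Nat.sub_mul, Nat.sub_mul, mul_comm N a]
    exact Nat.sub_le_sub_left (Nat.mul_le_mul_left i h) _
  rw [Nat.descFactorial_eq_factorial_mul_choose, Nat.descFactorial_eq_factorial_mul_choose,
    mul_assoc, mul_assoc] at h1
  exact Nat.le_of_mul_le_mul_left h1 d.factorial_pos

/-- Coupling percolation on the pairs of `D'` with percolation on the pairs of a slightly larger
set `D`, by embedding `D'` into `D` off a random set of `d` vertices that are made isolated. -/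
theorem percW_pairsIn_subC {n q : ℕ} (p : Fin n → Fin q) {D' D : Finset (Fin n)} {d : ℕ}
    (hd : #D = #D' + d) (hD : 0 < #D) {y ε α : ℝ} (hy0 : 0 ≤ y) (hy1 : y ≤ 1) (hε0 : 0 ≤ ε)
    (hε1 : ε ≤ 1) {A : Finset (Fin n × Fin n) → Prop}
    (hA : ∀ E ⊆ pairsIn D', A E → (isoCnt E D' : ℝ) + d ≤ α)
    (hα : ε * (α / #D) ^ d ≤ y ^ (d * #D)) :
    SubC (percW y (pairsIn D')) (percW y (pairsIn D)) (fun E' E => A E' ∧ E' ⊆ pairsIn D' ∧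
      ∃ φ : Equiv.Perm (Fin n), (∀ v ∈ D', φ v ∈ D) ∧
        #{v ∈ D' | p (φ v) ≠ p v} ≤ ∑ i, (#{v ∈ D' | p v = i} - (#{v ∈ D | p v = i} - d)) ∧
        E = mapPairs φ E') (ε * percProb y (pairsIn D') A) := by
  have hφ : ∀ R ∈ Finset.powersetCard d D, ∃ φ : Equiv.Perm (Fin n), (∀ v ∈ D', φ v ∈ D \ R) ∧
      #{v ∈ D' | p (φ v) ≠ p v} ≤ ∑ i, (#{v ∈ D' | p v = i} - (#{v ∈ D | p v = i} - d)) := by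
    intro R hR
    rw [Finset.mem_powersetCard] at hR
    obtain ⟨φ, h1, h2⟩ := exists_perm_mapsTo p p #D' D' (D \ R) rfl
      (by rw [Finset.card_sdiff_of_subset hR.1]; omega)
    refine ⟨φ, h1, h2.trans (Finset.sum_le_sum fun i _ => Nat.sub_le_sub_left ?_ _)⟩
    have h3 : ({v ∈ D | p v = i} : Finset (Fin n)) ⊆ {v ∈ D \ R | p v = i} ∪ R := by
      intro v hv
      rw [Finset.mem_filter] at hv
      by_cases hvR : v ∈ R
      · exact Finset.mem_union_right _ hvR
      · exact Finset.mem_union_left _ (Finset.mem_filter.2 ⟨Finset.mem_sdiff.2 ⟨hv.1, hvR⟩, hv.2⟩)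
    have h4 := (Finset.card_le_card h3).trans (Finset.card_union_le _ _)
    omega
  choose! φ hφ1 hφ2 using hφ
  set Q : Finset (Fin n) → Finset (Fin n × Fin n) → Finset (Fin n × Fin n) → Prop :=
    fun R E' E => A E' ∧ E' ⊆ pairsIn D' ∧ E = mapPairs (φ R) E' with hQ
  have hlt : ∀ {E' : Finset (Fin n × Fin n)}, E' ⊆ pairsIn D' → ∀ e ∈ E', e.1 < e.2 :=
    fun h e he => (mem_pairsIn.1 (h he)).1
  set c : ℝ := ε / (#D).choose d with hc
  have hch : (0 : ℝ) < (#D).choose d := by exact_mod_cast Nat.choose_pos (by omega)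
  have hc0 : 0 ≤ c := by positivity
  have hw := percW_nonneg hy0 hy1 (pairsIn D')
  have hrow : ∀ E', ∑ E, ∑ R ∈ Finset.powersetCard d D,
      (if Q R E' E then c * percW y (pairsIn D') E' else 0) =
      ε * if A E' then percW y (pairsIn D') E' else 0 := by
    intro E'
    rw [Finset.sum_comm]
    by_cases hAE : A E' ∧ E' ⊆ pairsIn D'
    · have : ∀ R, ∑ E, (if Q R E' E then c * percW y (pairsIn D') E' else 0)
          = c * percW y (pairsIn D') E' := by
        intro R
        simp only [hQ, hAE.1, hAE.2, true_and]
        rw [Finset.sum_ite_eq' Finset.univ, if_pos (Finset.mem_univ _)]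
      rw [Finset.sum_congr rfl fun R _ => this R, Finset.sum_const, Finset.card_powersetCard,
        nsmul_eq_mul, if_pos hAE.1, hc]
      field_simp
    · have h0 : ∀ R E, ¬ Q R E' E := fun R E h => hAE ⟨h.1, h.2.1⟩
      simp only [h0, if_false, Finset.sum_const_zero]
      by_cases hA' : A E'
      · rw [if_pos hA', percW, if_neg fun h => hAE ⟨hA', h⟩, mul_zero]
      · rw [if_neg hA', mul_zero]
  refine ⟨fun E' E => ∑ R ∈ Finset.powersetCard d D,
    if Q R E' E then c * percW y (pairsIn D') E' else 0, fun E' E => ?_, fun E' => ?_, fun E => ?_,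
    fun E' E hne => ?_, ?_⟩
  · exact Finset.sum_nonneg fun R _ => by
      split_ifs
      exacts [mul_nonneg hc0 (hw _), le_rfl]
  · rw [hrow]
    split_ifs
    · exact mul_le_of_le_one_left (hw _) hε1
    · rw [mul_zero]; exact hw _
  · rw [Finset.sum_comm]
    by_cases hex : ∃ R ∈ Finset.powersetCard d D, ∃ E', Q R E' E
    · obtain ⟨R₀, hR₀, E₀, hA₀, hE₀, rfl⟩ := hex
      set E := mapPairs (φ R₀) E₀ with hE
      have hsub : ∀ R ∈ Finset.powersetCard d D, ∀ E', Q R E' E → E ⊆ pairsIn (D \ R) := by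
        rintro R hR E' ⟨-, h2, h3⟩
        rw [h3]
        exact mapPairs_subset_pairsIn (hφ1 R hR) h2
      have hcard : #E = #E₀ := card_mapPairs _ (hlt hE₀)
      set Is : Finset (Fin n) := {v ∈ D | Untouched E v} with hIs
      have hIsa : #Is ≤ isoCnt E₀ D' + d := by
        have him : D'.image (φ R₀) = D \ R₀ := by
          refine Finset.eq_of_subset_of_card_le (Finset.image_subset_iff.2 (hφ1 R₀ hR₀)) ?_
          rw [Finset.card_image_of_injective _ (φ R₀).injective]
          rw [Finset.mem_powersetCard] at hR₀
          rw [Finset.card_sdiff_of_subset hR₀.1]; omega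
        have : Is ⊆ ({v ∈ D' | Untouched E₀ v} : Finset (Fin n)).image (φ R₀) ∪ R₀ := by
          intro v hv
          rw [hIs, Finset.mem_filter] at hv
          by_cases hvR : v ∈ R₀
          · exact Finset.mem_union_right _ hvR
          have : v ∈ D'.image (φ R₀) := him ▸ Finset.mem_sdiff.2 ⟨hv.1, hvR⟩
          obtain ⟨u, hu, rfl⟩ := Finset.mem_image.1 this
          refine Finset.mem_union_left _ (Finset.mem_image_of_mem _ ?_)
          exact Finset.mem_filter.2 ⟨hu, (untouched_mapPairs _ _ _).1 hv.2⟩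
        refine (Finset.card_le_card this).trans ((Finset.card_union_le _ _).trans ?_)
        rw [(Finset.mem_powersetCard.1 hR₀).2]
        exact Nat.add_le_add_right Finset.card_image_le _
      set w₀ : ℝ := (1 - y) ^ #E * y ^ (#(pairsIn D') - #E) with hw₀
      have hw₀0 : 0 ≤ w₀ := mul_nonneg (pow_nonneg (by linarith) _) (pow_nonneg hy0 _)
      have hinner : ∀ R ∈ Finset.powersetCard d D,
          ∑ E', (if Q R E' E then c * percW y (pairsIn D') E' else 0) ≤
            if R ⊆ Is then c * w₀ else 0 := by
        intro R hR
        have hle : ∀ E', (if Q R E' E then c * percW y (pairsIn D') E' else 0) ≤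
            if E' = mapPairs (φ R).symm E then (if R ⊆ Is then c * w₀ else 0) else 0 := by
          intro E'
          by_cases hq' : Q R E' E
          · have h1 : E' = mapPairs (φ R).symm E := by
              rw [hq'.2.2, mapPairs_symm_mapPairs _ (hlt hq'.2.1)]
            have h2 : R ⊆ Is := by
              intro v hv
              refine Finset.mem_filter.2 ⟨(Finset.mem_powersetCard.1 hR).1 hv, fun e he => ?_⟩
              have := mem_pairsIn.1 (hsub R hR E' hq' he)
              rw [Finset.mem_sdiff, Finset.mem_sdiff] at this
              exact ⟨fun h => this.2.1.2 (h ▸ hv), fun h => this.2.2.2 (h ▸ hv)⟩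
            have h3 : #E' = #E := by rw [hq'.2.2, card_mapPairs _ (hlt hq'.2.1)]
            rw [if_pos hq', if_pos h1, if_pos h2, percW, if_pos hq'.2.1, h3]
          · rw [if_neg hq']
            split_ifs <;> first | exact mul_nonneg hc0 hw₀0 | exact le_rfl
        refine (Finset.sum_le_sum fun E' _ => hle E').trans_eq ?_
        rw [Finset.sum_ite_eq' Finset.univ, if_pos (Finset.mem_univ _)]
      refine (Finset.sum_le_sum hinner).trans ?_
      rw [← Finset.sum_filter, Finset.sum_const, nsmul_eq_mul]
      have hcount : #{R ∈ Finset.powersetCard d D | R ⊆ Is} ≤ (#Is).choose d := by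
        rw [← Finset.card_powersetCard]
        refine Finset.card_le_card fun R hR => ?_
        rw [Finset.mem_filter, Finset.mem_powersetCard] at hR
        exact Finset.mem_powersetCard.2 ⟨hR.2, hR.1.2⟩
      have hED : E ⊆ pairsIn D := (hsub R₀ hR₀ E₀ ⟨hA₀, hE₀, rfl⟩).trans
        (pairsIn_mono Finset.sdiff_subset)
      have hEle : #E ≤ #(pairsIn D') := hcard.trans_le (Finset.card_le_card hE₀)
      have hpc : #(pairsIn D) ≤ #(pairsIn D') + d * #D := by
        have h1 := two_mul_card_pairsIn D
        have h2 := two_mul_card_pairsIn D'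
        have h3 : #D * #D = #D' * #D' + 2 * (d * #D) - d * d := by
          rw [hd]; refine (Nat.sub_eq_of_eq_add ?_).symm; ring
        omega
      have hDr : (0 : ℝ) < #D := by exact_mod_cast hD
      have hIsα : (#Is : ℝ) ≤ α := by
        refine le_trans ?_ (hA E₀ hE₀ hA₀); exact_mod_cast hIsa
      have hratio : ((#Is).choose d : ℝ) ≤ (#D).choose d * (α / #D) ^ d := by
        have h1 : ((#Is).choose d : ℝ) * (#D : ℝ) ^ d ≤ (#D).choose d * (#Is : ℝ) ^ d := by
          exact_mod_cast choose_mul_pow_le (Finset.card_le_card (Finset.filter_subset _ _)) d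
        rw [div_pow, ← mul_div_assoc, le_div_iff₀ (by positivity)]
        refine h1.trans ?_
        gcongr
      rw [percW, if_pos hED]
      calc (#{R ∈ Finset.powersetCard d D | R ⊆ Is} : ℝ) * (c * w₀)
          ≤ ((#D).choose d * (α / #D) ^ d) * (c * w₀) := by
            have := mul_nonneg hc0 hw₀0
            gcongr
            exact le_trans (by exact_mod_cast hcount) hratio
        _ = (ε * (α / #D) ^ d) * w₀ := by rw [hc]; field_simp
        _ ≤ y ^ (d * #D) * w₀ := by gcongr
        _ = (1 - y) ^ #E * y ^ (#(pairsIn D') - #E + d * #D) := by rw [hw₀, pow_add]; ring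
        _ ≤ (1 - y) ^ #E * y ^ (#(pairsIn D) - #E) := by
            have : 0 ≤ (1 - y) ^ #E := pow_nonneg (by linarith) _
            gcongr ?_ * ?_
            exact pow_le_pow_of_le_one hy0 hy1 (by omega)
    · push Not at hex
      rw [Finset.sum_eq_zero]
      · exact percW_nonneg hy0 hy1 _ _
      · intro R hR
        exact Finset.sum_eq_zero fun E' _ => if_neg (hex R hR E')
  · refine Finset.sum_eq_zero fun R hR => if_neg ?_
    rintro ⟨h1, h2, h3⟩
    exact hne ⟨h1, h2, φ R, fun v hv => (Finset.mem_sdiff.1 (hφ1 R hR v hv)).1, hφ2 R hR, h3⟩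
  · rw [Finset.sum_congr rfl fun E' _ => hrow E', ← Finset.mul_sum, sum_ite_percW]

theorem exp_le_one_add_two_mul {x : ℝ} (h0 : 0 ≤ x) (h1 : x ≤ 1 / 2) :
    Real.exp x ≤ 1 + 2 * x := by
  have h2 := Real.one_sub_le_exp_neg x
  have h3 : Real.exp x * Real.exp (-x) = 1 := by rw [← Real.exp_add]; simp
  have h4 : Real.exp x * (1 - x) ≤ 1 :=
    (mul_le_mul_of_nonneg_left h2 (Real.exp_pos x).le).trans_eq h3
  have h5 : Real.exp x * (1 - x) ≤ (1 + 2 * x) * (1 - x) := by nlinarith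
  exact le_of_mul_le_mul_right h5 (by linarith)

/-- The numerical estimate behind the coupling of the giant components of two classes whose sizes
differ by `d = O(√n)`. -/
theorem exists_giant_const {β c K C : ℝ} (hβ : 0 < β) (hc : 0 < c) (hK : 0 ≤ K) (hC : 0 ≤ C) :
    ∃ ε : ℝ, 0 < ε ∧ ε ≤ 1 ∧ ∃ n₀ : ℕ, ∀ n : ℕ, n₀ ≤ n → ∀ N' N d : ℕ, N = N' + d → N ≤ n →
      c * n ≤ N → (d : ℝ) ≤ K * √n →
      ε * (((N' : ℝ) * Real.exp (-(β / n)) ^ (N' - 1) + C * √n + d) / N) ^ d ≤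
        Real.exp (-(β / n)) ^ (d * N) := by
  set C₃ : ℝ := 2 * (β * (K + 1)) + (C + K) * Real.exp β / c with hC₃
  have hC₃0 : 0 ≤ C₃ := by positivity
  refine ⟨Real.exp (-(C₃ * K)), Real.exp_pos _, Real.exp_le_one_iff.2 (by nlinarith [mul_nonneg hC₃0 hK]),
    ⌈(2 * (β * (K + 1))) ^ 2⌉₊ + 1, fun n hn N' N d hN hNn hcN hd => ?_⟩
  have hn1 : (1 : ℝ) ≤ n := by exact_mod_cast (by omega : 1 ≤ n)
  have hn0 : (0 : ℝ) < n := by linarith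
  set s := √(n : ℝ) with hs
  have hs1 : 1 ≤ s := Real.one_le_sqrt.2 hn1
  have hs0 : 0 < s := by linarith
  have hss : s * s = n := Real.mul_self_sqrt hn0.le
  have hs2 : 2 * (β * (K + 1)) ≤ s := by
    refine Real.le_sqrt_of_sq_le ?_
    calc _ ≤ ((⌈(2 * (β * (K + 1))) ^ 2⌉₊ : ℕ) : ℝ) := Nat.le_ceil _
      _ ≤ n := by exact_mod_cast (by omega)
  set y := Real.exp (-(β / n)) with hy
  have hypow : ∀ k : ℕ, y ^ k = Real.exp (-(β * k / n)) := by
    intro k; rw [hy, ← Real.exp_nat_mul]; congr 1; ring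
  have hN0 : (0 : ℝ) < N := lt_of_lt_of_le (by positivity) hcN
  have hNr : (N : ℝ) = N' + d := by exact_mod_cast hN
  set x := β * (d + 1) / n with hx
  have hx0 : 0 ≤ x := by positivity
  have hxs : x ≤ β * (K + 1) / s := by
    rw [hx, div_le_div_iff₀ hn0 hs0, ← hss]
    have : (d : ℝ) + 1 ≤ (K + 1) * s := by linarith
    calc β * (d + 1) * s ≤ β * ((K + 1) * s) * s := by gcongr
      _ = _ := by ring
  have hx2 : x ≤ 1 / 2 := hxs.trans (by rw [div_le_iff₀ hs0]; linarith)
  have h1 : (N' : ℝ) * y ^ (N' - 1) ≤ N * y ^ N * (1 + 2 * (β * (K + 1)) / s) := by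
    rcases Nat.eq_zero_or_pos N' with h0 | h0
    · rw [h0]; simp only [Nat.cast_zero, zero_mul]; positivity
    · have hsplit : y ^ (N' - 1) = y ^ N * Real.exp x := by
        rw [hypow, hypow, ← Real.exp_add, hx]
        congr 1
        rw [Nat.cast_sub h0, hNr]
        push_cast
        ring
      rw [hsplit, mul_assoc (N : ℝ)]
      have h2 := exp_le_one_add_two_mul hx0 hx2
      have h3 : 1 + 2 * x ≤ 1 + 2 * (β * (K + 1)) / s := by
        rw [mul_div_assoc]; linarith
      have h4 : (N' : ℝ) ≤ N := by rw [hNr]; linarith [(Nat.cast_nonneg d : (0 : ℝ) ≤ d)]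
      have h5 := h2.trans h3
      gcongr
  have h2 : C * s + d ≤ N * y ^ N * ((C + K) * Real.exp β / c / s) := by
    have hyN : Real.exp (-β) ≤ y ^ N := by
      rw [hypow]
      refine Real.exp_le_exp.2 (neg_le_neg ?_)
      rw [div_le_iff₀ hn0]
      have : (N : ℝ) ≤ n := by exact_mod_cast hNn
      gcongr
    calc C * s + d ≤ (C + K) * s := by linarith
      _ = c * n * Real.exp (-β) * ((C + K) * Real.exp β / c / s) := by
          rw [Real.exp_neg, ← hss]; field_simp
      _ ≤ _ := by gcongr
  have h3 : ((N' : ℝ) * y ^ (N' - 1) + C * s + d) / N ≤ y ^ N * (1 + C₃ / s) := by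
    rw [div_le_iff₀ hN0, hC₃, add_div]
    linarith
  have h4 : (1 + C₃ / s) ^ d ≤ Real.exp (C₃ * K) := by
    have : 1 + C₃ / s ≤ Real.exp (C₃ / s) := by linarith [Real.add_one_le_exp (C₃ / s)]
    calc (1 + C₃ / s) ^ d ≤ Real.exp (C₃ / s) ^ d := by gcongr
      _ = Real.exp (d * (C₃ / s)) := (Real.exp_nat_mul _ _).symm
      _ ≤ Real.exp (K * s * (C₃ / s)) := by gcongr
      _ = _ := by congr 1; field_simp
  calc Real.exp (-(C₃ * K)) * (((N' : ℝ) * y ^ (N' - 1) + C * s + d) / N) ^ d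
      ≤ Real.exp (-(C₃ * K)) * (y ^ N * (1 + C₃ / s)) ^ d := by gcongr
    _ = Real.exp (-(C₃ * K)) * (1 + C₃ / s) ^ d * (y ^ N) ^ d := by rw [mul_pow]; ring
    _ ≤ Real.exp (-(C₃ * K)) * Real.exp (C₃ * K) * (y ^ N) ^ d := by gcongr
    _ = y ^ (d * N) := by rw [← Real.exp_add, ← pow_mul, mul_comm N]; simp

/-- A positive root of `exp (-λ x) = 1 - x` is unique. -/
theorem exp_neg_mul_root_unique {lam x y : ℝ} (hx : 0 < x) (hxy : x < y)
    (h1 : Real.exp (-lam * x) = 1 - x) (h2 : Real.exp (-lam * y) = 1 - y) : False := by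
  have hlam : lam ≠ 0 := by
    rintro rfl
    simp only [neg_zero, zero_mul, Real.exp_zero] at h1
    linarith
  have hy : 0 < y := hx.trans hxy
  have hne : (0 : ℝ) ≠ -lam * y := by
    intro h
    exact (mul_ne_zero (neg_ne_zero.2 hlam) hy.ne') h.symm
  have h3 := strictConvexOn_exp.2 (Set.mem_univ 0) (Set.mem_univ (-lam * y)) hne
    (show 0 < 1 - x / y by rw [sub_pos, div_lt_one hy]; exact hxy) (div_pos hx hy) (by ring)
  have h4 : (1 - x / y) • (0 : ℝ) + (x / y) • (-lam * y) = -lam * x := by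
    simp only [smul_eq_mul]; field_simp; ring
  rw [h4, h1, h2] at h3
  simp only [smul_eq_mul, Real.exp_zero] at h3
  have h5 : (1 - x / y) * 1 + x / y * (1 - y) = 1 - x := by field_simp; ring
  linarith

theorem theta_eq {lam x : ℝ} (hlam : 1 < lam) (hx : x ∈ Set.Ioo (0 : ℝ) 1)
    (h : Real.exp (-lam * x) = 1 - x) : theta lam = x := by
  have : {x : ℝ | x ∈ Set.Ioo (0 : ℝ) 1 ∧ Real.exp (-lam * x) = 1 - x} = {x} := by
    ext z
    simp only [Set.mem_ofPred_eq, Set.mem_singleton_iff]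
    constructor
    · rintro ⟨hz, hz'⟩
      rcases lt_trichotomy z x with h1 | h1 | h1
      · exact (exp_neg_mul_root_unique hz.1 h1 hz' h).elim
      · exact h1
      · exact (exp_neg_mul_root_unique hx.1 h1 h hz').elim
    · rintro rfl; exact ⟨hx, h⟩
  rw [theta, if_neg (not_le.2 hlam), this, csSup_singleton]

/-- Away from the dominant class the percolation at the fixed point of `F` is subcritical. -/
theorem mul_one_sub_aFix_lt {q : ℕ} (hq : 2 ≤ q) {β : ℝ} (hβ : (q : ℝ) < β) :
    β * ((1 - aFix q β) / ((q : ℝ) - 1)) < 1 := by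
  have hq2 : (2 : ℝ) ≤ q := by exact_mod_cast hq
  have hq0 : (0 : ℝ) < q := by linarith
  have hβ0 : 0 < β := by linarith
  set G : ℝ → ℝ := fun u => u * (1 + (q - 1) * Real.exp (-u)) - β * (1 - Real.exp (-u)) with hG
  set u₀ : ℝ := (β - q) / (2 * q) with hu₀
  have hu₀0 : 0 < u₀ := div_pos (by linarith) (by linarith)
  have hG0 : G u₀ ≤ 0 := by
    have h1 : Real.exp (-u₀) ≤ 1 := Real.exp_le_one_iff.2 (by linarith)
    have h2 : Real.exp (-u₀) ≤ (1 + u₀)⁻¹ := by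
      rw [Real.exp_neg]
      exact inv_anti₀ (by linarith) (by linarith [Real.add_one_le_exp u₀])
    have h3 : u₀ * q - β * (1 - (1 + u₀)⁻¹) ≤ 0 := by
      have : u₀ * q - β * (1 - (1 + u₀)⁻¹) = u₀ * (1 + u₀)⁻¹ * (q * (1 + u₀) - β) := by
        field_simp; ring
      rw [this]
      refine mul_nonpos_of_nonneg_of_nonpos (by positivity) ?_
      have : q * (1 + u₀) = q + (β - q) / 2 := by rw [hu₀]; field_simp
      linarith
    have h4 : u₀ * (1 + (q - 1) * Real.exp (-u₀)) ≤ u₀ * q := by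
      refine mul_le_mul_of_nonneg_left ?_ hu₀0.le
      nlinarith
    have h5 : β * (1 - (1 + u₀)⁻¹) ≤ β * (1 - Real.exp (-u₀)) := by gcongr
    simp only [hG]; linarith
  have hGβ : 0 ≤ G β := by
    have : G β = β * q * Real.exp (-β) := by simp only [hG]; ring
    rw [this]; positivity
  have hu₀β : u₀ ≤ β := by
    rw [hu₀, div_le_iff₀ (by positivity)]; nlinarith
  have hcont : ContinuousOn G (Set.Icc u₀ β) := by
    refine Continuous.continuousOn ?_
    simp only [hG]; fun_prop
  obtain ⟨u, hu, hGu⟩ := intermediate_value_Icc hu₀β hcont ⟨hG0, hGβ⟩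
  have hu0 : 0 < u := hu₀0.trans_le hu.1
  set θ : ℝ := 1 - Real.exp (-u) with hθ
  have hexp : Real.exp (-u) = 1 - θ := by rw [hθ]; ring
  have hθ1 : θ < 1 := by rw [hθ]; linarith [Real.exp_pos (-u)]
  have hθ0 : 0 < θ := by
    rw [hθ, sub_pos, Real.exp_lt_one_iff]; linarith
  have hθu : θ < u := by
    have := Real.add_one_lt_exp (x := -u) (by linarith); rw [hθ]; linarith
  have hden : 1 ≤ (q : ℝ) - (q - 1) * θ := by nlinarith
  set x : ℝ := u / θ / β with hx
  have hβx : β * x = u / θ := by rw [hx]; field_simp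
  have hth : theta (β * x) = θ := by
    rw [hβx]
    refine theta_eq (by rwa [lt_div_iff₀ hθ0, one_mul]) ⟨hθ0, hθ1⟩ ?_
    rw [← hexp]; congr 1; field_simp
  have hxq : x * (q - (q - 1) * θ) = 1 := by
    simp only [hG, hexp] at hGu
    have : u * (q - (q - 1) * θ) = β * θ := by linear_combination hGu
    rw [hx, div_mul_eq_mul_div, div_mul_eq_mul_div, this]; field_simp
  have hx0 : 0 < x := by positivity
  have hmem : x ∈ {x : ℝ | x ∈ Set.Ioc (1 / (q : ℝ)) 1 ∧ F q β x = x} := by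
    refine ⟨⟨?_, ?_⟩, ?_⟩
    · rw [div_lt_iff₀ hq0]
      have : 0 < x * ((q - 1) * θ) := by
        have : (0 : ℝ) < q - 1 := by linarith
        positivity
      nlinarith
    · nlinarith
    · rw [F, hth]; field_simp; linear_combination -hxq
  have hle : x ≤ aFix q β := le_csSup ⟨1, fun z hz => hz.1.2⟩ hmem
  have hlt : β * ((1 - x) / ((q : ℝ) - 1)) < 1 := by
    have h1 : (1 - x) / ((q : ℝ) - 1) = x * (1 - θ) := by
      rw [div_eq_iff (by linarith)]; linear_combination -hxq
    rw [h1, ← mul_assoc, hβx, div_mul_eq_mul_div, div_lt_one hθ0, ← hexp, Real.exp_neg]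
    have h2 := Real.add_one_lt_exp hu0.ne'
    have h3 : θ = 1 - (Real.exp u)⁻¹ := by rw [hθ, Real.exp_neg]
    rw [h3, ← div_eq_mul_inv, div_lt_iff₀ (Real.exp_pos u), sub_mul,
      inv_mul_cancel₀ (Real.exp_pos u).ne']
    linarith
  refine lt_of_le_of_lt ?_ hlt
  have : (0 : ℝ) < q - 1 := by linarith
  gcongr

theorem exists_eq_domIdx {n q : ℕ} (hq : 1 ≤ q) (X : Conf n q) :
    ∃ k : Fin q, (∀ v, (X v : ℕ) = domIdx X ↔ X v = k) ∧ ∀ j, cntN X j ≤ cntN X k := by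
  have : Nonempty (Fin q) := ⟨⟨0, hq⟩⟩
  obtain ⟨k₀, hk₀⟩ := Finite.exists_max (cntN X)
  obtain ⟨hk, hmax⟩ := Nat.sInf_mem
    (s := {j : ℕ | ∃ hj : j < q, ∀ j' : Fin q, cntN X j' ≤ cntN X ⟨j, hj⟩}) ⟨k₀, k₀.2, hk₀⟩
  exact ⟨⟨_, hk⟩, fun v => by rw [Fin.ext_iff]; rfl, hmax⟩

theorem card_le_mul_cntN {n q : ℕ} {X : Conf n q} {k : Fin q} (hk : ∀ j, cntN X j ≤ cntN X k) :
    n ≤ q * cntN X k := by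
  have h : ∑ j, cntN X j = n := by
    have := Finset.card_eq_sum_card_fiberwise (s := Finset.univ) (t := Finset.univ) (f := X)
      (fun _ _ => Finset.mem_univ _)
    rw [Finset.card_univ, Fintype.card_fin] at this
    exact this.symm
  calc n = ∑ j, cntN X j := h.symm
    _ ≤ ∑ j : Fin q, cntN X k := Finset.sum_le_sum fun j _ => hk j
    _ = _ := by simp

theorem cntFrac_le_of_linf_le {n q : ℕ} {X : Conf n q} {β δ : ℝ}
    (h : linf (alphaVec X) (mVec q β) ≤ δ) {k : Fin q} (hk : ∀ j, cntN X j ≤ cntN X k)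
    {j : Fin q} (hj : j ≠ k) : cntFrac X j ≤ (1 - aFix q β) / ((q : ℝ) - 1) + δ := by
  have hcomp : ∀ i, |alphaVec X i - mVec q β i| ≤ δ := fun i =>
    (le_ciSup (f := fun i => |alphaVec X i - mVec q β i|) (Set.finite_range _).bddAbove i).trans h
  have key : ∀ l : Fin q, ((Tuple.sort (cntFrac X)).symm l).rev.val ≠ 0 →
      cntFrac X l ≤ (1 - aFix q β) / ((q : ℝ) - 1) + δ := by
    intro l hl
    have h1 := hcomp ((Tuple.sort (cntFrac X)).symm l).rev
    rw [alphaVec, Fin.rev_rev, Equiv.apply_symm_apply, mVec, kappaVec, if_neg hl, abs_le] at h1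
    linarith [h1.2]
  by_cases h0 : ((Tuple.sort (cntFrac X)).symm j).rev.val = 0
  · have h1 : cntFrac X j ≤ cntFrac X k := by
      unfold cntFrac
      have : (cntN X j : ℝ) ≤ cntN X k := by exact_mod_cast hk j
      gcongr
    refine h1.trans (key k fun h2 => hj ?_)
    have h3 := Fin.ext (h0.trans h2.symm)
    exact (Tuple.sort (cntFrac X)).symm.injective (Fin.rev_injective h3)
  · exact key j h0

theorem minRep_congr {n : ℕ} {R R' : Fin n → Fin n → Prop} {v : Fin n}
    (h : ∀ u, R u v ↔ R' u v) : minRep R v = minRep R' v := by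
  simp only [minRep, h]

theorem colorLaw_conj {n q : ℕ} (φ : Equiv.Perm (Fin n)) (h : Fin n → Fin n) (τ : Conf n q) :
    colorLaw (fun v => φ (h (φ.symm v))) τ = colorLaw h (fun v => τ (φ v)) := by
  refine Fintype.sum_equiv (Equiv.arrowCongr φ.symm (Equiv.refl _)) _ _ fun c => ?_
  congr 1
  refine if_congr ?_ rfl rfl
  constructor
  · intro hc
    funext v
    rw [← hc]
    simp
  · intro hc
    funext v
    have := congrFun hc (φ.symm v)
    simpa using this

theorem card_filter_perm {n : ℕ} (φ : Equiv.Perm (Fin n)) (A : Fin n → Prop)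
    [DecidablePred A] [DecidablePred fun v => A (φ v)] : #{v | A (φ v)} = #{v | A v} := by
  refine Finset.card_nbij' φ φ.symm ?_ ?_ ?_ ?_
  · intro v hv
    exact Finset.mem_coe.2 (Finset.mem_filter.2 ⟨Finset.mem_univ _, (Finset.mem_filter.1 hv).2⟩)
  · intro v hv
    refine Finset.mem_coe.2 (Finset.mem_filter.2 ⟨Finset.mem_univ _, ?_⟩)
    rw [φ.apply_symm_apply]
    exact (Finset.mem_filter.1 hv).2
  · exact fun v _ => φ.symm_apply_apply v
  · exact fun v _ => φ.apply_symm_apply v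

theorem exists_subset_card_fiber {n q k : ℕ} (t : Fin n → Fin q) (A : Fin n → Prop)
    (h : ∀ i, k ≤ #{v | t v = i ∧ A v}) :
    ∃ J : Finset (Fin n), (∀ v ∈ J, A v) ∧ ∀ i, #{v ∈ J | t v = i} = k := by
  choose B hB hBk using fun i => Finset.exists_subset_card_eq (h i)
  refine ⟨Finset.univ.biUnion B, fun v hv => ?_, fun i => ?_⟩
  · obtain ⟨i, -, hi⟩ := Finset.mem_biUnion.1 hv
    exact (Finset.mem_filter.1 (hB i hi)).2.2
  · rw [← hBk i]
    congr 1
    ext v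
    rw [Finset.mem_filter, Finset.mem_biUnion]
    constructor
    · rintro ⟨⟨j, -, hj⟩, rfl⟩
      rwa [(Finset.mem_filter.1 (hB j hj)).2.1]
    · exact fun hv => ⟨⟨i, Finset.mem_univ i, hv⟩, (Finset.mem_filter.1 (hB i hv)).2.1⟩

/-- Percolation on the pairs of `D` does not interact with edges outside `D`. -/
theorem conn_union_of_not_untouched {n : ℕ} {E₁ E₂ : Finset (Fin n × Fin n)} {D : Finset (Fin n)}
    (h1 : E₁ ⊆ pairsIn D) (h2 : ∀ e ∈ E₂, e.1 ∉ D ∧ e.2 ∉ D) {v u : Fin n}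
    (hv : ¬ Untouched E₁ v) (h : Conn (E₁ ∪ E₂) v u) : Conn E₁ v u ∧ ¬ Untouched E₁ u := by
  have hT : ∀ w, ¬ Untouched E₁ w → w ∈ D := by
    intro w hw
    by_contra hD
    refine hw fun e he => ?_
    have := mem_pairsIn.1 (h1 he)
    exact ⟨fun h => hD (h ▸ this.2.1), fun h => hD (h ▸ this.2.2)⟩
  have := Conn.of_closed (W := {w | ¬ Untouched E₁ w}) (E := E₁) (G := E₁ ∪ E₂) ?_
    (Finset.mem_filter.2 ⟨Finset.mem_univ v, hv⟩) h
  · exact ⟨this.1, (Finset.mem_filter.1 this.2).2⟩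
  · intro e he hor
    simp only [Finset.mem_filter, Finset.mem_univ, true_and] at hor ⊢
    rcases Finset.mem_union.1 he with he | he
    · exact ⟨he, fun h => (h e he).1 rfl, fun h => (h e he).2 rfl⟩
    · exact absurd hor (not_or.2 ⟨fun h => (h2 e he).1 (hT _ h), fun h => (h2 e he).2 (hT _ h)⟩)

theorem conn_union_of_untouched {n : ℕ} {E₁ E₂ : Finset (Fin n × Fin n)} {v u : Fin n}
    (hv : Untouched E₁ v) (h2 : ∀ e ∈ E₂, Untouched E₁ e.1 ∧ Untouched E₁ e.2)
    (h : Conn (E₁ ∪ E₂) v u) : Conn E₂ v u ∧ Untouched E₁ u := by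
  have := Conn.of_closed (W := {w | Untouched E₁ w}) (E := E₂) (G := E₁ ∪ E₂) ?_
    (Finset.mem_filter.2 ⟨Finset.mem_univ v, hv⟩) h
  · exact ⟨this.1, (Finset.mem_filter.1 this.2).2⟩
  · intro e he hor
    simp only [Finset.mem_filter, Finset.mem_univ, true_and] at hor ⊢
    rcases Finset.mem_union.1 he with he | he
    · exact absurd hor (not_or.2 ⟨fun h => (h e he).1 rfl, fun h => (h e he).2 rfl⟩)
    · exact ⟨he, h2 e he⟩

theorem untouched_of_notMem {n : ℕ} {E : Finset (Fin n × Fin n)} {D : Finset (Fin n)}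
    (h : E ⊆ pairsIn D) {v : Fin n} (hv : v ∉ D) : Untouched E v := fun _ he =>
  have := mem_pairsIn.1 (h he)
  ⟨fun h => hv (h ▸ this.2.1), fun h => hv (h ▸ this.2.2)⟩

/-- Coupling the colouring steps when the percolation on the dominant class is shared. -/
theorem exists_conn_colorLaw_subC {q : ℕ} (hq : 1 ≤ q) {c K : ℝ} (hc : 0 < c) (hK : 0 ≤ K) :
    ∃ ρ : ℝ, 0 < ρ ∧ ∃ N : ℕ, ∀ n : ℕ, N ≤ n → ∀ (p : Fin n → Fin q) (D' D : Finset (Fin n))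
      (E₁ E₂ E₂' : Finset (Fin n × Fin n)) (φ : Equiv.Perm (Fin n)) (m : ℕ),
      E₁ ⊆ pairsIn D' → (∀ v ∈ D', φ v ∈ D) →
      (∀ e ∈ E₂, e.1 ∉ D' ∧ e.2 ∉ D') → (∀ e ∈ E₂', e.1 ∉ D ∧ e.2 ∉ D) →
      c * n ≤ m → (∀ i, q * m ≤ #{v | p v = i ∧ Untouched (E₁ ∪ E₂) v}) →
      (∀ i, q * m ≤ #{v | p v = i ∧ Untouched (mapPairs φ E₁ ∪ E₂') v}) →
      (#{v ∈ D' | p (φ v) ≠ p v} : ℝ) ≤ K * √n →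
      (#{z : Fin n × Fin n | Conn E₂ z.1 z.2} : ℝ) ≤ K * n →
      (#{z : Fin n × Fin n | Conn E₂' z.1 z.2} : ℝ) ≤ K * n →
      SubC (colorLaw (q := q) (minRep (Conn (E₁ ∪ E₂))))
        (colorLaw (q := q) (minRep (Conn (mapPairs φ E₁ ∪ E₂')))) (fun τ τ' => ∀ i j,
        #{v | p v = i ∧ τ v = j} = #{v | p v = i ∧ τ' v = j}) ρ := by
  obtain ⟨ρ, hρ, N, hN⟩ := exists_colorLaw_subC hq hc hK
  refine ⟨ρ, hρ, N, fun n hn p D' D E₁ E₂ E₂' φ m hE₁ hφ hE₂ hE₂' hm hU hU' hp hc₂ hc₂' => ?_⟩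
  have hF₁ := mapPairs_subset_pairsIn hφ hE₁
  set F₁ := mapPairs φ E₁ with hF
  set G := E₁ ∪ E₂ with hG
  set G' := F₁ ∪ E₂' with hG'
  have hR := Conn.equivalence G
  set R' : Fin n → Fin n → Prop := fun u v => Conn G' (φ u) (φ v) with hR'def
  have hR' : Equivalence R' := ⟨fun v => (Conn.equivalence G').refl _,
    fun h => (Conn.equivalence G').symm h, fun h h' => (Conn.equivalence G').trans h h'⟩
  set h := minRep (Conn G) with hh
  set h' := minRep R' with hh'
  have hhv : ∀ v, Conn G (h v) v := rel_minRep hR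
  have hhv' : ∀ v, Conn G' (φ (h' v)) (φ v) := rel_minRep hR'
  have hT : ∀ v u, ¬ Untouched E₁ v → Conn G v u → Conn E₁ v u ∧ ¬ Untouched E₁ u :=
    fun v u hv => conn_union_of_not_untouched hE₁ hE₂ hv
  have hT' : ∀ v u, ¬ Untouched E₁ v → R' v u → Conn E₁ v u ∧ ¬ Untouched E₁ u := by
    intro v u hv hvu
    have := conn_union_of_not_untouched hF₁ hE₂' (by rwa [hF, untouched_mapPairs]) hvu
    rwa [hF, conn_mapPairs, untouched_mapPairs] at this
  set T : Finset (Fin n) := {v | ¬ Untouched E₁ v} with hTdef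
  have hmemT : ∀ v, v ∈ T ↔ ¬ Untouched E₁ v := fun v => by simp [hTdef]
  have hTD : T ⊆ D' := by
    intro v hv
    by_contra hD
    exact (hmemT v).1 hv (untouched_of_notMem hE₁ hD)
  obtain ⟨J, hJU, hJc⟩ := exists_subset_card_fiber p (Untouched G) hU
  obtain ⟨J', hJU', hJc'⟩ := exists_subset_card_fiber (k := q * m) (fun v => p (φ v))
    (fun v => Untouched G' (φ v)) (fun i => (hU' i).trans_eq
      (card_filter_perm φ fun v => p v = i ∧ Untouched G' v).symm)
  have hfix : ∀ v, Untouched G v → h v = v := fun v hv => hv.eq_of_conn (hR.symm (hhv v))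
  have hfix' : ∀ v, Untouched G' (φ v) → h' v = v := fun v hv =>
    φ.injective (hv.eq_of_conn ((Conn.equivalence G').symm (hhv' v)))
  have hback : ∀ v, Untouched G (h v) → h v = v := fun v hv => (hv.eq_of_conn (hhv v)).symm
  have hback' : ∀ v, Untouched G' (φ (h' v)) → h' v = v := fun v hv =>
    (φ.injective (hv.eq_of_conn (hhv' v))).symm
  have key := hN n hn h h' p (fun v => p (φ v)) T J J' m ?_ ?_ ?_ ?_ ?_
    (fun v hv => hfix v (hJU v hv)) (fun v hv => hfix' v (hJU' v hv))
    (fun v hv => by rwa [hback v (hJU _ hv)] at hv) (fun v hv => by rwa [hback' v (hJU' _ hv)] at hv)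
    hm hJc hJc' (fun i => (card_filter_perm φ fun v => p v = i).symm) ?_ ?_ ?_
  · have h2 := key.comp_equiv (Equiv.arrowCongr φ.symm (Equiv.refl (Fin q)))
    have h3 : (fun τ : Conf n q => colorLaw h' ((Equiv.arrowCongr φ.symm (Equiv.refl (Fin q))) τ)) =
        colorLaw (minRep (Conn G')) := by
      funext τ
      have h4 : (Equiv.arrowCongr φ.symm (Equiv.refl (Fin q))) τ = fun v => τ (φ v) := by
        funext v; simp
      rw [h4, ← colorLaw_conj, ← ite_eq_colorLaw hq G' _ _ τ,
        ← ite_eq_colorLaw hq G' (minRep (Conn G')) (rel_iff_minRep_eq (Conn.equivalence G')) τ]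
      intro u v
      rw [φ.apply_eq_iff_eq, ← rel_iff_minRep_eq hR', hR'def]
      simp only [φ.apply_symm_apply]
      rfl
    rw [← h3]
    refine h2.mono (fun τ τ' hττ i j => ?_) le_rfl
    rw [hττ i j]
    have h4 : (Equiv.arrowCongr φ.symm (Equiv.refl (Fin q))) τ' = fun v => τ' (φ v) := by
      funext v; simp
    rw [h4]
    exact (card_filter_congr_iff fun _ => Iff.rfl).trans
      (card_filter_perm φ fun v => p v = i ∧ τ' v = j)
  · intro v
    rw [hmemT, hmemT]
    exact ⟨fun hv => (hT _ _ hv (hhv v)).2, fun hv => (hT _ _ hv (hR.symm (hhv v))).2⟩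
  · intro v
    rw [hmemT, hmemT]
    exact ⟨fun hv => (hT' _ _ hv (hhv' v)).2, fun hv => (hT' _ _ hv (hR'.symm (hhv' v))).2⟩
  · intro v hv
    rw [hmemT] at hv
    refine minRep_congr fun u => ⟨fun huv => ?_, fun huv => ?_⟩
    · have := (hT v u hv (hR.symm huv)).1
      refine hR'.symm (Conn.mono Finset.subset_union_left ?_)
      rwa [hF, conn_mapPairs]
    · exact hR.symm ((hT' v u hv (hR'.symm huv)).1.mono Finset.subset_union_left)
  · rw [Finset.disjoint_left]
    intro v hv hvT
    exact (hmemT v).1 hvT fun e he => hJU v hv e (Finset.mem_union_left _ he)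
  · rw [Finset.disjoint_left]
    intro v hv hvT
    refine (hmemT v).1 hvT ((untouched_mapPairs φ E₁ v).1 fun e he => ?_)
    exact hJU' v hv e (Finset.mem_union_left _ he)
  · refine le_trans ?_ hp
    have : #{v ∈ T | p v ≠ p (φ v)} ≤ #{v ∈ D' | p (φ v) ≠ p v} :=
      Finset.card_le_card fun v hv => Finset.mem_filter.2
        ⟨hTD (Finset.mem_filter.1 hv).1, (Finset.mem_filter.1 hv).2.symm⟩
    exact_mod_cast this
  · refine le_trans ?_ hc₂
    have : #{z ∈ Tᶜ ×ˢ Tᶜ | h z.1 = h z.2} ≤ #{z : Fin n × Fin n | Conn E₂ z.1 z.2} := by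
      refine Finset.card_le_card fun z hz => Finset.mem_filter.2 ⟨Finset.mem_univ _, ?_⟩
      rw [Finset.mem_filter, Finset.mem_product, Finset.mem_compl, Finset.mem_compl, hmemT, hmemT,
        not_not, not_not] at hz
      refine (conn_union_of_untouched hz.1.1 (fun e he => ?_) ((rel_iff_minRep_eq hR _ _).2 hz.2)).1
      exact ⟨untouched_of_notMem hE₁ (hE₂ e he).1, untouched_of_notMem hE₁ (hE₂ e he).2⟩
    exact_mod_cast this
  · refine le_trans ?_ hc₂'
    have : #{z ∈ Tᶜ ×ˢ Tᶜ | h' z.1 = h' z.2} ≤ #{z : Fin n × Fin n | Conn E₂' z.1 z.2} := by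
      refine Finset.card_le_card_of_injOn (fun z => (φ z.1, φ z.2)) (fun z hz => ?_) ?_
      · refine Finset.mem_coe.2 (Finset.mem_filter.2 ⟨Finset.mem_univ _, ?_⟩)
        rw [Finset.mem_coe, Finset.mem_filter, Finset.mem_product, Finset.mem_compl,
          Finset.mem_compl, hmemT, hmemT, not_not, not_not] at hz
        refine (conn_union_of_untouched (E₁ := F₁) ?_ (fun e he => ?_)
          ((rel_iff_minRep_eq hR' _ _).2 hz.2)).1
        · rw [hF, untouched_mapPairs]; exact hz.1.1
        · exact ⟨untouched_of_notMem hF₁ (hE₂' e he).1, untouched_of_notMem hF₁ (hE₂' e he).2⟩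
      · rintro ⟨a, b⟩ _ ⟨a', b'⟩ _ hab
        simpa using hab
    exact_mod_cast this

theorem colorLaw_nonneg {n q : ℕ} (h : Fin n → Fin n) (τ : Conf n q) : 0 ≤ colorLaw h τ :=
  Finset.sum_nonneg fun _ _ => mul_nonneg (by positivity) (by split_ifs <;> norm_num)

theorem sum_colorLaw {n q : ℕ} (hq : 1 ≤ q) (h : Fin n → Fin n) :
    ∑ τ : Conf n q, colorLaw h τ = 1 := by
  have hq' : (q : ℝ) ^ n ≠ 0 := pow_ne_zero _ (by positivity)
  simp only [colorLaw]
  rw [Finset.sum_comm]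
  simp only [← Finset.mul_sum, Finset.sum_ite_eq, Finset.mem_univ, if_true]
  rw [Finset.sum_const, Finset.card_univ, nsmul_eq_mul, card_conf]
  simp [hq']

/-- The monochromatic pairs whose common spin is not `k`. -/
def otherPairs {n q : ℕ} (X : Conf n q) (k : Fin q) : Finset (Fin n × Fin n) :=
  {e | e.1 < e.2 ∧ X e.1 = X e.2 ∧ X e.1 ≠ k}

theorem mem_otherPairs {n q : ℕ} {X : Conf n q} {k : Fin q} {e : Fin n × Fin n} :
    e ∈ otherPairs X k ↔ e.1 < e.2 ∧ X e.1 = X e.2 ∧ X e.1 ≠ k := by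
  simp [otherPairs]

theorem disjoint_pairsIn_otherPairs {n q : ℕ} (X : Conf n q) (k : Fin q) :
    Disjoint (pairsIn ({v | X v = k} : Finset (Fin n))) (otherPairs X k) := by
  rw [Finset.disjoint_left]
  intro e he he'
  exact (mem_otherPairs.1 he').2.2 (Finset.mem_filter.1 (mem_pairsIn.1 he).2.1).2

theorem monoPairs_eq_union {n q : ℕ} (X : Conf n q) (k : Fin q) :
    monoPairs X = pairsIn ({v | X v = k} : Finset (Fin n)) ∪ otherPairs X k := by
  ext e
  rw [Finset.mem_union, mem_pairsIn, mem_otherPairs, monoPairs, Finset.mem_filter]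
  simp only [Finset.mem_univ, true_and, Finset.mem_filter]
  constructor
  · rintro ⟨h1, h2⟩
    by_cases h : X e.1 = k
    · exact Or.inl ⟨h1, h, h2 ▸ h⟩
    · exact Or.inr ⟨h1, h2, h⟩
  · rintro (⟨h1, h2, h3⟩ | ⟨h1, h2, h3⟩)
    · exact ⟨h1, h2.trans h3.symm⟩
    · exact ⟨h1, h2⟩

/-- A Swendsen–Wang step percolates separately on the class of spin `k` and on the rest. -/
theorem swStep_eq_sum {n q : ℕ} (hq : 1 ≤ q) (β : ℝ) (X : Conf n q) (k : Fin q) (τ : Conf n q) :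
    swStep n q β X τ =
      ∑ E₁, percW (Real.exp (-(β / n))) (pairsIn ({v | X v = k} : Finset (Fin n))) E₁ *
        ∑ E₂, percW (Real.exp (-(β / n))) (otherPairs X k) E₂ *
          colorLaw (minRep (Conn (E₁ ∪ E₂))) τ := by
  have h1 : swStep n q β X τ = percExp (Real.exp (-(β / n))) (monoPairs X)
      (fun E => colorLaw (minRep (Conn E)) τ) := by
    refine Finset.sum_congr rfl fun E _ => ?_
    rw [ite_eq_colorLaw hq E (minRep (Conn E)) (rel_iff_minRep_eq (Conn.equivalence E))]
  rw [h1, monoPairs_eq_union X k, percExp_union _ (disjoint_pairsIn_otherPairs X k),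
    ← sum_percW_mul]
  refine Finset.sum_congr rfl fun E₁ _ => ?_
  rw [← sum_percW_mul]

theorem sum_swStep {n q : ℕ} (hq : 1 ≤ q) (β : ℝ) (X : Conf n q) :
    ∑ τ, swStep n q β X τ = 1 := by
  simp only [swStep_eq_sum hq β X ⟨0, hq⟩]
  rw [Finset.sum_comm]
  simp only [← Finset.mul_sum]
  have (E₁ : Finset (Fin n × Fin n)) : ∑ τ : Conf n q, ∑ E₂,
      percW (Real.exp (-(β / n))) (otherPairs X ⟨0, hq⟩) E₂ *
        colorLaw (minRep (Conn (E₁ ∪ E₂))) τ = 1 := by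
    rw [Finset.sum_comm]
    simp only [← Finset.mul_sum, sum_colorLaw hq, mul_one, sum_percW]
  simp only [this, mul_one, sum_percW]

theorem card_pairsAt_otherPairs_le {n q : ℕ} {X : Conf n q} {k : Fin q} {M : ℝ} (hM : 0 ≤ M)
    (h : ∀ j ≠ k, (cntN X j : ℝ) ≤ M) (v : Fin n) :
    (#(pairsAt (otherPairs X k) v) : ℝ) ≤ M := by
  by_cases hv : X v = k
  · have : pairsAt (otherPairs X k) v = ∅ := by
      refine Finset.filter_eq_empty_iff.2 fun e he hor => ?_
      obtain ⟨-, h1, h2⟩ := mem_otherPairs.1 he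
      rcases hor with rfl | rfl
      · exact h2 hv
      · exact h2 (h1.trans hv)
    rw [this]
    simpa using hM
  · refine le_trans ?_ (h _ hv)
    have hv' : v ∈ ({u | X u = X v} : Finset (Fin n)) := by simp
    have h1 : pairsAt (otherPairs X k) v ⊆
        pairsAt (pairsIn ({u | X u = X v} : Finset (Fin n))) v := by
      intro e he
      obtain ⟨he, hor⟩ := Finset.mem_filter.1 he
      obtain ⟨h0, h1, h2⟩ := mem_otherPairs.1 he
      refine Finset.mem_filter.2 ⟨mem_pairsIn.2 ⟨h0, ?_, ?_⟩, hor⟩ <;>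
      rw [Finset.mem_filter] <;> refine ⟨Finset.mem_univ _, ?_⟩ <;>
      rcases hor with rfl | rfl <;> simp [h1]
    have h2 := Finset.card_le_card h1
    rw [card_pairsAt_pairsIn hv'] at h2
    have h3 : #({u | X u = X v} : Finset (Fin n)) = cntN X (X v) := rfl
    exact_mod_cast (h2.trans (Nat.sub_le _ _)).trans_eq h3

/-- Typical isolated-vertex counts of a percolation: not too many in `U₀`, enough in every `U i`. -/
def IsoTypical {n q : ℕ} (y a L : ℝ) (S : Finset (Fin n × Fin n)) (U₀ : Finset (Fin n))
    (U : Fin q → Finset (Fin n)) (E : Finset (Fin n × Fin n)) : Prop :=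
  (isoCnt E U₀ : ℝ) ≤ isoMean y S U₀ + L * √n ∧ ∀ i, a * #(U i) - L * √n ≤ isoCnt E (U i)

theorem percProb_isoTypical_compl_le {n q : ℕ} (hn : 0 < n) {S : Finset (Fin n × Fin n)}
    (hS : ∀ e ∈ S, e.1 < e.2) (U₀ : Finset (Fin n)) (U : Fin q → Finset (Fin n)) {y a β L : ℝ}
    (hy0 : 0 ≤ y) (hy1 : y ≤ 1) (ha : a ≤ y ^ n) (hβ : (1 - y) * n ≤ β) (hL : 0 < L) :
    percProb y S (fun E => ¬ IsoTypical y a L S U₀ U E) ≤ (q + 1) * (1 + β) / L ^ 2 := by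
  have hmean (i : Fin q) : a * #(U i) ≤ isoMean y S (U i) := by
    rw [isoMean, mul_comm, ← nsmul_eq_mul]
    exact Finset.card_nsmul_le_sum _ _ _ fun v _ =>
      ha.trans (pow_le_pow_of_le_one hy0 hy1 (card_pairsAt_lt hS v).le)
  have h1 : percProb y S (fun E => ¬ IsoTypical y a L S U₀ U E) ≤
      percProb y S (fun E => L * √n < |isoCnt E U₀ - isoMean y S U₀| ∨
        ∃ i, L * √n < |isoCnt E (U i) - isoMean y S (U i)|) := by
    refine percProb_mono hy0 hy1 fun E _ hE => ?_
    by_contra hcon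
    push Not at hcon
    refine hE ⟨?_, fun i => ?_⟩
    · linarith [(abs_le.1 hcon.1).2]
    · linarith [(abs_le.1 (hcon.2 i)).1, hmean i]
  refine h1.trans ((percProb_or_le hy0 hy1 S _ _).trans ?_)
  have h2 := percProb_exists_le hy0 hy1 S
    (fun (i : Fin q) E => L * √n < |isoCnt E (U i) - isoMean y S (U i)|)
  have h3 := Finset.sum_le_sum fun (i : Fin q) (_ : i ∈ Finset.univ) =>
    percProb_isoCnt_le hn hS (U i) hy0 hy1 hβ hL
  rw [Finset.sum_const, Finset.card_univ, Fintype.card_fin, nsmul_eq_mul] at h3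
  calc _ ≤ (1 + β) / L ^ 2 + q * ((1 + β) / L ^ 2) :=
        add_le_add (percProb_isoCnt_le hn hS U₀ hy0 hy1 hβ hL) (h2.trans h3)
    _ = _ := by ring

theorem half_le_percProb_isoTypical {n q : ℕ} (hn : 0 < n) {S : Finset (Fin n × Fin n)}
    (hS : ∀ e ∈ S, e.1 < e.2) (U₀ : Finset (Fin n)) (U : Fin q → Finset (Fin n)) {y a β L : ℝ}
    (hy0 : 0 ≤ y) (hy1 : y ≤ 1) (ha : a ≤ y ^ n) (hβ : (1 - y) * n ≤ β) (hL : 0 < L)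
    (hL4 : (q + 1) * (1 + β) / L ^ 2 ≤ 1 / 4) :
    1 / 2 ≤ percProb y S (IsoTypical y a L S U₀ U) := by
  have := percProb_isoTypical_compl_le hn hS U₀ U hy0 hy1 ha hβ hL
  rw [percProb_not] at this
  linarith

theorem half_le_percProb_isoTypical_and_conn {n q : ℕ} (hn : 0 < n) {S : Finset (Fin n × Fin n)}
    (hS : ∀ e ∈ S, e.1 < e.2) (U₀ : Finset (Fin n)) (U : Fin q → Finset (Fin n))
    {y a β L M b : ℝ} (hy0 : 0 ≤ y) (hy1 : y ≤ 1) (ha : a ≤ y ^ n) (hβ : (1 - y) * n ≤ β)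
    (hL : 0 < L) (hL4 : (q + 1) * (1 + β) / L ^ 2 ≤ 1 / 4) (hb : 0 < b)
    (hMb : (1 - y) * M ≤ 1 - b) (hM : ∀ v, (#(pairsAt S v) : ℝ) ≤ M) :
    1 / 2 ≤ percProb y S (fun E => IsoTypical y a L S U₀ U E ∧
      (#{z : Fin n × Fin n | Conn E z.1 z.2} : ℝ) ≤ 4 / b * n) := by
  have h1 := percProb_isoTypical_compl_le hn hS U₀ U hy0 hy1 ha hβ hL
  have h2 := percProb_card_conn_le hn hy0 hy1 hb hMb S hM (K := 4 / b) (by positivity)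
  have h3 : 1 / (4 / b * b) = 1 / 4 := by field_simp
  rw [h3] at h2
  have h4 := percProb_or_le hy0 hy1 S (fun E => ¬ IsoTypical y a L S U₀ U E)
    (fun E => 4 / b * n < #{z : Fin n × Fin n | Conn E z.1 z.2})
  have h5 := percProb_mono hy0 hy1 (S := S)
    (A := fun E => ¬ (IsoTypical y a L S U₀ U E ∧
      (#{z : Fin n × Fin n | Conn E z.1 z.2} : ℝ) ≤ 4 / b * n))
    (B := fun E => ¬ IsoTypical y a L S U₀ U E ∨
      4 / b * n < #{z : Fin n × Fin n | Conn E z.1 z.2})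
    (fun E _ hE => by rwa [not_and_or, not_le] at hE)
  rw [percProb_not] at h5
  linarith

theorem isoMean_pairsIn {n : ℕ} (y : ℝ) (D : Finset (Fin n)) :
    isoMean y (pairsIn D) D = #D * y ^ (#D - 1) := by
  rw [isoMean, Finset.sum_congr rfl fun v hv => by rw [card_pairsAt_pairsIn hv],
    Finset.sum_const, nsmul_eq_mul]

theorem isoCnt_add_isoCnt_le {n q : ℕ} {D : Finset (Fin n)} {E₁ E₂ : Finset (Fin n × Fin n)}
    (p : Fin n → Fin q) (i : Fin q) (hE₁ : E₁ ⊆ pairsIn D) (hE₂ : ∀ e ∈ E₂, e.1 ∉ D ∧ e.2 ∉ D) :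
    isoCnt E₁ {v ∈ D | p v = i} + isoCnt E₂ {v | v ∉ D ∧ p v = i} ≤
      #{v | p v = i ∧ Untouched (E₁ ∪ E₂) v} := by
  rw [isoCnt, isoCnt, ← Finset.card_union_of_disjoint]
  · refine Finset.card_le_card fun v hv => ?_
    simp only [Finset.mem_union, Finset.mem_filter, Finset.mem_univ, true_and] at hv ⊢
    rcases hv with ⟨⟨hD, hp⟩, hv⟩ | ⟨⟨hD, hp⟩, hv⟩ <;> refine ⟨hp, fun e he => ?_⟩ <;>
      rcases Finset.mem_union.1 he with he | he
    · exact hv e he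
    · exact ⟨fun h => (hE₂ e he).1 (h ▸ hD), fun h => (hE₂ e he).2 (h ▸ hD)⟩
    · exact untouched_of_notMem hE₁ hD e he
    · exact hv e he
  · rw [Finset.disjoint_left]
    intro v hv hv'
    simp only [Finset.mem_filter, Finset.mem_univ, true_and] at hv hv'
    exact hv'.1.1 hv.1.1

theorem isoCnt_le_isoCnt_mapPairs {n q : ℕ} {D' D : Finset (Fin n)} {E : Finset (Fin n × Fin n)}
    (p : Fin n → Fin q) (i : Fin q) {φ : Equiv.Perm (Fin n)} (hφ : ∀ v ∈ D', φ v ∈ D) :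
    isoCnt E {v ∈ D' | p v = i} ≤
      isoCnt (mapPairs φ E) {v ∈ D | p v = i} + #{v ∈ D' | p (φ v) ≠ p v} := by
  rw [isoCnt, isoCnt]
  have h1 : #{v ∈ {v ∈ D' | p v = i} | Untouched E v} ≤
      #({v ∈ {v ∈ D' | p (φ v) = i} | Untouched E v} ∪ {v ∈ D' | p (φ v) ≠ p v}) := by
    refine Finset.card_le_card fun v hv => ?_
    simp only [Finset.mem_union, Finset.mem_filter] at hv ⊢
    by_cases h : p (φ v) = p v
    · exact Or.inl ⟨⟨hv.1.1, h.trans hv.1.2⟩, hv.2⟩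
    · exact Or.inr ⟨hv.1.1, h⟩
  refine h1.trans ((Finset.card_union_le _ _).trans (Nat.add_le_add_right ?_ _))
  refine Finset.card_le_card_of_injOn φ (fun v hv => ?_) φ.injective.injOn
  simp only [Finset.mem_coe, Finset.mem_filter] at hv ⊢
  exact ⟨⟨hφ v hv.1.1, hv.1.2⟩, (untouched_mapPairs φ E v).2 hv.2⟩

/-- Conditionally on coupled percolations of the dominant classes, the rest of the Swendsen–Wang
step can be coupled so that the projections agree. -/
theorem exists_swStep_rest_subC {q : ℕ} (hq : 1 ≤ q) {lam a L K : ℝ} (hlam : 0 < lam) (ha : 0 < a)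
    (ha1 : a ≤ 1) (hL : 0 ≤ L) (hK : 0 ≤ K) :
    ∃ ρ : ℝ, 0 < ρ ∧ ∃ N : ℕ, ∀ n : ℕ, N ≤ n → ∀ (p : Fin n → Fin q) (D' D : Finset (Fin n))
      (S' S : Finset (Fin n × Fin n)) (y : ℝ) (E₁ : Finset (Fin n × Fin n))
      (φ : Equiv.Perm (Fin n)), 0 ≤ y → y ≤ 1 →
      (∀ i, lam * n ≤ #{v | p v = i}) →
      (∀ i, |(#{v ∈ D | p v = i} : ℝ) - #{v ∈ D' | p v = i}| ≤ K * √n) →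
      (∀ e ∈ S', e.1 ∉ D' ∧ e.2 ∉ D') → (∀ e ∈ S, e.1 ∉ D ∧ e.2 ∉ D) →
      E₁ ⊆ pairsIn D' → (∀ v ∈ D', φ v ∈ D) → (#{v ∈ D' | p (φ v) ≠ p v} : ℝ) ≤ K * √n →
      IsoTypical y a L (pairsIn D') D' (fun i => {v ∈ D' | p v = i}) E₁ →
      1 / 2 ≤ percProb y S' (fun E => IsoTypical y a L S' ∅ (fun i => {v | v ∉ D' ∧ p v = i}) E ∧
        (#{z : Fin n × Fin n | Conn E z.1 z.2} : ℝ) ≤ K * n) →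
      1 / 2 ≤ percProb y S (fun E => IsoTypical y a L S ∅ (fun i => {v | v ∉ D ∧ p v = i}) E ∧
        (#{z : Fin n × Fin n | Conn E z.1 z.2} : ℝ) ≤ K * n) →
      SubC (fun τ : Conf n q => ∑ E₂, percW y S' E₂ * colorLaw (minRep (Conn (E₁ ∪ E₂))) τ)
        (fun τ : Conf n q => ∑ E₂, percW y S E₂ *
          colorLaw (minRep (Conn (mapPairs φ E₁ ∪ E₂))) τ)
        (fun τ τ' => ∀ i j, #{v | p v = i ∧ τ v = j} = #{v | p v = i ∧ τ' v = j}) ρ := by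
  have hq0 : (0 : ℝ) < q := by positivity
  set c : ℝ := a * lam / (2 * q) with hc
  have hc0 : 0 < c := by positivity
  obtain ⟨ρ, hρ, N, hN⟩ := exists_conn_colorLaw_subC hq (half_pos hc0) hK
  set T : ℝ := 2 * (2 * L + 2 * K) / (a * lam) with hT
  have hT0 : 0 ≤ T := by positivity
  refine ⟨1 / 2 * (1 / 2) * ρ, by positivity, max N (max ⌈2 / c⌉₊ ⌈T ^ 2⌉₊), ?_⟩
  intro n hn p D' D S' S y E₁ φ hy0 hy1 hp hDD hS' hS hE₁ hφ hφp hE₁t hP' hP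
  have hnN : N ≤ n := (le_max_left _ _).trans hn
  have hnc : 2 / c ≤ n := Nat.ceil_le.1 ((le_max_left _ _).trans ((le_max_right _ _).trans hn))
  have hnT : T ^ 2 ≤ n := Nat.ceil_le.1 ((le_max_right _ _).trans ((le_max_right _ _).trans hn))
  have hTn : T ≤ √n := Real.le_sqrt_of_sq_le hnT
  have hs0 : 0 ≤ √(n : ℝ) := Real.sqrt_nonneg _
  have hss : √(n : ℝ) * √n = n := Real.mul_self_sqrt (Nat.cast_nonneg n)
  have hbig : (2 * L + 2 * K) * √n ≤ a * lam * n / 2 := by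
    have h1 : 2 * (2 * L + 2 * K) ≤ √n * (a * lam) := (div_le_iff₀ (by positivity)).1 hTn
    have h2 := mul_le_mul_of_nonneg_right h1 hs0
    have h3 : √n * (a * lam) * √n = a * lam * n := by
      rw [mul_right_comm, hss]; ring
    linarith
  set m := ⌊c * n⌋₊ with hm
  have hmn : c / 2 * n ≤ m := by
    have h1 := Nat.lt_floor_add_one (c * (n : ℝ))
    have h2 : 2 ≤ n * c := (div_le_iff₀ hc0).1 hnc
    rw [← hm] at h1
    linarith
  have hqm : (q : ℝ) * m ≤ a * lam * n / 2 := by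
    calc (q : ℝ) * m ≤ q * (c * n) :=
          mul_le_mul_of_nonneg_left (Nat.floor_le (by positivity)) hq0.le
      _ = _ := by rw [hc]; field_simp
  have hsplit (D : Finset (Fin n)) (i : Fin q) :
      (#{v ∈ D | p v = i} : ℝ) + #{v | v ∉ D ∧ p v = i} = #{v | p v = i} := by
    have h1 : #{v ∈ D | p v = i} + #{v | v ∉ D ∧ p v = i} = #{v | p v = i} := by
      rw [← Finset.card_filter_add_card_filter_not (s := ({v | p v = i} : Finset (Fin n)))
        (fun v => v ∈ D)]
      congr 2 <;> ext v <;> simp [and_comm]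
    exact_mod_cast h1
  have hind := SubC.indep (percW_nonneg hy0 hy1 S') (percW_nonneg hy0 hy1 S)
    (sum_percW y S').le (sum_percW y S).le
    (fun E => E ⊆ S' ∧ IsoTypical y a L S' ∅ (fun i => {v | v ∉ D' ∧ p v = i}) E ∧
      (#{z : Fin n × Fin n | Conn E z.1 z.2} : ℝ) ≤ K * n)
    (fun E => E ⊆ S ∧ IsoTypical y a L S ∅ (fun i => {v | v ∉ D ∧ p v = i}) E ∧
      (#{z : Fin n × Fin n | Conn E z.1 z.2} : ℝ) ≤ K * n)
    (ρ₁ := 1 / 2) (ρ₂ := 1 / 2) (by norm_num)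
    (by
      rw [sum_ite_percW]
      exact hP'.trans (percProb_mono hy0 hy1 fun E hE h => ⟨hE, h⟩))
    (by
      rw [sum_ite_percW]
      exact hP.trans (percProb_mono hy0 hy1 fun E hE h => ⟨hE, h⟩))
  refine hind.mixture (fun _ _ => colorLaw_nonneg _ _) (fun _ _ => colorLaw_nonneg _ _) hρ.le ?_
  rintro E₂ E₂' ⟨⟨hE₂S, hE₂t, hE₂c⟩, ⟨hE₂S', hE₂t', hE₂c'⟩⟩
  refine hN n hnN p D' D E₁ E₂ E₂' φ m hE₁ hφ (fun e he => hS' e (hE₂S he))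
    (fun e he => hS e (hE₂S' he)) hmn (fun i => ?_) (fun i => ?_) hφp hE₂c hE₂c'
  · have h1 := isoCnt_add_isoCnt_le p i hE₁ (fun e he => hS' e (hE₂S he))
    refine le_trans ?_ h1
    have h2 := hE₁t.2 i
    have h3 := hE₂t.2 i
    have h4 : a * (lam * n) ≤ a * #{v | p v = i} := mul_le_mul_of_nonneg_left (hp i) ha.le
    rw [← hsplit D' i, mul_add] at h4
    have h5 : (q : ℝ) * m ≤ isoCnt E₁ {v ∈ D' | p v = i} + isoCnt E₂ {v | v ∉ D' ∧ p v = i} := by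
      have : 0 ≤ K * √(n : ℝ) := mul_nonneg hK hs0
      linarith
    exact_mod_cast h5
  · have h1 := isoCnt_add_isoCnt_le p i (mapPairs_subset_pairsIn hφ hE₁)
      (fun e he => hS e (hE₂S' he))
    refine le_trans ?_ h1
    have h2 := hE₁t.2 i
    have h3 := hE₂t'.2 i
    have h4 : a * (lam * n) ≤ a * #{v | p v = i} := mul_le_mul_of_nonneg_left (hp i) ha.le
    rw [← hsplit D i, mul_add] at h4
    have h6 : (isoCnt E₁ {v ∈ D' | p v = i} : ℝ) ≤
        isoCnt (mapPairs φ E₁) {v ∈ D | p v = i} + #{v ∈ D' | p (φ v) ≠ p v} := by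
      exact_mod_cast isoCnt_le_isoCnt_mapPairs p i hφ
    have h7 : a * (#{v ∈ D | p v = i} - #{v ∈ D' | p v = i} : ℝ) ≤ 1 * (K * √n) :=
      (mul_le_mul_of_nonneg_left (abs_le.1 (hDD i)).2 ha.le).trans
        (mul_le_mul_of_nonneg_right ha1 (mul_nonneg hK hs0))
    have h5 : (q : ℝ) * m ≤ isoCnt (mapPairs φ E₁) {v ∈ D | p v = i} +
        isoCnt E₂' {v | v ∉ D ∧ p v = i} := by
      linarith
    exact_mod_cast h5

/-- Swendsen–Wang steps from two configurations near the majority phase can be coupled so that the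
type counts agree, when the dominant class of the first is at most that of the second. -/
theorem exists_swStep_subC {q : ℕ} (hq : 2 ≤ q) {β : ℝ} (hβ : (q : ℝ) < β) {lam : ℝ}
    (hlam : 0 < lam) {C : ℝ} (hC : 0 < C) :
    ∃ ρ : ℝ, 0 < ρ ∧ ∃ N : ℕ, ∀ n : ℕ, N ≤ n → ∀ (p : Fin n → Fin q) (Y X : Conf n q)
      (l k : Fin q), (∀ i, lam * n ≤ #{v | p v = i}) →
      (∀ j, cntN Y j ≤ cntN Y l) → (∀ j, cntN X j ≤ cntN X k) →
      linf (alphaVec Y) (mVec q β) ≤ C / √n → linf (alphaVec X) (mVec q β) ≤ C / √n →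
      (∀ i, |(#{v | p v = i ∧ X v = k} : ℝ) - #{v | p v = i ∧ Y v = l}| ≤ C * √n) →
      cntN Y l ≤ cntN X k →
      SubC (swStep n q β Y) (swStep n q β X)
        (fun τ τ' => ∀ i j, #{v | p v = i ∧ τ v = j} = #{v | p v = i ∧ τ' v = j}) ρ := by
  have hq1 : 1 ≤ q := by lia
  have hq0 : (0 : ℝ) < q := by positivity
  have hβ0 : 0 < β := hq0.trans hβ
  set s : ℝ := (1 - aFix q β) / (q - 1) with hs
  have hs1 : β * s < 1 := mul_one_sub_aFix_lt hq hβ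
  set b : ℝ := (1 - β * s) / 2 with hb
  have hb0 : 0 < b := by rw [hb]; linarith
  set L : ℝ := 4 * (q + 1) * (1 + β) with hL
  have hL0 : 0 < L := by positivity
  have hL4 : (q + 1) * (1 + β) / L ^ 2 ≤ 1 / 4 := by
    rw [div_le_iff₀ (by positivity), hL]
    have : 1 ≤ (q + 1) * (1 + β) := by nlinarith
    nlinarith
  set K : ℝ := 4 / b + C + q * (C + q * C) with hK
  have hK0 : 0 ≤ K := by positivity
  obtain ⟨ε, hε0, hε1, n₀, hε⟩ := exists_giant_const (K := q * C) (C := L) hβ0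
    (one_div_pos.2 hq0) (by positivity) hL0.le
  obtain ⟨ρ, hρ, N, hN⟩ := exists_swStep_rest_subC hq1 hlam (Real.exp_pos (-β))
    (Real.exp_le_one_iff.2 (by linarith)) hL0.le hK0
  refine ⟨ε * (1 / 2) * ρ, by positivity, max (max 1 n₀) (max N ⌈(β * C / b) ^ 2⌉₊), ?_⟩
  intro n hn p Y X l k hp hl hk hY hX hYX hle
  have hn1 : 0 < n := (le_max_left _ _).trans ((le_max_left _ _).trans hn)
  have hn₀ : n₀ ≤ n := (le_max_right _ _).trans ((le_max_left _ _).trans hn)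
  have hnN : N ≤ n := (le_max_left _ _).trans ((le_max_right _ _).trans hn)
  have hnb : (β * C / b) ^ 2 ≤ n :=
    Nat.ceil_le.1 ((le_max_right _ _).trans ((le_max_right _ _).trans hn))
  have hnR : (0 : ℝ) < n := by exact_mod_cast hn1
  have hs0 : 0 < √(n : ℝ) := Real.sqrt_pos.2 hnR
  have hss : √(n : ℝ) * √n = n := Real.mul_self_sqrt hnR.le
  have hbn : β * C / √n ≤ b := by
    rw [div_le_iff₀ hs0, mul_comm b, ← div_le_iff₀ hb0]
    exact Real.le_sqrt_of_sq_le hnb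
  set y : ℝ := Real.exp (-(β / n)) with hy
  have hy0 : 0 ≤ y := (Real.exp_pos _).le
  have hy1 : y ≤ 1 := Real.exp_le_one_iff.2 (neg_nonpos.2 (by positivity))
  have hyβ' : 1 - y ≤ β / n := by
    have := Real.add_one_le_exp (-(β / n))
    rw [hy]; linarith
  have hyβ : (1 - y) * n ≤ β := (le_div_iff₀ hnR).1 hyβ'
  have hyn : Real.exp (-β) ≤ y ^ n := by
    rw [hy, ← Real.exp_nat_mul]
    exact Real.exp_le_exp.2 (by field_simp; rfl)
  have hlt (D : Finset (Fin n)) : ∀ e ∈ pairsIn D, e.1 < e.2 := fun e he => (mem_pairsIn.1 he).1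
  have hcls (Z : Conf n q) (j : Fin q) : #({v | Z v = j} : Finset (Fin n)) = cntN Z j := rfl
  set M : ℝ := n * (s + C / √n) with hM
  have hMy (hM0 : 0 ≤ M) : (1 - y) * M ≤ 1 - b := by
    have h1 : β / n * M = β * s + β * C / √n := by rw [hM]; field_simp
    have h2 := mul_le_mul_of_nonneg_right hyβ' hM0
    have h3 : 2 * b = 1 - β * s := by rw [hb]; ring
    linarith
  have hside (Z : Conf n q) (j : Fin q) (hj : ∀ i, cntN Z i ≤ cntN Z j)
      (hZ : linf (alphaVec Z) (mVec q β) ≤ C / √n) :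
      1 / 2 ≤ percProb y (otherPairs Z j) (fun E => IsoTypical y (Real.exp (-β)) L (otherPairs Z j)
        ∅ (fun i => {v | v ∉ ({v | Z v = j} : Finset (Fin n)) ∧ p v = i}) E ∧
        (#{z : Fin n × Fin n | Conn E z.1 z.2} : ℝ) ≤ K * n) := by
    have hM1 : ∀ i ≠ j, (cntN Z i : ℝ) ≤ M := by
      intro i hi
      have := cntFrac_le_of_linf_le hZ hj hi
      rw [cntFrac, div_le_iff₀ hnR] at this
      rw [hM, mul_comm]
      exact this
    have hM0 : 0 ≤ M := by
      have : Nontrivial (Fin q) := Fin.nontrivial_iff_two_le.2 hq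
      obtain ⟨i, hi⟩ := exists_ne j
      exact (Nat.cast_nonneg _).trans (hM1 i hi)
    refine (half_le_percProb_isoTypical_and_conn hn1 (fun e he => (mem_otherPairs.1 he).1) ∅ _
      hy0 hy1 hyn hyβ hL0 hL4 hb0 (hMy hM0) (card_pairsAt_otherPairs_le hM0 hM1)).trans
      (percProb_mono hy0 hy1 fun E _ hE => ⟨hE.1, hE.2.trans ?_⟩)
    refine mul_le_mul_of_nonneg_right ?_ hnR.le
    rw [hK]
    have : 0 ≤ C + q * (C + q * C) := by positivity
    linarith
  set D' : Finset (Fin n) := {v | Y v = l} with hD'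
  set D : Finset (Fin n) := {v | X v = k} with hD
  have hfib (D : Finset (Fin n)) : #D = ∑ i, #{v ∈ D | p v = i} :=
    Finset.card_eq_sum_card_fiberwise fun v _ => Finset.mem_coe.2 (Finset.mem_univ (p v))
  have hDi (i : Fin q) : |(#{v ∈ D | p v = i} : ℝ) - #{v ∈ D' | p v = i}| ≤ C * √n := by
    convert hYX i using 4 <;>
      (congr 1; ext v; simp [hD, hD', and_comm])
  obtain ⟨d, hd⟩ := Nat.exists_eq_add_of_le hle
  rw [← hcls, ← hcls, ← hD, ← hD'] at hd
  have hDn : #D ≤ n := (Finset.card_le_univ D).trans_eq (Fintype.card_fin n)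
  have hDq : 1 / (q : ℝ) * n ≤ #D := by
    have : (n : ℝ) ≤ q * #D := by exact_mod_cast card_le_mul_cntN hk
    rw [one_div, inv_mul_le_iff₀ hq0]
    exact this
  have hD0 : 0 < #D := by
    have : (0 : ℝ) < #D := lt_of_lt_of_le (by positivity) hDq
    exact_mod_cast this
  have hdC : (d : ℝ) ≤ q * C * √n := by
    have h1 : (d : ℝ) = ∑ i, ((#{v ∈ D | p v = i} : ℝ) - #{v ∈ D' | p v = i}) := by
      rw [Finset.sum_sub_distrib, ← Nat.cast_sum, ← Nat.cast_sum, ← hfib, ← hfib, hd]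
      push_cast; ring
    rw [h1]
    refine (Finset.sum_le_card_nsmul _ _ (C * √n) fun i _ => (abs_le.1 (hDi i)).2).trans_eq ?_
    rw [Finset.card_univ, Fintype.card_fin, nsmul_eq_mul, mul_assoc]
  have hgiant := percW_pairsIn_subC p hd hD0 hy0 hy1 hε0.le hε1
    (A := IsoTypical y (Real.exp (-β)) L (pairsIn D') D' (fun i => {v ∈ D' | p v = i}))
    (α := #D' * y ^ (#D' - 1) + L * √n + d)
    (fun E _ hE => by
      have := hE.1
      rw [isoMean_pairsIn] at this
      linarith)
    (hε n hn₀ _ _ d hd hDn hDq hdC)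
  have hhalf : 1 / 2 ≤ percProb y (pairsIn D')
      (IsoTypical y (Real.exp (-β)) L (pairsIn D') D' (fun i => {v ∈ D' | p v = i})) :=
    half_le_percProb_isoTypical hn1 (hlt D') _ _ hy0 hy1 hyn hyβ hL0 hL4
  have havoid (Z : Conf n q) (j : Fin q) : ∀ e ∈ otherPairs Z j,
      e.1 ∉ ({v | Z v = j} : Finset (Fin n)) ∧ e.2 ∉ ({v | Z v = j} : Finset (Fin n)) := by
    intro e he
    obtain ⟨-, h1, h2⟩ := mem_otherPairs.1 he
    simp only [Finset.mem_filter, Finset.mem_univ, true_and]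
    exact ⟨h2, h1 ▸ h2⟩
  have hstep := (hgiant.mono (fun _ _ h => h) (mul_le_mul_of_nonneg_left hhalf hε0.le)).mixture
    (F := fun E₁ (τ : Conf n q) => ∑ E₂, percW y (otherPairs Y l) E₂ *
      colorLaw (minRep (Conn (E₁ ∪ E₂))) τ)
    (G := fun E₁ (τ : Conf n q) => ∑ E₂, percW y (otherPairs X k) E₂ *
      colorLaw (minRep (Conn (E₁ ∪ E₂))) τ)
    (R := fun τ τ' => ∀ i j, #{v | p v = i ∧ τ v = j} = #{v | p v = i ∧ τ' v = j})
    (fun _ _ => Finset.sum_nonneg fun E _ => mul_nonneg (percW_nonneg hy0 hy1 _ E)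
      (colorLaw_nonneg _ _))
    (fun _ _ => Finset.sum_nonneg fun E _ => mul_nonneg (percW_nonneg hy0 hy1 _ E)
      (colorLaw_nonneg _ _)) hρ.le ?_
  · convert hstep using 1
    · funext τ
      exact swStep_eq_sum hq1 β Y l τ
    · funext τ
      exact swStep_eq_sum hq1 β X k τ
  · rintro E₁ F₁ ⟨hE₁t, hE₁, φ, hφ, hφp, rfl⟩
    have hCK : C * √(n : ℝ) ≤ K * √n := by
      refine mul_le_mul_of_nonneg_right ?_ hs0.le
      rw [hK]
      have : 0 ≤ 4 / b + q * (C + q * C) := by positivity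
      linarith
    refine hN n hnN p D' D _ _ y E₁ φ hy0 hy1 hp (fun i => (hDi i).trans hCK) (havoid Y l)
      (havoid X k) hE₁ hφ ?_ hE₁t (hside Y l hl hY) (hside X k hk hX)
    have h1 : (#{v ∈ D' | p (φ v) ≠ p v} : ℝ) ≤
        ∑ i : Fin q, ((#{v ∈ D' | p v = i} - (#{v ∈ D | p v = i} - d) : ℕ) : ℝ) := by
      exact_mod_cast hφp
    refine h1.trans ((Finset.sum_le_card_nsmul _ _ (C * √n + q * C * √n) fun i _ => ?_).trans ?_)
    · have h2 := (abs_le.1 (hDi i)).1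
      have h3 : #{v ∈ D' | p v = i} - (#{v ∈ D | p v = i} - d) ≤
          (#{v ∈ D' | p v = i} - #{v ∈ D | p v = i}) + d := by lia
      have h4 : ((#{v ∈ D' | p v = i} - #{v ∈ D | p v = i} : ℕ) : ℝ) ≤ C * √n := by
        rcases le_total (#{v ∈ D' | p v = i}) (#{v ∈ D | p v = i}) with h | h
        · rw [Nat.sub_eq_zero_of_le h, Nat.cast_zero]; positivity
        · rw [Nat.cast_sub h]; linarith
      have h5 : ((#{v ∈ D' | p v = i} - (#{v ∈ D | p v = i} - d) : ℕ) : ℝ) ≤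
          (#{v ∈ D' | p v = i} - #{v ∈ D | p v = i} : ℕ) + d := by exact_mod_cast h3
      linarith
    · rw [Finset.card_univ, Fintype.card_fin, nsmul_eq_mul]
      have : q * (C * √n + q * C * √n) = q * (C + q * C) * √n := by ring
      rw [this]
      refine mul_le_mul_of_nonneg_right ?_ hs0.le
      rw [hK]
      have : 0 ≤ 4 / b + C := by positivity
      linarith

theorem abs_card_sub_le_of_abs_alpha1In_sub_le {n q : ℕ} {X Y : Conf n q} {V : Finset (Fin n)}
    {k l : Fin q} (hk : ∀ v, (X v : ℕ) = domIdx X ↔ X v = k)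
    (hl : ∀ v, (Y v : ℕ) = domIdx Y ↔ Y v = l) {C : ℝ} (hC : 0 ≤ C) (hV : 0 < #V)
    (h : |alpha1In X V - alpha1In Y V| ≤ C / √(#V)) :
    |(#{v ∈ V | X v = k} : ℝ) - #{v ∈ V | Y v = l}| ≤ C * √n := by
  have hV' : (0 : ℝ) < #V := by exact_mod_cast hV
  have hX : #(V.filter fun v => (X v : ℕ) = domIdx X) = #{v ∈ V | X v = k} :=
    card_filter_congr_iff hk
  have hY : #(V.filter fun v => (Y v : ℕ) = domIdx Y) = #{v ∈ V | Y v = l} :=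
    card_filter_congr_iff hl
  rw [alpha1In, alpha1In, hX, hY, ← sub_div, abs_div, abs_of_pos hV', div_le_iff₀ hV'] at h
  calc _ ≤ C / √(#V) * #V := h
    _ = C * √(#V) := by rw [div_mul_eq_mul_div, mul_div_assoc, Real.div_sqrt]
    _ ≤ C * √n := mul_le_mul_of_nonneg_left (Real.sqrt_le_sqrt (by
        exact_mod_cast (Finset.card_le_univ V).trans_eq (Fintype.card_fin n))) hC

/-- Lemma 3.4: under assumptions A1–A2 there is a one-step coupling
of the SW dynamics from `X` and from `Y` whose projections agree after one step
with probability at least a constant `ρ > 0`. -/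
theorem sw_projection_coupling (q : ℕ) (hq : 2 ≤ q) (β : ℝ) (hβ : (q : ℝ) < β)
    (lam : ℝ) (hlam : lam ∈ Set.Ioo (0 : ℝ) 1) (Chat : ℝ) (hChat : 0 < Chat) :
    ∃ ρ : ℝ, 0 < ρ ∧ ∃ N : ℕ, ∀ n : ℕ, N ≤ n →
      ∀ P : Fin q → Finset (Fin n), IsLamPartition lam P →
      ∀ X Y : Conf n q,
        linf (alphaVec X) (mVec q β) ≤ Chat / Real.sqrt n →
        linf (alphaVec Y) (mVec q β) ≤ Chat / Real.sqrt n →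
        (∀ i : Fin q, |alpha1In X (P i) - alpha1In Y (P i)| ≤
          Chat / Real.sqrt ((P i).card)) →
        ∃ μc : Conf n q × Conf n q → ℝ,
          (∀ z, 0 ≤ μc z) ∧
          (∀ x' : Conf n q, ∑ y' : Conf n q, μc (x', y') = swStep n q β X x') ∧
          (∀ y' : Conf n q, ∑ x' : Conf n q, μc (x', y') = swStep n q β Y y') ∧
          ρ ≤ ∑ z : Conf n q × Conf n q,
            (if projCnt P z.1 = projCnt P z.2 then μc z else 0) := by
  obtain ⟨ρ, hρ, N, hN⟩ := exists_swStep_subC hq hβ hlam.1 hChat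
  refine ⟨ρ, hρ, max 1 N, fun n hn P hP X Y hX hY hXY => ?_⟩
  have hq1 : 1 ≤ q := by lia
  have hn1 : 0 < n := (le_max_left _ _).trans hn
  have hnN : N ≤ n := (le_max_right _ _).trans hn
  obtain ⟨k, hk, hk'⟩ := exists_eq_domIdx hq1 X
  obtain ⟨l, hl, hl'⟩ := exists_eq_domIdx hq1 Y
  choose p hp using hP.1.2
  have hpi (v : Fin n) (i : Fin q) : v ∈ P i ↔ p v = i := by
    refine ⟨fun hv => ?_, fun h => h ▸ hp v⟩
    by_contra hne
    exact Finset.disjoint_left.1 (hP.1.1 _ _ hne) (hp v) hv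
  have hPi (i : Fin q) : P i = ({v | p v = i} : Finset (Fin n)) := by
    ext v
    simp [hpi]
  have hcard (i : Fin q) : lam * n ≤ #{v | p v = i} := by
    rw [← hPi]
    exact hP.2 i
  have hproj (τ : Conf n q) (i j : Fin q) :
      projCnt P τ i j = #{v | p v = i ∧ τ v = j} := by
    rw [projCnt, hPi, Finset.filter_filter]
  have hdiff (i : Fin q) :
      |(#{v | p v = i ∧ X v = k} : ℝ) - #{v | p v = i ∧ Y v = l}| ≤ Chat * √n := by
    have hpos : 0 < #(P i) := by
      have := hP.2 i
      have h0 : 0 < lam * n := mul_pos hlam.1 (by exact_mod_cast hn1)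
      exact_mod_cast h0.trans_le this
    have := abs_card_sub_le_of_abs_alpha1In_sub_le hk hl hChat.le hpos (hXY i)
    simpa only [hPi, Finset.filter_filter] using this
  have hsub : SubC (swStep n q β X) (swStep n q β Y)
      (fun τ τ' => projCnt P τ = projCnt P τ') ρ := by
    rcases le_total (cntN Y l) (cntN X k) with hle | hle
    · refine (hN n hnN p Y X l k hcard hl' hk' hY hX hdiff hle).symm.mono
        (fun τ τ' h => ?_) le_rfl
      funext i j
      rw [hproj, hproj]
      exact (h i j).symm
    · refine (hN n hnN p X Y k l hcard hk' hl' hX hY (fun i => ?_) hle).mono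
        (fun τ τ' h => ?_) le_rfl
      · rw [abs_sub_comm]
        exact hdiff i
      · funext i j
        rw [hproj, hproj]
        exact h i j
  obtain ⟨μ, h0, h1, h2, h3⟩ := hsub.exists_coupling (sum_swStep hq1 β X) (sum_swStep hq1 β Y)
  refine ⟨μ, h0, h1, h2, h3.trans_eq ?_⟩
  exact Finset.sum_congr rfl fun z _ => by congr
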